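/- Let k be any field, R = k[t,u,x,y]/(xy − tu − 1), and let P, Q ∈ k[t,x,y] be polynomials which are variables of the k(t)-algebra k(t)[x,y] and such that R/(P·R) and R/(Q·R) are isomorphic as k-algebras to the polynomial ring in two variables over k (i.e., the hypersurfaces H_P, H_Q ⊂ SL₂ given by P = 0 and Q = 0 are isomorphic to 𝔸²). If there exists a k-algebra automorphism Φ of R with Φ(P·R) = Q·R (i.e., H_P and H_Q are equivalent under an automorphism of SL₂), then there exists a k-algebra automorphism ψ of k[t,x,y] with ψ(P·k[t,x,y]) = Q·k[t,x,y] (i.e., the hypersurfaces Z_P, Z_Q ⊂ 𝔸³ given by P = 0 and Q = 0 are equivalent under an automorphism of 𝔸³). -/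

import Mathlib

open MvPolynomial

noncomputable section

variable (k : Type*) [Field k]

/-- The polynomial `x*y - t*u - 1` defining `SL₂` inside `𝔸⁴ = Spec k[t,u,x,y]`
(variables: `0 = t`, `1 = u`, `2 = x`, `3 = y`). -/
def sl2Rel : MvPolynomial (Fin 4) k := X 2 * X 3 - X 0 * X 1 - 1

/-- The coordinate ring `R = k[t,u,x,y]/(xy - tu - 1)` of `SL₂`. -/
abbrev SL2Ring : Type _ := MvPolynomial (Fin 4) k ⧸ Ideal.span {sl2Rel k}

/-- `B = k[t,x,y]` (variables: `0 = t`, `1 = x`, `2 = y`). -/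
abbrev B3 : Type _ := MvPolynomial (Fin 3) k

/-- The comorphism `η* : k[t,x,y] → R` of `η : SL₂ → 𝔸³`, `(t,u,x,y) ↦ (t,x,y)`. -/
def etaStar : B3 k →ₐ[k] SL2Ring k :=
  aeval ![Ideal.Quotient.mk (Ideal.span {sl2Rel k}) (X 0),
          Ideal.Quotient.mk (Ideal.span {sl2Rel k}) (X 2),
          Ideal.Quotient.mk (Ideal.span {sl2Rel k}) (X 3)]

/-- The inclusion `k[t,x,y] → k(t)[x,y]`, `t ↦ t`, `x ↦ x`, `y ↦ y`. -/
def toRatFuncXY : B3 k →ₐ[k] MvPolynomial (Fin 2) (RatFunc k) :=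
  aeval ![MvPolynomial.C (algebraMap (Polynomial k) (RatFunc k) Polynomial.X), X 0, X 1]

/-- `P ∈ k[t,x,y]` is a variable of the `k(t)`-algebra `k(t)[x,y]`: some `k(t)`-algebra
automorphism of `k(t)[x,y]` sends `P` to `x`. -/
def IsVarOverRatFunc (P : B3 k) : Prop :=
  ∃ ψ : MvPolynomial (Fin 2) (RatFunc k) ≃ₐ[RatFunc k] MvPolynomial (Fin 2) (RatFunc k),
    ψ (toRatFuncXY k P) = X 0

section
section
namespace SLP

variable {k : Type*} [Field k]

/-! ### generators of `R` -/

def tR : SL2Ring k := Ideal.Quotient.mk (Ideal.span {sl2Rel k}) (X 0)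
def uR : SL2Ring k := Ideal.Quotient.mk (Ideal.span {sl2Rel k}) (X 1)
def xR : SL2Ring k := Ideal.Quotient.mk (Ideal.span {sl2Rel k}) (X 2)
def yR : SL2Ring k := Ideal.Quotient.mk (Ideal.span {sl2Rel k}) (X 3)

theorem rel_R : (xR : SL2Ring k) * yR = tR * uR + 1 := by
  have h : Ideal.Quotient.mk (Ideal.span {sl2Rel k}) (sl2Rel k) = 0 :=
    Ideal.Quotient.eq_zero_iff_mem.2 (Ideal.mem_span_singleton_self _)
  have h2 : Ideal.Quotient.mk (Ideal.span {sl2Rel k}) (sl2Rel k) = xR * yR - tR * uR - 1 := by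
    conv_lhs => arg 2; rw [sl2Rel]
    rw [map_sub, map_sub, map_mul, map_mul, map_one]; rfl
  rw [h2] at h
  linear_combination h

@[simp] theorem eta_X0 : etaStar k (X 0) = tR := by simp [etaStar, tR]
@[simp] theorem eta_X1 : etaStar k (X 1) = xR := by simp [etaStar, xR]
@[simp] theorem eta_X2 : etaStar k (X 2) = yR := by simp [etaStar, yR]

/-- universal property, ring hom version -/
def liftR {A : Type*} [CommRing A] (f : k →+* A) (a b c d : A) (h : c * d = a * b + 1) :
    SL2Ring k →+* A :=
  Ideal.Quotient.lift _ (eval₂Hom f ![a, b, c, d]) (by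
    intro p hp
    rw [Ideal.mem_span_singleton] at hp
    obtain ⟨q, rfl⟩ := hp
    rw [map_mul]
    have : (eval₂Hom f ![a, b, c, d]) (sl2Rel k) = 0 := by
      simp [sl2Rel, h]
    rw [this, zero_mul])

section
variable {A : Type*} [CommRing A] (f : k →+* A) (a b c d : A) (h : c * d = a * b + 1)
@[simp] theorem liftR_t : liftR f a b c d h tR = a := by simp [liftR, tR]
@[simp] theorem liftR_u : liftR f a b c d h uR = b := by simp [liftR, uR]
@[simp] theorem liftR_x : liftR f a b c d h xR = c := by simp [liftR, xR]
@[simp] theorem liftR_y : liftR f a b c d h yR = d := by simp [liftR, yR]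
@[simp] theorem liftR_C (r : k) : liftR f a b c d h (algebraMap k _ r) = f r := by
  have : algebraMap k (SL2Ring k) r = Ideal.Quotient.mk _ (C r) := rfl
  rw [this, liftR, Ideal.Quotient.lift_mk]; simp
end

theorem homR_ext {A : Type*} [CommRing A] {f g : SL2Ring k →+* A}
    (hC : ∀ r : k, f (algebraMap k _ r) = g (algebraMap k _ r))
    (ht : f tR = g tR) (hu : f uR = g uR) (hx : f xR = g xR) (hy : f yR = g yR) : f = g := by
  apply Ideal.Quotient.ringHom_ext
  apply MvPolynomial.ringHom_ext
  · intro r; exact hC r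
  · intro i
    fin_cases i
    · exact ht
    · exact hu
    · exact hx
    · exact hy

/-- alg hom version -/
def liftA {A : Type*} [CommRing A] [Algebra k A] (a b c d : A) (h : c * d = a * b + 1) :
    SL2Ring k →ₐ[k] A :=
  { liftR (algebraMap k A) a b c d h with
    commutes' := fun r => liftR_C (algebraMap k A) a b c d h r }

section
variable {A : Type*} [CommRing A] [Algebra k A] (a b c d : A) (h : c * d = a * b + 1)
theorem liftA_apply (r : SL2Ring k) : liftA a b c d h r = liftR (algebraMap k A) a b c d h r := rfl
@[simp] theorem liftA_t : liftA a b c d h (tR : SL2Ring k) = a := liftR_t _ _ _ _ _ h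
@[simp] theorem liftA_u : liftA a b c d h (uR : SL2Ring k) = b := liftR_u _ _ _ _ _ h
@[simp] theorem liftA_x : liftA a b c d h (xR : SL2Ring k) = c := liftR_x _ _ _ _ _ h
@[simp] theorem liftA_y : liftA a b c d h (yR : SL2Ring k) = d := liftR_y _ _ _ _ _ h
end

theorem homA_ext {A : Type*} [CommRing A] [Algebra k A] {f g : SL2Ring k →ₐ[k] A}
    (ht : f tR = g tR) (hu : f uR = g uR) (hx : f xR = g xR) (hy : f yR = g yR) : f = g := by
  have : (f : SL2Ring k →+* A) = g := homR_ext (fun r => by simp) ht hu hx hy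
  exact AlgHom.ext fun r => congrArg (fun h : SL2Ring k →+* A => h r) this

theorem t_nzd {r : SL2Ring k} (h : tR * r = 0) : r = 0 := by
  obtain ⟨p, rfl⟩ := Ideal.Quotient.mk_surjective r
  unfold tR at h
  rw [← map_mul, Ideal.Quotient.eq_zero_iff_mem, Ideal.mem_span_singleton] at h
  obtain ⟨q, hq⟩ := h
  have hp : Prime (X 0 : MvPolynomial (Fin 4) k) := X_prime
  have h1 : (X 0 : MvPolynomial (Fin 4) k) ∣ sl2Rel k * q := ⟨p, hq.symm⟩
  rcases hp.dvd_or_dvd h1 with h2 | h2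
  · exfalso
    obtain ⟨w, hw⟩ := h2
    have := congrArg (eval ![0, 0, 0, 0]) hw
    simp [sl2Rel] at this
  · obtain ⟨w, rfl⟩ := h2
    rw [Ideal.Quotient.eq_zero_iff_mem, Ideal.mem_span_singleton]
    refine ⟨w, mul_left_cancel₀ hp.ne_zero ?_⟩
    rw [hq]; ring

theorem t_pow_nzd {r : SL2Ring k} (n : ℕ) (h : tR ^ n * r = 0) : r = 0 := by
  induction n with
  | zero => simpa using h
  | succ n ih => exact ih (t_nzd (by rw [← h]; ring))

/-! ### saturation -/

/-- saturation of a subring `S` w.r.t. a submonoid -/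
def satur {A : Type*} [CommRing A] (M : Submonoid A) (S : Subring A) (hM : M ≤ S.toSubmonoid) :
    Subring A where
  carrier := {b | ∃ m ∈ M, m * b ∈ S}
  mul_mem' := by
    rintro a b ⟨m, hm, h⟩ ⟨n, hn, h'⟩
    exact ⟨m * n, M.mul_mem hm hn, by
      have := S.mul_mem h h'; convert this using 1; ring⟩
  one_mem' := ⟨1, M.one_mem, by simp⟩
  add_mem' := by
    rintro a b ⟨m, hm, h⟩ ⟨n, hn, h'⟩
    refine ⟨m * n, M.mul_mem hm hn, ?_⟩
    have := S.add_mem (S.mul_mem (hM hn) h) (S.mul_mem (hM hm) h')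
    convert this using 1; ring
  zero_mem' := ⟨1, M.one_mem, by simp⟩
  neg_mem' := by
    rintro a ⟨m, hm, h⟩
    exact ⟨m, hm, by rw [mul_neg]; exact S.neg_mem h⟩

theorem mem_satur {A : Type*} [CommRing A] {M : Submonoid A} {S : Subring A}
    {hM : M ≤ S.toSubmonoid} {b : A} : b ∈ satur M S hM ↔ ∃ m ∈ M, m * b ∈ S := Iff.rfl

theorem le_satur {A : Type*} [CommRing A] {M : Submonoid A} {S : Subring A}
    {hM : M ≤ S.toSubmonoid} : S ≤ satur M S hM := fun b hb => ⟨1, M.one_mem, by simpa using hb⟩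

theorem satur_of_mul {A : Type*} [CommRing A] {M : Submonoid A} {S : Subring A}
    {hM : M ≤ S.toSubmonoid} {b m : A} (hm : m ∈ M) (h : m * b ∈ satur M S hM) :
    b ∈ satur M S hM := by
  obtain ⟨n, hn, h'⟩ := h
  exact ⟨n * m, M.mul_mem hn hm, by rwa [mul_assoc]⟩

theorem subringR_top (S : Subring (SL2Ring k)) (hC : ∀ r : k, algebraMap k _ r ∈ S)
    (ht : tR ∈ S) (hu : uR ∈ S) (hx : xR ∈ S) (hy : yR ∈ S) (r : SL2Ring k) : r ∈ S := by
  obtain ⟨p, rfl⟩ := Ideal.Quotient.mk_surjective r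
  induction p using MvPolynomial.induction_on with
  | C a => exact hC a
  | add p q hp hq => rw [map_add]; exact S.add_mem hp hq
  | mul_X p i hp =>
    rw [map_mul]
    refine S.mul_mem hp ?_
    fin_cases i
    · exact ht
    · exact hu
    · exact hx
    · exact hy

theorem subringMv_top {σ : Type*} {A : Type*} [CommRing A] (S : Subring (MvPolynomial σ A))
    (hC : ∀ r : A, C r ∈ S) (hX : ∀ i, X i ∈ S) (p : MvPolynomial σ A) : p ∈ S := by
  induction p using MvPolynomial.induction_on with
  | C a => exact hC a
  | add p q hp hq => exact S.add_mem hp hq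
  | mul_X p i hp => exact S.mul_mem hp (hX i)

theorem eta_C (r : k) : etaStar k (C r) = algebraMap k _ r := (etaStar k).commutes r

theorem exists_t_pow (r : SL2Ring k) : ∃ n b, tR ^ n * r = etaStar k b := by
  let S : Subring (SL2Ring k) := (etaStar k).toRingHom.range
  let M : Submonoid (SL2Ring k) := Submonoid.powers tR
  have ht : tR ∈ S := ⟨X 0, eta_X0⟩
  have hM : M ≤ S.toSubmonoid := by
    rw [Submonoid.powers_le]; exact ht
  have : r ∈ satur M S hM := by
    apply subringR_top
    · intro r; exact le_satur ⟨C r, eta_C r⟩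
    · exact le_satur ht
    · refine ⟨tR, Submonoid.mem_powers _, X 1 * X 2 - 1, ?_⟩
      show etaStar k _ = _
      rw [map_sub, map_mul, eta_X1, eta_X2, map_one, rel_R]; ring
    · exact le_satur ⟨X 1, eta_X1⟩
    · exact le_satur ⟨X 2, eta_X2⟩
  obtain ⟨m, ⟨n, rfl⟩, b, hb⟩ := this
  exact ⟨n, b, hb.symm⟩

/-! ### the map to `k(t)[x,y]` -/

/-- the inclusion `k[t] → B` -/
def kt : Polynomial k →ₐ[k] B3 k := Polynomial.aeval (X 0)

/-- `k(t)` -/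
abbrev ktoF : Polynomial k →+* RatFunc k := algebraMap (Polynomial k) (RatFunc k)

@[simp] theorem toRat_X0 : toRatFuncXY k (X 0) = C (ktoF Polynomial.X) := by simp [toRatFuncXY]
@[simp] theorem toRat_X1 : toRatFuncXY k (X 1) = X 0 := by simp [toRatFuncXY]
@[simp] theorem toRat_X2 : toRatFuncXY k (X 2) = X 1 := by simp [toRatFuncXY]
theorem toRat_C (r : k) : toRatFuncXY k (C r) = C (ktoF (Polynomial.C r)) :=
  (toRatFuncXY k).commutes r

theorem toRat_kt (θ : Polynomial k) : toRatFuncXY k (kt θ) = C (ktoF θ) := by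
  have : ((toRatFuncXY k).toRingHom.comp (kt (k := k)).toRingHom) = (C).comp ktoF := by
    apply Polynomial.ringHom_ext
    · intro a
      simp [kt]
    · simp [kt]
  exact congrArg (fun h : Polynomial k →+* _ => h θ) this

/-- `B ≃ k[t][x,y]` -/
def eqB : B3 k ≃ₐ[k] MvPolynomial (Fin 2) (Polynomial k) :=
  (renameEquiv k (finSuccEquiv 2)).trans (optionEquivRight k (Fin 2))

theorem eqB_X0 : eqB (X 0 : B3 k) = C Polynomial.X := by simp [eqB]
theorem eqB_X1 : eqB (X 1 : B3 k) = X 0 := by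
  have : (1 : Fin 3) = Fin.succ 0 := rfl
  rw [eqB, AlgEquiv.trans_apply, renameEquiv_apply, rename_X, this, finSuccEquiv_succ,
    optionEquivRight_X_some]
theorem eqB_X2 : eqB (X 2 : B3 k) = X 1 := by
  have : (2 : Fin 3) = Fin.succ 1 := rfl
  rw [eqB, AlgEquiv.trans_apply, renameEquiv_apply, rename_X, this, finSuccEquiv_succ,
    optionEquivRight_X_some]

theorem toRat_eq (b : B3 k) : toRatFuncXY k b = MvPolynomial.map ktoF (eqB b) := by
  have : (toRatFuncXY k).toRingHom =
      (MvPolynomial.map ktoF).comp (eqB (k := k)).toRingEquiv.toRingHom := by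
    apply MvPolynomial.ringHom_ext
    · intro r
      show toRatFuncXY k (C r) = MvPolynomial.map ktoF (eqB (C r))
      have : eqB (C r : B3 k) = C (Polynomial.C r) := eqB.commutes r
      rw [this, map_C, toRat_C]
    · intro i
      show toRatFuncXY k (X i) = MvPolynomial.map ktoF (eqB (X i))
      fin_cases i
      · show toRatFuncXY k (X 0) = MvPolynomial.map ktoF (eqB (X 0))
        rw [eqB_X0, toRat_X0, map_C]
      · show toRatFuncXY k (X 1) = MvPolynomial.map ktoF (eqB (X 1))
        rw [eqB_X1, toRat_X1, map_X]
      · show toRatFuncXY k (X 2) = MvPolynomial.map ktoF (eqB (X 2))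
        rw [eqB_X2, toRat_X2, map_X]
  exact congrArg (fun h : B3 k →+* _ => h b) this

theorem toRat_inj : Function.Injective (toRatFuncXY k) := by
  have : (toRatFuncXY k : B3 k → _) = MvPolynomial.map ktoF ∘ eqB := funext toRat_eq
  rw [this]
  exact (MvPolynomial.map_injective _ (RatFunc.algebraMap_injective k)).comp eqB.injective

theorem exists_clear (q : MvPolynomial (Fin 2) (RatFunc k)) :
    ∃ θ : Polynomial k, θ ≠ 0 ∧ ∃ b, toRatFuncXY k (kt θ) * q = toRatFuncXY k b := by
  let S : Subring (MvPolynomial (Fin 2) (RatFunc k)) := (toRatFuncXY k).toRingHom.range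
  let M : Submonoid (MvPolynomial (Fin 2) (RatFunc k)) :=
    (nonZeroDivisors (Polynomial k)).map ((toRatFuncXY k).toRingHom.comp kt.toRingHom)
  have hM : M ≤ S.toSubmonoid := by
    rintro _ ⟨θ, -, rfl⟩
    exact ⟨kt θ, rfl⟩
  have : q ∈ satur M S hM := by
    apply subringMv_top
    · intro r
      refine ⟨_, ⟨r.denom, mem_nonZeroDivisors_of_ne_zero r.denom_ne_zero, rfl⟩, kt r.num, ?_⟩
      show toRatFuncXY k (kt r.num) = toRatFuncXY k (kt r.denom) * _
      rw [toRat_kt, toRat_kt, ← map_mul]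
      congr 1
      have h1 := RatFunc.num_div_denom r
      rw [div_eq_iff (RatFunc.algebraMap_ne_zero r.denom_ne_zero)] at h1
      rw [mul_comm]; exact h1
    · intro i
      apply le_satur
      fin_cases i
      · exact ⟨X 1, toRat_X1⟩
      · exact ⟨X 2, toRat_X2⟩
  obtain ⟨_, ⟨θ, hθ, rfl⟩, b, hb⟩ := this
  exact ⟨θ, nonZeroDivisors.ne_zero hθ, b, hb.symm⟩

theorem kt_inj : Function.Injective (kt (k := k)) := by
  intro a b h
  have := congrArg (toRatFuncXY k) h
  rw [toRat_kt, toRat_kt] at this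
  exact RatFunc.algebraMap_injective k (C_injective _ _ this)

/-- `R → k(t)[x,y]` -/
def rho : SL2Ring k →ₐ[k] MvPolynomial (Fin 2) (RatFunc k) :=
  liftA (C (ktoF Polynomial.X)) (C (ktoF Polynomial.X)⁻¹ * (X 0 * X 1 - 1)) (X 0) (X 1) (by
    have : (C (ktoF Polynomial.X) : MvPolynomial (Fin 2) (RatFunc k)) * C (ktoF Polynomial.X)⁻¹ = 1 := by
      rw [← map_mul, mul_inv_cancel₀ (RatFunc.algebraMap_ne_zero Polynomial.X_ne_zero), map_one]
    linear_combination -(X 0 * X 1 - 1) * this)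

theorem rho_eta (b : B3 k) : rho (etaStar k b) = toRatFuncXY k b := by
  have : rho.comp (etaStar k) = toRatFuncXY k := by
    apply MvPolynomial.algHom_ext
    intro i
    fin_cases i
    · show rho (etaStar k (X 0)) = toRatFuncXY k (X 0)
      simp [rho]
    · show rho (etaStar k (X 1)) = toRatFuncXY k (X 1)
      simp [rho]
    · show rho (etaStar k (X 2)) = toRatFuncXY k (X 2)
      simp [rho]
  exact congrArg (fun h : B3 k →ₐ[k] _ => h b) this

theorem eta_inj : Function.Injective (etaStar k) := by
  intro a b h
  apply toRat_inj
  rw [← rho_eta, h, rho_eta]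

theorem rho_inj : Function.Injective (rho (k := k)) := by
  rw [injective_iff_map_eq_zero]
  intro r hr
  obtain ⟨n, b, hb⟩ := exists_t_pow r
  have h1 : toRatFuncXY k b = 0 := by rw [← rho_eta, ← hb, map_mul, hr, mul_zero]
  have h2 : b = 0 := toRat_inj (by rw [h1, map_zero])
  rw [h2, map_zero] at hb
  exact t_pow_nzd n hb

instance instDomR : IsDomain (SL2Ring k) := rho_inj.isDomain rho.toRingHom

theorem tR_ne : (tR : SL2Ring k) ≠ 0 := by
  intro h
  have := congrArg rho h
  rw [map_zero] at this
  simp only [rho, liftA_t] at this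
  rw [C_eq_zero] at this
  exact RatFunc.algebraMap_ne_zero Polynomial.X_ne_zero this

/-! ### evaluation at `t = c` -/

def evc (c : k) : B3 k →ₐ[k] MvPolynomial (Fin 2) k := aeval ![C c, X 0, X 1]
def inc : MvPolynomial (Fin 2) k →ₐ[k] B3 k := aeval ![X 1, X 2]

@[simp] theorem evc_X0 (c : k) : evc c (X 0) = C c := by simp [evc]
@[simp] theorem evc_X1 (c : k) : evc c (X 1) = X 0 := by simp [evc]
@[simp] theorem evc_X2 (c : k) : evc c (X 2) = X 1 := by simp [evc]
@[simp] theorem evc_C (c r : k) : evc c (C r) = C r := (evc c).commutes r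
@[simp] theorem inc_X0 : inc (X 0 : MvPolynomial (Fin 2) k) = X 1 := by simp [inc]
@[simp] theorem inc_X1 : inc (X 1 : MvPolynomial (Fin 2) k) = X 2 := by simp [inc]
@[simp] theorem inc_C (r : k) : inc (C r) = C r := inc.commutes r
@[simp] theorem evc_inc (c : k) (p) : evc c (inc p) = p := by
  have : (evc c).comp inc = AlgHom.id k _ := by
    apply MvPolynomial.algHom_ext
    intro i
    fin_cases i
    · show evc c (inc (X 0)) = X 0
      simp
    · show evc c (inc (X 1)) = X 1
      simp
  exact congrArg (fun h : MvPolynomial (Fin 2) k →ₐ[k] _ => h p) this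

theorem algHomB_ext {A : Type*} [CommRing A] [Algebra k A] {f g : B3 k →ₐ[k] A}
    (h0 : f (X 0) = g (X 0)) (h1 : f (X 1) = g (X 1)) (h2 : f (X 2) = g (X 2)) : f = g := by
  apply MvPolynomial.algHom_ext
  intro i
  fin_cases i
  · exact h0
  · exact h1
  · exact h2

theorem dvd_sub_inc (c : k) (b : B3 k) : (X 0 - C c) ∣ b - inc (evc c b) := by
  rw [← Ideal.mem_span_singleton, ← Ideal.Quotient.eq]
  have : Ideal.Quotient.mkₐ k (Ideal.span {(X 0 - C c : B3 k)}) =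
      (Ideal.Quotient.mkₐ k (Ideal.span {(X 0 - C c : B3 k)})).comp (inc.comp (evc c)) := by
    apply algHomB_ext
    · simp only [AlgHom.comp_apply, evc_X0, inc_C, Ideal.Quotient.mkₐ_eq_mk]
      rw [Ideal.Quotient.eq]
      exact Ideal.mem_span_singleton_self _
    · simp
    · simp
  exact congrArg (fun h : B3 k →ₐ[k] _ => h b) this

theorem dvd_iff_evc (c : k) (b : B3 k) : (X 0 - C c) ∣ b ↔ evc c b = 0 := by
  constructor
  · rintro ⟨q, rfl⟩
    simp
  · intro h
    have := dvd_sub_inc c b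
    rwa [h, map_zero, sub_zero] at this

theorem evc_kt (c : k) (θ : Polynomial k) : evc c (kt θ) = C (θ.eval c) := by
  have : (evc c).comp kt = (Algebra.ofId k _).comp (Polynomial.aeval c) := by
    ext1
    simp [kt, Algebra.ofId_apply]
  have := congrArg (fun h : Polynomial k →ₐ[k] _ => h θ) this
  simpa [Algebra.ofId_apply, Polynomial.coe_aeval_eq_eval] using this

theorem X0_sub_ne (c : k) : (X 0 - C c : B3 k) ≠ 0 := by
  intro h
  have := congrArg (evc (c + 1)) h
  simp at this

end SLP
end

end

section
section
namespace SLP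

theorem lift_exists {W R D : Type*} [CommRing W] [CommRing R] [CommRing D]
    [IsDomain R] (f : W →+* R) (hf : Function.Injective f) (M : Submonoid W)
    (hM0 : (0 : W) ∉ M) (hM : ∀ r, ∃ m ∈ M, ∃ G, f m * r = f G) (h : W →+* D)
    (hh : ∀ m ∈ M, IsUnit (h m)) : ∃ e : R →+* D, ∀ w, e (f w) = h w := by
  let N : Submonoid R := M.map f
  let RL := Localization N
  let _ : Algebra W RL := ((algebraMap R RL).comp f).toAlgebra
  have hN : N ≤ nonZeroDivisors R := by
    rintro _ ⟨m, hm, rfl⟩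
    apply mem_nonZeroDivisors_of_ne_zero
    intro h0
    rw [← map_zero f] at h0
    exact hM0 (hf h0 ▸ hm)
  have hinj : Function.Injective (algebraMap R RL) := IsLocalization.injective RL hN
  have : IsLocalization M RL := by
    refine ⟨?_, ?_, ?_⟩
    · intro y
      exact IsLocalization.map_units RL (⟨f y, y, y.2, rfl⟩ : N)
    · intro z
      obtain ⟨⟨r, ⟨_, m, hm, rfl⟩⟩, hr⟩ := IsLocalization.surj N z
      obtain ⟨m', hm', G, hG⟩ := hM r
      refine ⟨(G, ⟨m * m', M.mul_mem hm hm'⟩), ?_⟩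
      show z * algebraMap R RL (f (m * m')) = algebraMap R RL (f G)
      rw [← hG, map_mul, map_mul, map_mul, ← mul_assoc, hr]
      ring
    · intro x y hxy
      have : f x = f y := hinj hxy
      exact ⟨1, by rw [hf this]⟩
  refine ⟨(IsLocalization.lift (M := M) (g := h) (fun y => hh y y.2) : RL →+* D).comp
    (algebraMap R RL), fun w => ?_⟩
  exact IsLocalization.lift_eq (M := M) (fun y => hh y y.2) w

variable {k : Type*} [Field k]

/-! ### kappa -/

abbrev W3 (k : Type*) [Field k] := Polynomial (Polynomial (Polynomial k))

def kap (P s : B3 k) : W3 k →+* B3 k :=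
  Polynomial.eval₂RingHom
    (Polynomial.eval₂RingHom (Polynomial.aeval P : Polynomial k →ₐ[k] B3 k).toRingHom (X 0)) s

variable (P s : B3 k)

theorem kap_X : kap P s Polynomial.X = s := by simp [kap]
theorem kap_CX : kap P s (Polynomial.C Polynomial.X) = X 0 := by simp [kap]
theorem kap_CC (g : Polynomial k) :
    kap P s (Polynomial.C (Polynomial.C g)) = Polynomial.aeval P g := by simp [kap]
theorem kap_kt (θ : Polynomial k) :
    kap P s (Polynomial.C (θ.map Polynomial.C)) = kt θ := by
  have : (kap P s).comp ((Polynomial.C).comp (Polynomial.mapRingHom Polynomial.C)) =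
      (kt (k := k)).toRingHom := by
    apply Polynomial.ringHom_ext
    · intro a
      simp [kap, kt]
    · simp [kap, kt]
  exact congrArg (fun h : Polynomial k →+* _ => h θ) this

theorem W3_hom_ext {A : Type*} [CommRing A] {f g : W3 k →+* A}
    (h1 : ∀ r : k, f (Polynomial.C (Polynomial.C (Polynomial.C r))) =
      g (Polynomial.C (Polynomial.C (Polynomial.C r))))
    (h2 : f (Polynomial.C (Polynomial.C Polynomial.X)) = g (Polynomial.C (Polynomial.C Polynomial.X)))
    (h3 : f (Polynomial.C Polynomial.X) = g (Polynomial.C Polynomial.X))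
    (h4 : f Polynomial.X = g Polynomial.X) : f = g := by
  apply Polynomial.ringHom_ext' _ h4
  apply Polynomial.ringHom_ext' _ h3
  apply Polynomial.ringHom_ext' _ h2
  ext r
  exact h1 r

def ev2 (p s : MvPolynomial (Fin 2) k) : Polynomial (Polynomial k) →+* MvPolynomial (Fin 2) k :=
  Polynomial.eval₂RingHom (Polynomial.aeval p : Polynomial k →ₐ[k] _).toRingHom s

theorem ev2_X (p s : MvPolynomial (Fin 2) k) : ev2 p s Polynomial.X = s := by simp [ev2]
theorem ev2_C (p s : MvPolynomial (Fin 2) k) (g : Polynomial k) :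
    ev2 p s (Polynomial.C g) = Polynomial.aeval p g := by simp [ev2]

theorem evc_kap (c : k) (G : W3 k) :
    evc c (kap P s G) = ev2 (evc c P) (evc c s)
      (G.map (Polynomial.evalRingHom (Polynomial.C c))) := by
  have : (evc c).toRingHom.comp (kap P s) = (ev2 (evc c P) (evc c s)).comp
      (Polynomial.mapRingHom (Polynomial.evalRingHom (Polynomial.C c))) := by
    apply W3_hom_ext
    · intro r
      simp [kap, ev2]
    · simp [kap, ev2]
    · simp [kap, ev2]
    · simp [kap, ev2]
  exact congrArg (fun h : W3 k →+* _ => h G) this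

/-! ### derivations -/

theorem chain_rule {σ K A : Type*} [Fintype σ] [CommRing K] [CommRing A] [Algebra K A]
    (φ : MvPolynomial σ K →ₐ[K] A) (D : Derivation K A A) (p : MvPolynomial σ K) :
    D (φ p) = ∑ i, φ (pderiv i p) * D (φ (X i)) := by
  classical
  induction p using MvPolynomial.induction_on with
  | C a =>
    have : φ (C a) = algebraMap K A a := φ.commutes a
    rw [this, D.map_algebraMap]
    simp
  | add p q hp hq =>
    simp only [map_add, hp, hq, add_mul, Finset.sum_add_distrib]
  | mul_X p i hp =>
    rw [map_mul, D.leibniz, hp]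
    simp only [Derivation.leibniz, pderiv_X, smul_eq_mul, map_add, map_mul, add_mul,
      Finset.sum_add_distrib]
    rw [Finset.mul_sum]
    congr 1
    · rw [Finset.sum_eq_single i]
      · simp
      · intro j _ hj
        simp [hj.symm]
      · simp
    · refine Finset.sum_congr rfl fun j _ => ?_
      ring

/-- jacobian derivation on `B` -/
def DB (f : B3 k) : Derivation k (B3 k) (B3 k) := pderiv 1 f • pderiv 2 - pderiv 2 f • pderiv 1

theorem DB_apply (f g : B3 k) :
    DB f g = pderiv 1 f * pderiv 2 g - pderiv 2 f * pderiv 1 g := rfl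

theorem DB_self (f : B3 k) : DB f f = 0 := by rw [DB_apply]; ring
theorem DB_X0 (f : B3 k) : DB f (X 0) = 0 := by
  rw [DB_apply, pderiv_X_of_ne (by decide), pderiv_X_of_ne (by decide)]; ring
theorem DB_aeval (f : B3 k) (g : Polynomial k) : DB f (Polynomial.aeval f g) = 0 := by
  rw [Derivation.map_aeval, DB_self, smul_zero]
theorem DB_kt (f : B3 k) (g : Polynomial k) : DB f (kt g) = 0 := by
  rw [kt, Derivation.map_aeval, DB_X0, smul_zero]

/-- jacobian derivation on two-variable polynomial rings -/
def D2 {K : Type*} [CommRing K] (f : MvPolynomial (Fin 2) K) :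
    Derivation K (MvPolynomial (Fin 2) K) (MvPolynomial (Fin 2) K) :=
  pderiv 0 f • pderiv 1 - pderiv 1 f • pderiv 0

theorem D2_apply {K : Type*} [CommRing K] (f g : MvPolynomial (Fin 2) K) :
    D2 f g = pderiv 0 f * pderiv 1 g - pderiv 1 f * pderiv 0 g := rfl

theorem D2_chain {K : Type*} [CommRing K]
    (φ : MvPolynomial (Fin 2) K →ₐ[K] MvPolynomial (Fin 2) K) (f g : MvPolynomial (Fin 2) K) :
    D2 (φ f) (φ g) = φ (D2 f g) * D2 (φ (X 0)) (φ (X 1)) := by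
  rw [D2_apply, D2_apply (f := f), D2_apply (f := φ (X 0))]
  rw [chain_rule φ (pderiv 0) f, chain_rule φ (pderiv 0) g, chain_rule φ (pderiv 1) f,
    chain_rule φ (pderiv 1) g]
  simp only [Fin.sum_univ_two, map_sub, map_mul]
  ring

theorem toRat_pderiv1 (b : B3 k) : toRatFuncXY k (pderiv 1 b) = pderiv 0 (toRatFuncXY k b) := by
  induction b using MvPolynomial.induction_on with
  | C a => rw [toRat_C]; simp
  | add p q hp hq => simp only [map_add, hp, hq]
  | mul_X p i hp =>
    rw [map_mul (toRatFuncXY k), Derivation.leibniz, Derivation.leibniz, map_add]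
    simp only [smul_eq_mul, map_mul, hp]
    congr 2
    fin_cases i
    · show toRatFuncXY k (pderiv 1 (X 0)) = pderiv 0 (toRatFuncXY k (X 0))
      rw [toRat_X0, pderiv_X_of_ne (by decide)]; simp
    · show toRatFuncXY k (pderiv 1 (X 1)) = pderiv 0 (toRatFuncXY k (X 1))
      rw [toRat_X1, pderiv_X_self, pderiv_X_self, map_one]
    · show toRatFuncXY k (pderiv 1 (X 2)) = pderiv 0 (toRatFuncXY k (X 2))
      rw [toRat_X2, pderiv_X_of_ne (by decide), pderiv_X_of_ne (by decide), map_zero]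

theorem toRat_pderiv2 (b : B3 k) : toRatFuncXY k (pderiv 2 b) = pderiv 1 (toRatFuncXY k b) := by
  induction b using MvPolynomial.induction_on with
  | C a => rw [toRat_C]; simp
  | add p q hp hq => simp only [map_add, hp, hq]
  | mul_X p i hp =>
    rw [map_mul (toRatFuncXY k), Derivation.leibniz, Derivation.leibniz, map_add]
    simp only [smul_eq_mul, map_mul, hp]
    congr 2
    fin_cases i
    · show toRatFuncXY k (pderiv 2 (X 0)) = pderiv 1 (toRatFuncXY k (X 0))
      rw [toRat_X0, pderiv_X_of_ne (by decide)]; simp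
    · show toRatFuncXY k (pderiv 2 (X 1)) = pderiv 1 (toRatFuncXY k (X 1))
      rw [toRat_X1, pderiv_X_of_ne (by decide), pderiv_X_of_ne (by decide), map_zero]
    · show toRatFuncXY k (pderiv 2 (X 2)) = pderiv 1 (toRatFuncXY k (X 2))
      rw [toRat_X2, pderiv_X_self, pderiv_X_self, map_one]

theorem toRat_DB (f g : B3 k) : toRatFuncXY k (DB f g) = D2 (toRatFuncXY k f) (toRatFuncXY k g) := by
  rw [DB_apply, D2_apply, map_sub, map_mul, map_mul, toRat_pderiv1, toRat_pderiv1, toRat_pderiv2,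
    toRat_pderiv2]

theorem kt_of_const {b : B3 k} {a : RatFunc k} (h : toRatFuncXY k b = C a) : ∃ j, b = kt j := by
  refine ⟨coeff 0 (eqB b), toRat_inj ?_⟩
  rw [toRat_kt, h]
  rw [toRat_eq] at h
  have := congrArg (coeff 0) h
  rw [coeff_map, coeff_C, if_pos rfl] at this
  rw [this]

def GV (P s : B3 k) : Prop := ∀ b, ∃ θ : Polynomial k, θ ≠ 0 ∧ ∃ G, kt θ * b = kap P s G

/-- Lemma IV -/
theorem lemma_IV (hP : IsVarOverRatFunc k P) :
    ∃ s, GV P s ∧ ∃ j : Polynomial k, j ≠ 0 ∧ DB P s = kt j := by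
  obtain ⟨ψ, hψ⟩ := hP
  obtain ⟨θ0, hθ0, s0, hs0⟩ := exists_clear (ψ.symm (X 1))
  have hPs : ψ.symm (X 0) = toRatFuncXY k P := by rw [← hψ, AlgEquiv.symm_apply_apply]
  refine ⟨s0, ?_, ?_⟩
  · intro b
    let S : Subring (MvPolynomial (Fin 2) (RatFunc k)) :=
      RingHom.range (R := W3 k) ((toRatFuncXY k).toRingHom.comp (kap P s0))
    let M : Submonoid (MvPolynomial (Fin 2) (RatFunc k)) :=
      (nonZeroDivisors (Polynomial k)).map ((toRatFuncXY k).toRingHom.comp kt.toRingHom)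
    have hM : M ≤ S.toSubmonoid := by
      rintro _ ⟨θ, -, rfl⟩
      exact ⟨Polynomial.C (θ.map Polynomial.C), by
        show toRatFuncXY k (kap P s0 _) = toRatFuncXY k (kt θ)
        rw [kap_kt]⟩
    have key : ∀ q, q ∈ (satur M S hM).comap ψ.symm.toRingEquiv.toRingHom := by
      intro q
      apply subringMv_top
      · intro r
        show ψ.symm (C r) ∈ satur M S hM
        have : ψ.symm (C r) = C r := ψ.symm.commutes r
        rw [this]
        refine ⟨_, ⟨r.denom, mem_nonZeroDivisors_of_ne_zero r.denom_ne_zero, rfl⟩,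
          Polynomial.C (r.num.map Polynomial.C), ?_⟩
        show toRatFuncXY k (kap P s0 _) = toRatFuncXY k (kt r.denom) * _
        rw [kap_kt, toRat_kt, toRat_kt, ← map_mul]
        congr 1
        have h1 := RatFunc.num_div_denom r
        rw [div_eq_iff (RatFunc.algebraMap_ne_zero r.denom_ne_zero)] at h1
        rw [mul_comm]; exact h1
      · intro i
        fin_cases i
        · show ψ.symm (X 0) ∈ satur M S hM
          rw [hPs]
          refine le_satur ⟨Polynomial.C (Polynomial.C Polynomial.X), ?_⟩
          show toRatFuncXY k (kap P s0 _) = _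
          rw [kap_CC, Polynomial.aeval_X]
        · show ψ.symm (X 1) ∈ satur M S hM
          refine ⟨_, ⟨θ0, mem_nonZeroDivisors_of_ne_zero hθ0, rfl⟩, Polynomial.X, ?_⟩
          show toRatFuncXY k (kap P s0 _) = toRatFuncXY k (kt θ0) * _
          rw [kap_X, hs0]
    have := key (ψ (toRatFuncXY k b))
    obtain ⟨_, ⟨θ, hθ, rfl⟩, G, hG⟩ := this
    refine ⟨θ, nonZeroDivisors.ne_zero hθ, G, toRat_inj ?_⟩
    rw [map_mul]
    have h2 : toRatFuncXY k (kap P s0 G) = toRatFuncXY k (kt θ) * ψ.symm (ψ (toRatFuncXY k b)) := hG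
    rw [h2, AlgEquiv.symm_apply_apply]
  · have h1 := D2_chain (ψ.symm : _ →ₐ[RatFunc k] _) (ψ (X 0)) (ψ (X 1))
    simp only [AlgEquiv.coe_toAlgHom, AlgEquiv.symm_apply_apply] at h1
    have h2 : D2 (X 0 : MvPolynomial (Fin 2) (RatFunc k)) (X 1) = 1 := by
      rw [D2_apply]
      simp
    rw [h2] at h1
    have hu : IsUnit (D2 (ψ.symm (X 0)) (ψ.symm (X 1))) := IsUnit.of_mul_eq_one_right _ h1.symm
    have hu' := hu
    rw [MvPolynomial.isUnit_iff_eq_C_of_isReduced] at hu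
    obtain ⟨a, ha, hau⟩ := hu
    have h3 : toRatFuncXY k (DB P s0) = C (ktoF θ0 * a) := by
      rw [toRat_DB, ← hs0, toRat_kt, ← hPs, C_mul', Derivation.map_smul, hau, ← C_mul', map_mul]
    obtain ⟨j, hj⟩ := kt_of_const h3
    refine ⟨j, ?_, hj⟩
    rintro rfl
    rw [hj, map_zero, map_zero] at h3
    have := C_injective (Fin 2) (RatFunc k) (h3.symm.trans (map_zero C).symm)
    rcases mul_eq_zero.1 this with h | h
    · exact RatFunc.algebraMap_ne_zero hθ0 h
    · rw [h] at ha; exact not_isUnit_zero ha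

end SLP
end

end

section
section
namespace SLP

variable {k : Type*} [Field k]

theorem eta_kt (θ : Polynomial k) : etaStar k (kt θ) = Polynomial.aeval tR θ := by
  rw [kt, ← Polynomial.aeval_algHom_apply, eta_X0]

theorem t_sub_nonunit (c : k) : ¬ IsUnit (tR - algebraMap k (SL2Ring k) c) := by
  intro h
  have := h.map (liftA c 0 1 1 (by ring) : SL2Ring k →ₐ[k] k)
  simp at this

theorem t_nonunit : ¬ IsUnit (tR : SL2Ring k) := by
  have := t_sub_nonunit (0 : k)
  simpa using this

theorem aevalt_inj : Function.Injective (Polynomial.aeval (tR : SL2Ring k) : Polynomial k →ₐ[k] _) := by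
  intro a b h
  rw [← eta_kt, ← eta_kt] at h
  exact kt_inj (eta_inj h)

theorem rho_const {r : SL2Ring k} {a : RatFunc k} (h : rho r = C a) :
    ∃ (n : ℕ) (j : Polynomial k), tR ^ n * r = Polynomial.aeval tR j := by
  obtain ⟨n, b, hb⟩ := exists_t_pow r
  have : toRatFuncXY k b = C ((ktoF Polynomial.X) ^ n * a) := by
    rw [← rho_eta, ← hb, map_mul, h, map_pow, rho, liftA_t, map_mul, map_pow]
  obtain ⟨j, rfl⟩ := kt_of_const this
  exact ⟨n, j, by rw [hb, eta_kt]⟩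

theorem unit_R {ε : SL2Ring k} (h : IsUnit ε) : ∃ c : k, c ≠ 0 ∧ ε = algebraMap k _ c := by
  obtain ⟨ε', hε⟩ := h.exists_right_inv
  have h' : IsUnit ε' := IsUnit.of_mul_eq_one_right _ hε
  have hu := h.map rho
  have hu' := h'.map rho
  rw [MvPolynomial.isUnit_iff_eq_C_of_isReduced] at hu hu'
  obtain ⟨a, -, ha⟩ := hu
  obtain ⟨a', -, ha'⟩ := hu'
  obtain ⟨n, j, hj⟩ := rho_const ha
  obtain ⟨m, j', hj'⟩ := rho_const ha'
  have h1 : j * j' = Polynomial.X ^ (n + m) := by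
    apply aevalt_inj
    rw [map_mul, ← hj, ← hj', map_pow, Polynomial.aeval_X]
    linear_combination tR ^ (n + m) * hε
  obtain ⟨i, hi, w, hw⟩ := (dvd_prime_pow Polynomial.prime_X _).1 (Dvd.intro _ h1)
  obtain ⟨c, hc, hcw⟩ := Polynomial.isUnit_iff.1 w⁻¹.isUnit
  have hj2 : j = Polynomial.X ^ i * Polynomial.C c := by
    rw [hcw, ← hw, mul_assoc, Units.mul_inv, mul_one]
  have hc0 : c ≠ 0 := hc.ne_zero
  have hj3 : tR ^ n * ε = tR ^ i * algebraMap k _ c := by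
    rw [hj, hj2]; simp; ring
  have hcu : IsUnit (algebraMap k (SL2Ring k) c) := hc.map _
  refine ⟨c, hc0, ?_⟩
  rcases lt_trichotomy n i with hn | hn | hn
  · exfalso
    obtain ⟨e, rfl⟩ := Nat.exists_eq_add_of_lt hn
    have : ε = tR * (tR ^ e * algebraMap k _ c) := by
      apply mul_left_cancel₀ (pow_ne_zero n tR_ne)
      rw [hj3]; ring
    rw [this] at h
    exact t_nonunit (isUnit_of_mul_isUnit_left h)
  · subst hn
    exact mul_left_cancel₀ (pow_ne_zero n tR_ne) hj3
  · exfalso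
    obtain ⟨e, rfl⟩ := Nat.exists_eq_add_of_lt hn
    have : tR * (tR ^ e * ε) = algebraMap k _ c := by
      apply mul_left_cancel₀ (pow_ne_zero i tR_ne)
      rw [← hj3]; ring
    rw [← this] at hcu
    exact t_nonunit (isUnit_of_mul_isUnit_left hcu)

/-! ### S1 -/

theorem irred_abstract {D : Type*} [CommRing D] [IsDomain D] [Algebra k D] (τ : D)
    (hunit : ∀ d : D, IsUnit d → ∃ c : k, d = algebraMap k D c)
    (hτ : Function.Injective (Polynomial.aeval τ : Polynomial k →ₐ[k] D))
    (j : D →+* Polynomial (RatFunc k)) (hj : Function.Injective j)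
    (hjτ : ∀ θ : Polynomial k, j (Polynomial.aeval τ θ) = Polynomial.C (ktoF θ)) (c : k) :
    Irreducible (τ - algebraMap k D c) := by
  have hτc : τ - algebraMap k D c = Polynomial.aeval τ (Polynomial.X - Polynomial.C c) := by simp
  have deg0 : ∀ f : D, (j f).natDegree = 0 → ∃ a : Polynomial k, f = Polynomial.aeval τ a := by
    intro f hf
    obtain ⟨r, hr⟩ := Polynomial.natDegree_eq_zero.1 hf
    have h1 := RatFunc.num_div_denom r
    have hd : ktoF r.denom ≠ 0 := RatFunc.algebraMap_ne_zero r.denom_ne_zero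
    rw [div_eq_iff hd] at h1
    have h2 : Polynomial.aeval τ r.denom * f = Polynomial.aeval τ r.num := by
      apply hj
      rw [map_mul, hjτ, hjτ, ← hr, ← map_mul]
      congr 1
      rw [mul_comm]; exact h1.symm
    obtain ⟨u, v, huv⟩ := RatFunc.isCoprime_num_denom r
    have h3 : Polynomial.aeval τ r.denom * (Polynomial.aeval τ u * f + Polynomial.aeval τ v) = 1 := by
      have := congrArg (Polynomial.aeval τ) huv
      simp only [map_add, map_mul, map_one] at this
      linear_combination (Polynomial.aeval τ u) * h2 + this
    obtain ⟨c, hc⟩ := hunit _ (IsUnit.of_mul_eq_one _ h3)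
    have h4 : r.denom = Polynomial.C c := by
      apply hτ; rw [hc]; simp
    have hc0 : c ≠ 0 := by
      rintro rfl
      exact r.denom_ne_zero (by rw [h4, map_zero])
    refine ⟨Polynomial.C c⁻¹ * r.num, ?_⟩
    rw [map_mul, ← h2, h4]
    rw [← mul_assoc, ← map_mul, ← map_mul, inv_mul_cancel₀ hc0]
    simp
  refine ⟨?_, ?_⟩
  · intro h
    obtain ⟨c', hc'⟩ := hunit _ h
    have : (Polynomial.X - Polynomial.C c : Polynomial k) = Polynomial.C c' := by
      apply hτ; rw [← hτc, hc']; simp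
    have := congrArg Polynomial.natDegree this
    simp at this
  · intro f h hfh
    have hj1 : j f * j h = Polynomial.C (ktoF (Polynomial.X - Polynomial.C c)) := by
      rw [← map_mul, ← hfh, hτc, hjτ]
    have hne : j f * j h ≠ 0 := by
      rw [hj1, Ne, Polynomial.C_eq_zero]
      exact RatFunc.algebraMap_ne_zero (Polynomial.X_sub_C_ne_zero c)
    have hd := Polynomial.natDegree_mul (left_ne_zero_of_mul hne) (right_ne_zero_of_mul hne)
    rw [hj1, Polynomial.natDegree_C] at hd
    obtain ⟨a, rfl⟩ := deg0 f (by omega)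
    obtain ⟨b, rfl⟩ := deg0 h (by omega)
    have : Polynomial.X - Polynomial.C c = a * b := by
      apply hτ; rw [← hτc, hfh, map_mul]
    rcases (Polynomial.irreducible_X_sub_C c).isUnit_or_isUnit this with h | h
    · exact Or.inl (h.map _)
    · exact Or.inr (h.map _)

variable {P : B3 k}

/-- `H_P` is an affine plane -/
structure PlaneHom (P : B3 k) (φ : SL2Ring k →ₐ[k] MvPolynomial (Fin 2) k) : Prop where
  surj : Function.Surjective φ
  ker : ∀ r, φ r = 0 ↔ etaStar k P ∣ r

theorem S1 (hP : IsVarOverRatFunc k P) {φ : SL2Ring k →ₐ[k] MvPolynomial (Fin 2) k}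
    (hφ : PlaneHom P φ) (c : k) :
    Prime (φ (tR - algebraMap k _ c)) := by
  obtain ⟨ψ, hψ⟩ := hP
  -- reduction modulo X 0
  let red : MvPolynomial (Fin 2) (RatFunc k) →ₐ[RatFunc k] Polynomial (RatFunc k) :=
    aeval ![0, Polynomial.X]
  let back : Polynomial (RatFunc k) →ₐ[RatFunc k] MvPolynomial (Fin 2) (RatFunc k) :=
    Polynomial.aeval (X 1)
  have hred : ∀ q, red q = 0 → X 0 ∣ q := by
    intro q hq
    have : Ideal.Quotient.mkₐ (RatFunc k) (Ideal.span {(X 0 : MvPolynomial (Fin 2) (RatFunc k))}) =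
      (Ideal.Quotient.mkₐ (RatFunc k) (Ideal.span {(X 0 : MvPolynomial (Fin 2) (RatFunc k))})).comp
        (back.comp red) := by
      apply MvPolynomial.algHom_ext
      intro i
      fin_cases i
      · simp [red]
      · simp [red, back]
    have := congrArg (fun h : _ →ₐ[RatFunc k] _ => h q) this
    simp only [AlgHom.comp_apply, hq, map_zero, Ideal.Quotient.mkₐ_eq_mk] at this
    rwa [Ideal.Quotient.eq_zero_iff_mem, Ideal.mem_span_singleton] at this
  let jm : SL2Ring k →+* Polynomial (RatFunc k) :=
    (red.toRingHom.comp ψ.toRingEquiv.toRingHom).comp rho.toRingHom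
  have hjm : ∀ r, jm r = red (ψ (rho r)) := fun r => rfl
  have hjt : ∀ θ : Polynomial k, jm (Polynomial.aeval tR θ) = Polynomial.C (ktoF θ) := by
    intro θ
    rw [hjm, ← eta_kt, rho_eta, toRat_kt]
    have h1 : ψ (C (ktoF θ)) = C (ktoF θ) := ψ.commutes _
    rw [h1]
    exact red.commutes _
  have hjP : jm (etaStar k P) = 0 := by
    rw [hjm, rho_eta, hψ]; simp [red]
  have hPt : ∀ θ : Polynomial k, θ ≠ 0 → ¬ etaStar k P ∣ Polynomial.aeval tR θ := by
    rintro θ hθ ⟨q, hq⟩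
    have := congrArg jm hq
    rw [hjt, map_mul, hjP, zero_mul, Polynomial.C_eq_zero] at this
    exact RatFunc.algebraMap_ne_zero hθ this
  have hker : ∀ r, jm r = 0 → φ r = 0 := by
    intro r hr
    obtain ⟨q, hq⟩ := hred _ hr
    have h1 : rho r = toRatFuncXY k P * ψ.symm q := by
      apply ψ.injective
      rw [map_mul, hψ, AlgEquiv.apply_symm_apply]; exact hq
    obtain ⟨θ, hθ, b, hb⟩ := exists_clear (ψ.symm q)
    have h2 : Polynomial.aeval tR θ * r = etaStar k P * etaStar k b := by
      apply rho_inj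
      rw [map_mul, map_mul, ← eta_kt, rho_eta, rho_eta, rho_eta, h1, ← hb]; ring
    have h3 : φ (Polynomial.aeval tR θ) * φ r = 0 := by
      rw [← map_mul, hφ.ker, h2]; exact dvd_mul_right _ _
    rcases mul_eq_zero.1 h3 with h4 | h4
    · exact absurd ((hφ.ker _).1 h4) (hPt θ hθ)
    · exact h4
  let j : MvPolynomial (Fin 2) k →+* Polynomial (RatFunc k) :=
    (RingHom.liftOfSurjective φ.toRingHom hφ.surj) ⟨jm, by
    intro a ha
    obtain ⟨q, rfl⟩ := (hφ.ker _).1 ha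
    show jm _ = 0
    rw [map_mul, hjP, zero_mul]⟩
  have hjj : ∀ r, j (φ r) = jm r := fun r =>
    RingHom.liftOfRightInverse_comp_apply _ _ _ _ r
  have haev : ∀ θ : Polynomial k, Polynomial.aeval (φ tR) θ = φ (Polynomial.aeval tR θ) := by
    intro θ
    exact Polynomial.aeval_algHom_apply φ tR θ
  have hirr : Irreducible (φ tR - algebraMap k _ c) := by
    apply irred_abstract (φ tR) _ _ j
    · rw [injective_iff_map_eq_zero]
      intro d hd
      obtain ⟨r, rfl⟩ := hφ.surj d
      exact hker r (by rw [← hjj]; exact hd)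
    · intro θ
      rw [haev, hjj, hjt]
    · intro d hd
      rw [MvPolynomial.isUnit_iff_eq_C_of_isReduced] at hd
      obtain ⟨a, -, ha⟩ := hd
      exact ⟨a, ha⟩
    · rw [injective_iff_map_eq_zero]
      intro θ hθ
      by_contra h0
      rw [haev, hφ.ker] at hθ
      exact hPt θ h0 hθ
  rw [map_sub, AlgHom.commutes]
  exact hirr.prime

variable {φ : SL2Ring k →ₐ[k] MvPolynomial (Fin 2) k}

theorem P_not_dvd (c : k) (hS : Prime (φ (tR - algebraMap k _ c))) (r : SL2Ring k)
    (hr : etaStar k P = (tR - algebraMap k _ c) * r) (hφ : PlaneHom P φ)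
    (hP0 : P ≠ 0) : False := by
  have h0 : φ (tR - algebraMap k _ c) * φ r = 0 := by
    rw [← map_mul, ← hr, hφ.ker]
  rcases mul_eq_zero.1 h0 with h | h
  · exact hS.ne_zero h
  · obtain ⟨q, rfl⟩ := (hφ.ker _).1 h
    have hPn : etaStar k P ≠ 0 := fun h => hP0 (eta_inj (by rw [h, map_zero]))
    have : (tR - algebraMap k _ c) * q = 1 := by
      apply mul_left_cancel₀ hPn
      rw [mul_one]; conv_rhs => rw [hr]
      ring
    exact t_sub_nonunit c (IsUnit.of_mul_eq_one _ this)

theorem isVar_ne_zero (hP : IsVarOverRatFunc k P) : P ≠ 0 := by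
  rintro rfl
  obtain ⟨ψ, hψ⟩ := hP
  rw [map_zero, map_zero] at hψ
  exact X_ne_zero _ hψ.symm

/-- evaluation `t = c`, `c ≠ 0`, on `R` -/
def sgc (c : k) (hc : c ≠ 0) : SL2Ring k →ₐ[k] MvPolynomial (Fin 2) k :=
  liftA (C c) (C c⁻¹ * (X 0 * X 1 - 1)) (X 0) (X 1) (by
    have : (C c : MvPolynomial (Fin 2) k) * C c⁻¹ = 1 := by
      rw [← map_mul, mul_inv_cancel₀ hc, map_one]
    linear_combination -(X 0 * X 1 - 1) * this)

theorem sgc_eta (c : k) (hc : c ≠ 0) (b : B3 k) : sgc c hc (etaStar k b) = evc c b := by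
  have : (sgc c hc).comp (etaStar k) = evc c := by
    apply algHomB_ext <;> simp [sgc]
  exact congrArg (fun h : B3 k →ₐ[k] _ => h b) this

theorem sgc_ker (c : k) (hc : c ≠ 0) (r : SL2Ring k) (h : sgc c hc r = 0) :
    (tR - algebraMap k _ c) ∣ r := by
  obtain ⟨n, b, hb⟩ := exists_t_pow r
  have h1 : evc c b = 0 := by rw [← sgc_eta c hc, ← hb, map_mul, h, mul_zero]
  rw [← dvd_iff_evc] at h1
  have h2 := map_dvd (etaStar k) h1
  rw [map_sub, eta_X0, eta_C, ← hb] at h2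
  have hcop : IsCoprime (tR - algebraMap k (SL2Ring k) c) tR := by
    refine ⟨-algebraMap k _ c⁻¹, algebraMap k _ c⁻¹, ?_⟩
    have : algebraMap k (SL2Ring k) c⁻¹ * algebraMap k (SL2Ring k) c = 1 := by
      rw [← map_mul, inv_mul_cancel₀ hc, map_one]
    linear_combination this
  exact (hcop.pow_right (n := n)).dvd_of_dvd_mul_left h2

theorem prime_evc (c : k) (hc : c ≠ 0) (hS : Prime (φ (tR - algebraMap k _ c)))
    (hφ : PlaneHom P φ) (hP0 : P ≠ 0) : Prime (evc c P) := by
  have lift : ∀ a b : B3 k, evc c P ∣ evc c a * evc c b →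
      φ (tR - algebraMap k _ c) ∣ φ (etaStar k a) * φ (etaStar k b) := by
    rintro a b ⟨q, hq⟩
    have h1 : sgc c hc (etaStar k (a * b - P * inc q)) = 0 := by
      rw [sgc_eta, map_sub, map_mul, map_mul, hq, evc_inc, sub_self]
    obtain ⟨w, hw⟩ := sgc_ker c hc _ h1
    refine ⟨φ w, ?_⟩
    rw [← map_mul, ← map_mul, ← map_mul, ← hw, map_sub, map_mul (etaStar k) P, map_sub]
    have : φ (etaStar k P * etaStar k (inc q)) = 0 := (hφ.ker _).2 (dvd_mul_right _ _)
    rw [this, sub_zero]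
  have back : ∀ a : B3 k, φ (tR - algebraMap k _ c) ∣ φ (etaStar k a) → evc c P ∣ evc c a := by
    rintro a ⟨w, hw⟩
    obtain ⟨w, rfl⟩ := hφ.surj w
    rw [← map_mul, ← sub_eq_zero, ← map_sub] at hw
    obtain ⟨q, hq⟩ := (hφ.ker _).1 hw
    have := congrArg (sgc c hc) hq
    rw [map_sub, map_mul, map_mul, sgc_eta, sgc_eta, map_sub] at this
    have h0 : sgc c hc (tR) = C c := by simp [sgc]
    have h1 : sgc c hc (algebraMap k _ c) = C c := (sgc c hc).commutes c
    rw [h0, h1, sub_self, zero_mul, sub_zero] at this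
    exact ⟨_, this⟩
  refine ⟨?_, ?_, ?_⟩
  · intro h
    rw [← dvd_iff_evc] at h
    obtain ⟨w, hw⟩ := h
    refine P_not_dvd (P := P) c hS (etaStar k w) ?_ hφ hP0
    conv_lhs => rw [hw]
    rw [map_mul, map_sub, eta_X0, eta_C]
  · intro h
    have h2 := lift 1 1 (h.dvd)
    rw [map_one, map_one, mul_one] at h2
    exact hS.not_isUnit (isUnit_of_dvd_one h2)
  · intro a b hab
    have h2 := lift (inc a) (inc b) (by rwa [evc_inc, evc_inc])
    rcases hS.dvd_or_dvd h2 with h | h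
    · left; have := back _ h; rwa [evc_inc] at this
    · right; have := back _ h; rwa [evc_inc] at this

end SLP
end

end

section
section
namespace SLP

variable {k : Type*} [Field k]

/-- the ideal of the hyperbola `t = 0, xy = 1` -/
def IH (k : Type*) [Field k] : Ideal (B3 k) := Ideal.span {X 0, X 1 * X 2 - 1}

theorem X0_mem_IH : (X 0 : B3 k) ∈ IH k := Ideal.subset_span (by simp)
theorem xy_mem_IH : (X 1 * X 2 - 1 : B3 k) ∈ IH k := Ideal.subset_span (by simp)

theorem eta_IH {b : B3 k} (hb : b ∈ IH k) : tR ∣ etaStar k b := by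
  obtain ⟨a, c, rfl⟩ := Ideal.mem_span_pair.1 hb
  refine ⟨etaStar k a + etaStar k c * uR, ?_⟩
  simp only [map_add, map_mul, map_sub, map_one, eta_X0, eta_X1, eta_X2, rel_R]
  ring

abbrev mH (k : Type*) [Field k] : B3 k →ₐ[k] (B3 k ⧸ IH k) := Ideal.Quotient.mkₐ k (IH k)

theorem mH_eq_zero {b : B3 k} : mH k b = 0 ↔ b ∈ IH k := Ideal.Quotient.eq_zero_iff_mem

theorem mH_xy : mH k (X 1) * mH k (X 2) = 1 := by
  rw [← map_mul, ← sub_eq_zero, ← map_one (mH k), ← map_sub, mH_eq_zero]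
  exact xy_mem_IH

theorem red_IH (b : B3 k) : ∃ (N : ℕ) (p : Polynomial k),
    mH k b = mH k (X 2) ^ N * Polynomial.aeval (mH k (X 1)) p := by
  let S : Subring (B3 k ⧸ IH k) :=
    (Polynomial.aeval (mH k (X 1)) : Polynomial k →ₐ[k] _).toRingHom.range
  let M : Submonoid (B3 k ⧸ IH k) := Submonoid.powers (mH k (X 1))
  have hxS : mH k (X 1) ∈ S := ⟨Polynomial.X, by simp⟩
  have hM : M ≤ S.toSubmonoid := by
    rw [Submonoid.powers_le]; exact hxS
  have : b ∈ (satur M S hM).comap (mH k).toRingHom := by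
    apply subringMv_top
    · intro r
      refine le_satur (hM := hM) ⟨Polynomial.C r, ?_⟩
      show Polynomial.aeval _ (Polynomial.C r) = mH k (C r)
      rw [Polynomial.aeval_C]
      rfl
    · intro i
      fin_cases i
      · have : mH k (X 0) = 0 := mH_eq_zero.2 X0_mem_IH
        show mH k (X 0) ∈ satur M S hM
        rw [this]; exact Subring.zero_mem _
      · exact le_satur (hM := hM) hxS
      · refine ⟨mH k (X 1), Submonoid.mem_powers _, ?_⟩
        show mH k (X 1) * mH k (X 2) ∈ S
        rw [mH_xy]; exact S.one_mem
  obtain ⟨_, ⟨N, rfl⟩, p, hp⟩ := this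
  refine ⟨N, p, ?_⟩
  have hp' : Polynomial.aeval (mH k (X 1)) p = mH k (X 1) ^ N * mH k b := hp
  have h1 : mH k (X 2) ^ N * mH k (X 1) ^ N = 1 := by
    rw [← mul_pow, mul_comm, mH_xy, one_pow]
  rw [hp', ← mul_assoc, h1, one_mul]

/-- `R → k(x)`, restriction to the hyperbola -/
def chi : SL2Ring k →ₐ[k] RatFunc k :=
  liftA 0 0 (ktoF Polynomial.X) (ktoF Polynomial.X)⁻¹ (by
    rw [mul_inv_cancel₀ (RatFunc.algebraMap_ne_zero Polynomial.X_ne_zero)]; ring)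

theorem chi_x : chi (xR : SL2Ring k) = ktoF Polynomial.X := by simp [chi]
theorem chi_y : chi (yR : SL2Ring k) = (ktoF Polynomial.X)⁻¹ := by simp [chi]
theorem chi_t : chi (tR : SL2Ring k) = 0 := by simp [chi]
theorem chi_u : chi (uR : SL2Ring k) = 0 := by simp [chi]

theorem ktoF_X_ne : ktoF (Polynomial.X : Polynomial k) ≠ 0 :=
  RatFunc.algebraMap_ne_zero Polynomial.X_ne_zero

theorem ktoF_aeval (p : Polynomial k) : Polynomial.aeval (ktoF Polynomial.X) p = ktoF p := by
  have : (Polynomial.aeval (ktoF (Polynomial.X : Polynomial k)) : Polynomial k →ₐ[k] RatFunc k) =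
      Algebra.algHom k (Polynomial k) (RatFunc k) := by
    ext1; simp [Algebra.algHom]
  rw [this]; rfl

theorem chi_eta {b : B3 k} {N : ℕ} {p : Polynomial k}
    (h : mH k b = mH k (X 2) ^ N * Polynomial.aeval (mH k (X 1)) p) :
    ktoF Polynomial.X ^ N * chi (etaStar k b) = ktoF p := by
  have h1 : b - X 2 ^ N * Polynomial.aeval (X 1) p ∈ IH k := by
    rw [← mH_eq_zero, map_sub, h, map_mul, map_pow, Polynomial.aeval_algHom_apply, sub_self]
  obtain ⟨r, hr⟩ := eta_IH h1
  have h2 := congrArg chi hr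
  rw [map_mul, chi_t, zero_mul, map_sub, map_sub, map_mul, map_mul, map_pow, map_pow, eta_X2,
    ← Polynomial.aeval_algHom_apply, ← Polynomial.aeval_algHom_apply, eta_X1, chi_x, chi_y,
    ktoF_aeval, sub_eq_zero] at h2
  rw [h2, ← mul_assoc, ← mul_pow, mul_inv_cancel₀ ktoF_X_ne, one_pow, one_mul]

theorem chi_range (r : SL2Ring k) : ∃ (M : ℕ) (p : Polynomial k),
    ktoF Polynomial.X ^ M * chi r = ktoF p := by
  let S : Subring (RatFunc k) := (ktoF (k := k)).range
  let M : Submonoid (RatFunc k) := Submonoid.powers (ktoF Polynomial.X)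
  have hxS : ktoF (Polynomial.X : Polynomial k) ∈ S := ⟨Polynomial.X, rfl⟩
  have hM : M ≤ S.toSubmonoid := by
    rw [Submonoid.powers_le]; exact hxS
  have : r ∈ (satur M S hM).comap (chi (k := k)).toRingHom := by
    apply subringR_top
    · intro r
      refine le_satur (hM := hM) ⟨Polynomial.C r, ?_⟩
      exact (chi.commutes r).symm
    · show chi tR ∈ satur M S hM
      rw [chi_t]; exact Subring.zero_mem _
    · show chi uR ∈ satur M S hM
      rw [chi_u]; exact Subring.zero_mem _
    · show chi xR ∈ satur M S hM
      rw [chi_x]; exact le_satur hxS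
    · show chi yR ∈ satur M S hM
      refine ⟨_, Submonoid.mem_powers _, ?_⟩
      rw [chi_y, mul_inv_cancel₀ ktoF_X_ne]; exact S.one_mem
  obtain ⟨_, ⟨N, rfl⟩, p, hp⟩ := this
  exact ⟨N, p, hp.symm⟩

variable {P : B3 k} {φ : SL2Ring k →ₐ[k] MvPolynomial (Fin 2) k}

theorem form_IH [IsAlgClosed k] (hφ : PlaneHom P φ) (hP0 : P ≠ 0)
    (hS : Prime (φ (tR - algebraMap k _ (0 : k)))) :
    ∃ (N i : ℕ) (ν lam : k), ν ≠ 0 ∧ lam ≠ 0 ∧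
      mH k P = mH k (X 2) ^ N * Polynomial.aeval (mH k (X 1))
        (Polynomial.C ν * Polynomial.X ^ i * (Polynomial.X - Polynomial.C lam)) := by
  obtain ⟨N, q, hq⟩ := red_IH P
  have hS' : Prime (φ tR) := by simpa using hS
  have hq0 : q ≠ 0 := by
    rintro rfl
    rw [map_zero, mul_zero, mH_eq_zero] at hq
    obtain ⟨r, hr⟩ := eta_IH hq
    exact P_not_dvd 0 hS r (by rw [hr]; simp) hφ hP0
  have hdv : φ tR ∣ φ (Polynomial.aeval xR q) := by
    have h1 : X 1 ^ N * P - Polynomial.aeval (X 1) q ∈ IH k := by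
      rw [← mH_eq_zero, map_sub, map_mul, hq, map_pow, ← Polynomial.aeval_algHom_apply, ← mul_assoc,
        ← mul_pow, mH_xy, one_pow, one_mul, sub_self]
    have h2 := map_dvd φ (eta_IH h1)
    rw [map_sub, map_mul, ← Polynomial.aeval_algHom_apply, eta_X1, map_sub, map_mul,
      (hφ.ker (etaStar k P)).2 dvd_rfl, mul_zero, zero_sub, dvd_neg] at h2
    exact h2
  have hroot : ∃ lam, q.IsRoot lam ∧ φ tR ∣ φ (xR - algebraMap k _ lam) := by
    have hsp := (IsAlgClosed.splits q).eq_prod_roots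
    rw [hsp] at hdv
    rw [map_mul, map_mul, Polynomial.aeval_C, map_multiset_prod, map_multiset_prod,
      Multiset.map_map, Multiset.map_map] at hdv
    rcases hS'.dvd_or_dvd hdv with h | h
    · exfalso
      apply hS'.not_isUnit
      refine isUnit_of_dvd_unit h ?_
      exact ((Polynomial.leadingCoeff_ne_zero.2 hq0).isUnit.map (algebraMap k _)).map φ
    · obtain ⟨a, ha, hd⟩ := hS'.exists_mem_multiset_map_dvd h
      refine ⟨a, Polynomial.isRoot_of_mem_roots ha, ?_⟩
      simpa using hd
  obtain ⟨lam, hlam, hdl⟩ := hroot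
  have hlam0 : lam ≠ 0 := by
    rintro rfl
    rw [map_zero, sub_zero] at hdl
    have h1 : φ tR ∣ φ (xR * yR) := by rw [map_mul]; exact hdl.mul_right _
    rw [rel_R, map_add, map_mul, map_one] at h1
    exact hS'.not_isUnit (isUnit_of_dvd_one ((dvd_add_right (dvd_mul_right _ _)).1 h1))
  obtain ⟨w, hw⟩ := hdl
  obtain ⟨w, rfl⟩ := hφ.surj w
  rw [← map_mul, ← sub_eq_zero, ← map_sub, hφ.ker] at hw
  obtain ⟨r, hr⟩ := hw
  have h3 := congrArg chi hr
  rw [map_sub, map_mul, chi_t, zero_mul, sub_zero, map_sub, chi_x, AlgHom.commutes, map_mul] at h3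
  obtain ⟨M, p, hp⟩ := chi_range r
  have h4 : Polynomial.X ^ (N + M) * (Polynomial.X - Polynomial.C lam) = q * p := by
    apply RatFunc.algebraMap_injective k
    rw [map_mul, map_mul, ← chi_eta hq, ← hp, map_sub, map_pow]
    have : algebraMap (Polynomial k) (RatFunc k) (Polynomial.C lam) = algebraMap k _ lam := rfl
    rw [this, h3]; ring
  obtain ⟨q', rfl⟩ := Polynomial.dvd_iff_isRoot.2 hlam
  have h5 : q' * p = Polynomial.X ^ (N + M) := by
    apply mul_left_cancel₀ (Polynomial.X_sub_C_ne_zero lam)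
    rw [← mul_assoc, ← h4]; ring
  obtain ⟨i, -, v, hv⟩ := (dvd_prime_pow Polynomial.prime_X _).1 (Dvd.intro _ h5)
  obtain ⟨c, hc, hcw⟩ := Polynomial.isUnit_iff.1 v⁻¹.isUnit
  have hj2 : q' = Polynomial.X ^ i * Polynomial.C c := by
    rw [hcw, ← hv, mul_assoc, Units.mul_inv, mul_one]
  refine ⟨N, i, c, lam, hc.ne_zero, hlam0, ?_⟩
  rw [hq, hj2]
  congr 2
  ring

/-- `h = x P_x - y P_y` -/
def hyp : Derivation k (B3 k) (B3 k) := (X 1 : B3 k) • pderiv 1 - (X 2 : B3 k) • pderiv 2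

theorem hyp_apply (b : B3 k) : hyp b = X 1 * pderiv 1 b - X 2 * pderiv 2 b := rfl
theorem hyp_X0 : hyp (X 0 : B3 k) = 0 := by
  rw [hyp_apply, pderiv_X_of_ne (by decide), pderiv_X_of_ne (by decide)]; ring
theorem hyp_X1 : hyp (X 1 : B3 k) = X 1 := by
  rw [hyp_apply, pderiv_X_self, pderiv_X_of_ne (by decide)]; ring
theorem hyp_X2 : hyp (X 2 : B3 k) = - X 2 := by
  rw [hyp_apply, pderiv_X_of_ne (by decide), pderiv_X_self]; ring

theorem hyp_IH {b : B3 k} (hb : b ∈ IH k) : hyp b ∈ IH k := by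
  obtain ⟨a, c, rfl⟩ := Ideal.mem_span_pair.1 hb
  have : hyp (a * X 0 + c * (X 1 * X 2 - 1)) = hyp a * X 0 + hyp c * (X 1 * X 2 - 1) := by
    simp only [map_add, map_sub, Derivation.leibniz, smul_eq_mul, hyp_X0, hyp_X1, hyp_X2,
      Derivation.map_one_eq_zero]
    ring
  rw [this]
  exact Ideal.add_mem _ (Ideal.mul_mem_left _ _ X0_mem_IH) (Ideal.mul_mem_left _ _ xy_mem_IH)

theorem hyp_form (N : ℕ) (q : Polynomial k)
    (h : mH k P = mH k (X 2) ^ N * Polynomial.aeval (mH k (X 1)) q) :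
    mH k (hyp P) = mH k (X 2) ^ N * Polynomial.aeval (mH k (X 1))
      (Polynomial.X * Polynomial.derivative q - (N : Polynomial k) * q) := by
  have h1 : P - X 2 ^ N * Polynomial.aeval (X 1) q ∈ IH k := by
    rw [← mH_eq_zero, map_sub, h, map_mul, map_pow, Polynomial.aeval_algHom_apply, sub_self]
  have h2 := hyp_IH h1
  have h3 : hyp (X 2 ^ N : B3 k) = - (N : B3 k) * X 2 ^ N := by
    rw [Derivation.leibniz_pow, hyp_X2]
    cases N with
    | zero => simp
    | succ n => simp [pow_succ]; ring
  rw [map_sub, Derivation.leibniz, Derivation.map_aeval, hyp_X1, h3, ← mH_eq_zero, map_sub,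
    sub_eq_zero] at h2
  rw [h2]
  simp only [smul_eq_mul, map_add, map_mul, map_sub, map_pow, ← Polynomial.aeval_algHom_apply,
    map_neg, Polynomial.aeval_X, map_natCast]
  ring

/-- Lemma (1, b) -/
theorem one_b [IsAlgClosed k] (hφ : PlaneHom P φ) (hP0 : P ≠ 0)
    (hS : Prime (φ (tR - algebraMap k _ (0 : k)))) :
    (∃ g : Polynomial k, g ≠ 0 ∧ ∃ a, Polynomial.aeval P g - hyp P * a ∈ IH k) ∧
    (∀ g : Polynomial k, Polynomial.aeval P g ∈ IH k → g = 0) := by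
  obtain ⟨N, i, ν, lam, hν, hlam, hPf⟩ := form_IH hφ hP0 hS
  have hxy := mH_xy (k := k)
  constructor
  · have hh := hyp_form N _ hPf
    have hX : Polynomial.X * Polynomial.derivative (Polynomial.X ^ i : Polynomial k) =
        (i : Polynomial k) * Polynomial.X ^ i := by
      cases i with
      | zero => simp
      | succ n => rw [Polynomial.derivative_X_pow_succ]; simp; ring
    have hd : Polynomial.X * Polynomial.derivative
        (Polynomial.C ν * Polynomial.X ^ i * (Polynomial.X - Polynomial.C lam)) -
        (N : Polynomial k) * (Polynomial.C ν * Polynomial.X ^ i * (Polynomial.X - Polynomial.C lam)) =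
        Polynomial.C ν * Polynomial.X ^ i * (Polynomial.C ((i : k) - N + 1) * Polynomial.X
          - Polynomial.C (((i : k) - N) * lam)) := by
      simp only [Polynomial.derivative_mul, Polynomial.derivative_C, Polynomial.derivative_sub,
        Polynomial.derivative_X, map_add, map_sub, map_mul, map_one, map_natCast]
      linear_combination (Polynomial.C ν * (Polynomial.X - Polynomial.C lam)) * hX
    rw [hd] at hh
    have hN1 : mH k (X 1) ^ N * mH k (X 2) ^ N = 1 := by rw [← mul_pow, hxy, one_pow]
    have hi1 : mH k (X 1) ^ i * mH k (X 2) ^ i = 1 := by rw [← mul_pow, hxy, one_pow]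
    have hinv : ∀ c : k, c ≠ 0 → algebraMap k (B3 k ⧸ IH k) c * algebraMap k (B3 k ⧸ IH k) c⁻¹ = 1 := by
      intro c hc
      rw [← map_mul, mul_inv_cancel₀ hc, map_one]
    have hmC : ∀ c : k, mH k (C c) = algebraMap k _ c := fun c => (mH k).commutes c
    by_cases hm1 : (i : k) - N + 1 = 0
    · refine ⟨1, one_ne_zero, X 1 ^ N * X 2 ^ i * C (ν * lam)⁻¹, ?_⟩
      have hm0 : (i : k) - N = -1 := by linear_combination hm1
      rw [← mH_eq_zero, map_sub, map_mul, hh, hm1, hm0]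
      simp only [map_mul, map_pow, hmC, map_sub, map_one, Polynomial.aeval_C,
        Polynomial.aeval_X, map_zero, zero_mul, zero_sub, map_neg]
      have := hinv (ν * lam) (mul_ne_zero hν hlam)
      rw [map_mul] at this
      linear_combination (-1 : B3 k ⧸ IH k) * this - (mH k (X 1) ^ i * mH k (X 2) ^ i *
        algebraMap k _ ν * algebraMap k _ lam * algebraMap k _ (ν * lam)⁻¹) * hN1 -
        (algebraMap k _ ν * algebraMap k _ lam * algebraMap k _ (ν * lam)⁻¹) * hi1
    · by_cases hm0 : (i : k) - N = 0
      · refine ⟨1, one_ne_zero, X 1 ^ N * X 2 ^ i * X 2 * C ν⁻¹, ?_⟩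
        rw [← mH_eq_zero, map_sub, map_mul, hh, hm0]
        simp only [map_mul, map_pow, hmC, map_sub, map_one, Polynomial.aeval_C,
          Polynomial.aeval_X, map_zero, zero_mul, sub_zero, zero_add, one_mul]
        have := hinv ν hν
        linear_combination (-1 : B3 k ⧸ IH k) * this - (mH k (X 1) ^ i * mH k (X 2) ^ i *
          algebraMap k _ ν * algebraMap k _ ν⁻¹ * mH k (X 1) * mH k (X 2)) * hN1 -
          (algebraMap k _ ν * algebraMap k _ ν⁻¹ * mH k (X 1) * mH k (X 2)) * hi1 -
          (algebraMap k _ ν * algebraMap k _ ν⁻¹) * hxy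
      · set m0 := (i : k) - N with hm0d
        set q := Polynomial.C ν * Polynomial.X ^ i * (Polynomial.X - Polynomial.C lam) with hqd
        let x0 := m0 * lam / (m0 + 1)
        have hx0 : x0 ≠ 0 := div_ne_zero (mul_ne_zero hm0 hlam) hm1
        have hx0' : (m0 + 1) * x0 = m0 * lam := mul_div_cancel₀ _ hm1
        let f0 := q.eval x0 / x0 ^ N
        have hroot : (q - Polynomial.C f0 * Polynomial.X ^ N).IsRoot x0 := by
          simp only [Polynomial.IsRoot, Polynomial.eval_sub, Polynomial.eval_mul,
            Polynomial.eval_C, Polynomial.eval_pow, Polynomial.eval_X]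
          simp only [f0]
          rw [div_mul_cancel₀ _ (pow_ne_zero _ hx0), sub_self]
        obtain ⟨w, hw⟩ := Polynomial.dvd_iff_isRoot.2 hroot
        refine ⟨Polynomial.X - Polynomial.C f0, Polynomial.X_sub_C_ne_zero f0,
          Polynomial.aeval (X 1) w * X 2 ^ i * C (ν * (m0 + 1))⁻¹, ?_⟩
        have hw' := congrArg (Polynomial.aeval (mH k (X 1))) hw
        have := hinv (ν * (m0 + 1)) (mul_ne_zero hν hm1)
        rw [map_mul] at this
        have hx0c := congrArg (algebraMap k (B3 k ⧸ IH k)) hx0'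
        rw [← mH_eq_zero, map_sub, map_mul, hh, ← Polynomial.aeval_algHom_apply, map_sub,
          Polynomial.aeval_X, hPf, Polynomial.aeval_C]
        simp only [map_mul, map_pow, hmC, map_sub, Polynomial.aeval_C,
          Polynomial.aeval_X, ← Polynomial.aeval_algHom_apply] at hw' hx0c ⊢
        rw [← hx0c]
        linear_combination mH k (X 2) ^ N * hw' + algebraMap k _ f0 * hN1 -
          (mH k (X 2) ^ N * (mH k (X 1) - algebraMap k _ x0) * Polynomial.aeval (mH k (X 1)) w) *
          this - (mH k (X 2) ^ N * (mH k (X 1) - algebraMap k _ x0) *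
          Polynomial.aeval (mH k (X 1)) w * algebraMap k _ ν * algebraMap k _ (m0 + 1) *
          algebraMap k _ (ν * (m0 + 1))⁻¹) * hi1
  · intro g hg
    by_contra hg0
    have hc := chi_eta hPf
    obtain ⟨r, hr⟩ := eta_IH hg
    have h1 := congrArg chi hr
    rw [map_mul, chi_t, zero_mul, ← Polynomial.aeval_algHom_apply,
      ← Polynomial.aeval_algHom_apply] at h1
    have halg : IsAlgebraic k (chi (etaStar k P)) := ⟨g, hg0, h1⟩
    have hInteg := halg.isIntegral
    have hdeg := IsAlgClosed.degree_eq_one_of_irreducible k (minpoly.irreducible hInteg)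
    obtain ⟨a, ha⟩ := minpoly.mem_range_of_degree_eq_one k _ hdeg
    rw [← ha] at hc
    have h2 : Polynomial.X ^ N * Polynomial.C a =
      (Polynomial.C ν * Polynomial.X ^ i * (Polynomial.X - Polynomial.C lam)) := by
      apply RatFunc.algebraMap_injective k
      rw [← hc, map_mul, map_pow]; rfl
    have h3 := congrArg (Polynomial.eval lam) h2
    simp [hlam] at h3
    rw [h3, map_zero, mul_zero] at h2
    have := Polynomial.X_sub_C_ne_zero lam
    have h5 : (Polynomial.C ν * Polynomial.X ^ i : Polynomial k) ≠ 0 := by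
      apply mul_ne_zero
      · simpa using hν
      · exact pow_ne_zero _ Polynomial.X_ne_zero
    exact mul_ne_zero h5 this h2.symm

end SLP
end

end

section
section
namespace SLP

theorem C_dvd_iff_map {R : Type*} [CommRing R] (c : R)
    (G : Polynomial (Polynomial R)) :
    Polynomial.C (Polynomial.X - Polynomial.C c) ∣ G ↔ G.map (Polynomial.evalRingHom c) = 0 := by
  rw [Polynomial.C_dvd_iff_dvd_coeff, Polynomial.ext_iff]
  simp [Polynomial.dvd_iff_isRoot]

theorem exists_cancel {R : Type*} [CommRing R] [IsDomain R] [WfDvdMonoid R] (c : R)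
    (G : Polynomial (Polynomial R)) (hG : G ≠ 0) :
    ∃ (n : ℕ) (G' : Polynomial (Polynomial R)),
      G = Polynomial.C (Polynomial.X - Polynomial.C c) ^ n * G' ∧
      G'.map (Polynomial.evalRingHom c) ≠ 0 := by
  have hnu : ¬ IsUnit (Polynomial.C (Polynomial.X - Polynomial.C c) : Polynomial (Polynomial R)) := by
    rw [Polynomial.isUnit_C]
    exact Polynomial.not_isUnit_X_sub_C c
  obtain ⟨G', h1, h2⟩ := (FiniteMultiplicity.of_not_isUnit hnu hG).exists_eq_pow_mul_and_not_dvd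
  exact ⟨_, G', h1, fun h => h2 ((C_dvd_iff_map c G').2 h)⟩

variable {k : Type*} [Field k]

theorem ev2_hom_ext {A : Type*} [CommRing A] {f g : Polynomial (Polynomial k) →+* A}
    (h1 : ∀ r : k, f (Polynomial.C (Polynomial.C r)) = g (Polynomial.C (Polynomial.C r)))
    (h2 : f (Polynomial.C Polynomial.X) = g (Polynomial.C Polynomial.X))
    (h4 : f Polynomial.X = g Polynomial.X) : f = g := by
  apply Polynomial.ringHom_ext' _ h4
  apply Polynomial.ringHom_ext' _ h2
  ext r
  exact h1 r

theorem ev2_cancel (p s : MvPolynomial (Fin 2) k) (hp : p ≠ 0) (G : Polynomial (Polynomial k))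
    (hG : G ≠ 0) (h : ev2 p s G = 0) :
    ∃ G' : Polynomial (Polynomial k), ev2 p s G' = 0 ∧ G'.map (Polynomial.evalRingHom 0) ≠ 0 := by
  obtain ⟨n, G', h1, h2⟩ := exists_cancel (0 : k) G hG
  refine ⟨G', ?_, h2⟩
  rw [h1, map_mul, map_pow, ev2_C] at h
  simp only [map_zero, sub_zero, Polynomial.aeval_X] at h
  exact (mul_eq_zero.1 h).resolve_left (pow_ne_zero _ hp)

theorem dep_lemma [IsAlgClosed k] (p : MvPolynomial (Fin 2) k) (hp : Prime p) :
    ∀ (n : ℕ) (s : MvPolynomial (Fin 2) k), s.totalDegree ≤ n → ∀ G : Polynomial (Polynomial k),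
      G ≠ 0 → ev2 p s G = 0 → ∃ g : Polynomial k, s = Polynomial.aeval p g := by
  have hpd : 1 ≤ p.totalDegree := by
    by_contra h
    have h0 : p.totalDegree = 0 := by omega
    rw [totalDegree_eq_zero_iff_eq_C] at h0
    have h1 : coeff 0 p ≠ 0 := by
      intro h1
      rw [h1, map_zero] at h0
      exact hp.ne_zero h0
    apply hp.not_isUnit
    rw [h0]
    exact h1.isUnit.map C
  intro n
  induction n with
  | zero =>
    intro s hs G _ _
    rw [Nat.le_zero, totalDegree_eq_zero_iff_eq_C] at hs
    refine ⟨Polynomial.C (coeff 0 s), ?_⟩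
    rw [Polynomial.aeval_C]; exact hs
  | succ n ih =>
    intro s hs G hG0 hG
    obtain ⟨G, hG, hG0⟩ := ev2_cancel p s hp.ne_zero G hG0 hG
    -- reduce mod p
    have hmod : p ∣ Polynomial.aeval s (G.map (Polynomial.evalRingHom 0)) := by
      have hx : (Polynomial.C (Polynomial.X) : Polynomial (Polynomial k)) ∣
          G - (G.map (Polynomial.evalRingHom 0)).map Polynomial.C := by
        have := (C_dvd_iff_map (0 : k) (G - (G.map (Polynomial.evalRingHom 0)).map Polynomial.C)).2 (by
          rw [Polynomial.map_sub, Polynomial.map_map (f := Polynomial.C)]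
          have : (Polynomial.evalRingHom (0 : k)).comp Polynomial.C = RingHom.id k := by
            ext; simp
          rw [this, Polynomial.map_id, sub_self])
        simpa using this
      obtain ⟨w, hw⟩ := hx
      have h1 := congrArg (ev2 p s) hw
      rw [map_sub, hG, map_mul, ev2_C, Polynomial.aeval_X, zero_sub] at h1
      have h2 : ∀ q : Polynomial k, ev2 p s (q.map Polynomial.C) = Polynomial.aeval s q := by
        intro q
        have : (ev2 p s).comp (Polynomial.mapRingHom Polynomial.C) =
            (Polynomial.aeval s : Polynomial k →ₐ[k] _).toRingHom := by
          apply Polynomial.ringHom_ext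
          · intro a; simp [ev2]
          · simp [ev2]
        exact congrArg (fun h : Polynomial k →+* _ => h q) this
      rw [h2] at h1
      exact ⟨-ev2 p s w, by linear_combination -h1⟩
    have hroot : ∃ lam : k, p ∣ s - C lam := by
      set q := G.map (Polynomial.evalRingHom 0) with hq
      have hsp := (IsAlgClosed.splits q).eq_prod_roots
      rw [hsp, map_mul, Polynomial.aeval_C, map_multiset_prod, Multiset.map_map] at hmod
      rcases hp.dvd_or_dvd hmod with h | h
      · exfalso
        apply hp.not_isUnit
        refine isUnit_of_dvd_unit h ?_
        exact ((Polynomial.leadingCoeff_ne_zero.2 hG0).isUnit.map (algebraMap k _))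
      · obtain ⟨a, ha, hd⟩ := hp.exists_mem_multiset_map_dvd h
        exact ⟨a, by simpa [algebraMap_eq] using hd⟩
    obtain ⟨lam, s', hs'⟩ := hroot
    have hs2 : s = C lam + p * s' := by linear_combination hs'
    by_cases hs0 : s' = 0
    · refine ⟨Polynomial.C lam, ?_⟩
      rw [hs2, hs0, Polynomial.aeval_C]; simp [algebraMap_eq]
    have hdeg : s'.totalDegree ≤ n := by
      have h1 : (s - C lam).totalDegree ≤ s.totalDegree := totalDegree_sub_C_le _ _
      rw [hs', totalDegree_mul_of_isDomain hp.ne_zero hs0] at h1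
      omega
    obtain ⟨g, hg⟩ := ih s' hdeg
      (G.comp (Polynomial.C (Polynomial.C lam) + Polynomial.C Polynomial.X * Polynomial.X)) (by
        intro h0
        rw [Polynomial.comp_eq_zero_iff] at h0
        rcases h0 with h0 | ⟨-, h0⟩
        · rw [h0] at hG0; simp at hG0
        · have := congrArg (fun q => Polynomial.coeff q 1) h0
          simp [Polynomial.coeff_C] at this)
      (by
        have : (ev2 p s').comp (Polynomial.compRingHom
            (Polynomial.C (Polynomial.C lam) + Polynomial.C Polynomial.X * Polynomial.X)) =
            ev2 p s := by
          apply ev2_hom_ext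
          · intro r; simp [ev2]
          · simp [ev2]
          · simp [ev2, hs2, algebraMap_eq]
        rw [← hG, ← this]; rfl)
    refine ⟨Polynomial.C lam + Polynomial.X * g, ?_⟩
    rw [hs2, hg]; simp [algebraMap_eq]

variable {P : B3 k}

theorem kap_mem (S : Subring (B3 k)) {s : B3 k} (hC : ∀ r : k, C r ∈ S) (ht : X 0 ∈ S) (hP : P ∈ S)
    (hs : s ∈ S) (G : W3 k) : kap P s G ∈ S := by
  have h1 : ∀ g : Polynomial k, Polynomial.aeval P g ∈ S := by
    intro g
    induction g using Polynomial.induction_on' with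
    | add p q hp hq => rw [map_add]; exact S.add_mem hp hq
    | monomial n a =>
      rw [Polynomial.aeval_monomial]
      exact S.mul_mem (hC a) (S.pow_mem hP n)
  have h2 : ∀ g : Polynomial (Polynomial k), kap P s (Polynomial.C g) ∈ S := by
    intro g
    induction g using Polynomial.induction_on' with
    | add p q hp hq => rw [map_add, map_add]; exact S.add_mem hp hq
    | monomial n a =>
      rw [← Polynomial.C_mul_X_pow_eq_monomial, map_mul, map_mul, kap_CC, map_pow, map_pow, kap_CX]
      exact S.mul_mem (h1 a) (S.pow_mem ht n)
  induction G using Polynomial.induction_on' with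
  | add p q hp hq => rw [map_add]; exact S.add_mem hp hq
  | monomial n a =>
    rw [← Polynomial.C_mul_X_pow_eq_monomial, map_mul, map_pow, kap_X]
    exact S.mul_mem (h2 a) (S.pow_mem hs n)

theorem kap_range_C {s : B3 k} (r : k) : C r ∈ RingHom.range (R := W3 k) (kap P s) :=
  ⟨Polynomial.C (Polynomial.C (Polynomial.C r)), by rw [kap_CC, Polynomial.aeval_C]; rfl⟩
theorem kap_range_X0 {s : B3 k} : X 0 ∈ RingHom.range (R := W3 k) (kap P s) :=
  ⟨Polynomial.C Polynomial.X, kap_CX P s⟩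
theorem kap_range_aeval {s : B3 k} (g : Polynomial k) :
    Polynomial.aeval P g ∈ RingHom.range (R := W3 k) (kap P s) :=
  ⟨Polynomial.C (Polynomial.C g), kap_CC P s g⟩
theorem kap_range_P {s : B3 k} : P ∈ RingHom.range (R := W3 k) (kap P s) := by
  simpa using kap_range_aeval (P := P) (s := s) Polynomial.X
theorem kap_range_s {s : B3 k} : s ∈ RingHom.range (R := W3 k) (kap P s) :=
  ⟨Polynomial.X, kap_X P s⟩

theorem stage1_aux [IsAlgClosed k] : ∀ (n : ℕ) (s : B3 k) (j : Polynomial k), j.natDegree ≤ n →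
    GV P s → j ≠ 0 → DB P s = kt j →
    ∃ s, GV P s ∧ (∃ j : Polynomial k, j ≠ 0 ∧ DB P s = kt j) ∧
      ∀ c, Prime (evc c P) → Function.Injective (ev2 (evc c P) (evc c s)) := by
  intro n
  induction n with
  | zero =>
    intro s j hj hGV hj0 hDB
    refine ⟨s, hGV, ⟨j, hj0, hDB⟩, ?_⟩
    intro c hc
    by_contra hinj
    rw [injective_iff_map_eq_zero] at hinj
    push Not at hinj
    obtain ⟨G, hG, hG0⟩ := hinj
    obtain ⟨g, hg⟩ := dep_lemma (evc c P) hc _ (evc c s) le_rfl G hG0 hG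
    have h1 : evc c (s - Polynomial.aeval P g) = 0 := by
      rw [map_sub, hg, Polynomial.aeval_algHom_apply, sub_self]
    rw [← dvd_iff_evc] at h1
    obtain ⟨s', hs'⟩ := h1
    have h2 := congrArg (DB P) hs'
    rw [map_sub, DB_aeval, sub_zero, hDB, Derivation.leibniz, map_sub, DB_X0] at h2
    have h3 := congrArg (evc c) h2
    rw [evc_kt] at h3
    simp [DB_apply] at h3
    rw [Nat.le_zero, Polynomial.natDegree_eq_zero] at hj
    obtain ⟨a, rfl⟩ := hj
    simp at h3
    rw [h3] at hj0; simp at hj0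
  | succ n ih =>
    intro s j hj hGV hj0 hDB
    by_cases hall : ∀ c, Prime (evc c P) → Function.Injective (ev2 (evc c P) (evc c s))
    · exact ⟨s, hGV, ⟨j, hj0, hDB⟩, hall⟩
    push Not at hall
    obtain ⟨c, hc, hinj⟩ := hall
    rw [injective_iff_map_eq_zero] at hinj
    push Not at hinj
    obtain ⟨G, hG, hG0⟩ := hinj
    obtain ⟨g, hg⟩ := dep_lemma (evc c P) hc _ (evc c s) le_rfl G hG0 hG
    have h1 : evc c (s - Polynomial.aeval P g) = 0 := by
      rw [map_sub, hg, Polynomial.aeval_algHom_apply, sub_self]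
    rw [← dvd_iff_evc] at h1
    obtain ⟨s', hs'⟩ := h1
    have h2 := congrArg (DB P) hs'
    have hD0 : DB P (X 0 - C c) = 0 := by
      rw [map_sub, DB_X0]; simp [DB_apply]
    rw [map_sub, DB_aeval, sub_zero, hDB, Derivation.leibniz, hD0] at h2
    have h3 := congrArg (evc c) h2
    rw [evc_kt] at h3
    simp at h3
    obtain ⟨j', hj'⟩ := Polynomial.dvd_iff_isRoot.2 h3
    have hj'0 : j' ≠ 0 := by rintro rfl; exact hj0 (by rw [hj', mul_zero])
    have hktc : kt (Polynomial.X - Polynomial.C c) = (X 0 - C c : B3 k) := by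
      simp [kt, algebraMap_eq]
    have h4 : DB P s' = kt j' := by
      apply mul_left_cancel₀ (X0_sub_ne c)
      rw [hj', map_mul, hktc] at h2
      rw [h2]; simp
    refine ih s' j' ?_ ?_ hj'0 h4
    · rw [hj', Polynomial.natDegree_mul (Polynomial.X_sub_C_ne_zero c) hj'0,
        Polynomial.natDegree_X_sub_C] at hj
      omega
    · intro b
      obtain ⟨θ, hθ, G, hG⟩ := hGV b
      have : kap P s G ∈ RingHom.range (R := W3 k) (kap P s') := by
        refine kap_mem _ kap_range_C kap_range_X0 kap_range_P ?_ G
        have : s = (X 0 - C c) * s' + Polynomial.aeval P g := by linear_combination hs'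
        rw [this]
        exact Subring.add_mem _ (Subring.mul_mem _ (Subring.sub_mem _ kap_range_X0 (kap_range_C c))
          kap_range_s) (kap_range_aeval g)
      obtain ⟨G', hG'⟩ := this
      exact ⟨θ, hθ, G', by rw [hG, hG']⟩

theorem stage1 [IsAlgClosed k] (hP : IsVarOverRatFunc k P) :
    ∃ s, GV P s ∧ (∃ j : Polynomial k, j ≠ 0 ∧ DB P s = kt j) ∧
      ∀ c, Prime (evc c P) → Function.Injective (ev2 (evc c P) (evc c s)) := by
  obtain ⟨s, h1, j, hj, h2⟩ := lemma_IV P hP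
  exact stage1_aux _ s j le_rfl h1 hj h2

variable {s : B3 k}

theorem kap_Tc (c : k) : kap P s (Polynomial.C (Polynomial.X - Polynomial.C (Polynomial.C c))) =
    X 0 - C c := by
  rw [map_sub, map_sub, kap_CX, kap_CC, Polynomial.aeval_C]; rfl

theorem kap_inj (c : k) (hinj : Function.Injective (ev2 (evc c P) (evc c s))) :
    Function.Injective (kap P s) := by
  rw [injective_iff_map_eq_zero]
  intro G hG
  by_contra hG0
  obtain ⟨n, G', h1, h2⟩ := exists_cancel (Polynomial.C c) G hG0
  rw [h1, map_mul, map_pow, kap_Tc] at hG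
  have h3 := (mul_eq_zero.1 hG).resolve_left (pow_ne_zero _ (X0_sub_ne c))
  have h4 := congrArg (evc c) h3
  rw [evc_kap, map_zero] at h4
  exact h2 (hinj (by rw [h4, map_zero]))

/-- cancel a factor `t - c` -/
theorem kap_div (c : k) (hinj : Function.Injective (ev2 (evc c P) (evc c s))) {b : B3 k}
    {G : W3 k} (h : (X 0 - C c) * b = kap P s G) : ∃ G', b = kap P s G' ∧
      G = Polynomial.C (Polynomial.X - Polynomial.C (Polynomial.C c)) * G' := by
  have h4 := congrArg (evc c) h
  rw [evc_kap] at h4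
  simp only [map_mul, map_sub, evc_X0, evc_C, sub_self, zero_mul] at h4
  have h5 : G.map (Polynomial.evalRingHom (Polynomial.C c)) = 0 := hinj (by rw [← h4, map_zero])
  rw [← C_dvd_iff_map] at h5
  obtain ⟨G', rfl⟩ := h5
  refine ⟨G', ?_, rfl⟩
  rw [map_mul, kap_Tc] at h
  exact mul_left_cancel₀ (X0_sub_ne c) h

theorem cons2_aux [IsAlgClosed k]
    (hinj : ∀ c, c ≠ 0 → Function.Injective (ev2 (evc c P) (evc c s))) :
    ∀ (n : ℕ) (θ : Polynomial k), θ ≠ 0 → θ.natDegree ≤ n → ∀ b G, kt θ * b = kap P s G →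
      ∃ m G, X 0 ^ m * b = kap P s G := by
  have const : ∀ (a : k) (b : B3 k) G, a ≠ 0 → kt (Polynomial.C a) * b = kap P s G →
      ∃ m G, X 0 ^ m * b = kap P s G := by
    intro a b G ha h
    refine ⟨0, Polynomial.C (Polynomial.C (Polynomial.C a⁻¹)) * G, ?_⟩
    rw [map_mul, ← h, kap_CC, kt, Polynomial.aeval_C, Polynomial.aeval_C, ← mul_assoc, ← map_mul,
      inv_mul_cancel₀ ha]
    simp
  intro n
  induction n with
  | zero =>
    intro θ hθ hd b G h
    rw [Nat.le_zero, Polynomial.natDegree_eq_zero] at hd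
    obtain ⟨a, rfl⟩ := hd
    exact const a b G (by rintro rfl; simp at hθ) h
  | succ n ih =>
    intro θ hθ hd b G h
    by_cases hdeg : θ.natDegree = 0
    · obtain ⟨a, rfl⟩ := Polynomial.natDegree_eq_zero.1 hdeg
      exact const a b G (by rintro rfl; simp at hθ) h
    obtain ⟨c, hc⟩ := IsAlgClosed.exists_root θ (by
      intro h0; exact hdeg (Polynomial.natDegree_eq_of_degree_eq_some h0))
    obtain ⟨θ', rfl⟩ := Polynomial.dvd_iff_isRoot.2 hc
    have hθ' : θ' ≠ 0 := right_ne_zero_of_mul hθ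
    have hd' : θ'.natDegree ≤ n := by
      rw [Polynomial.natDegree_mul (Polynomial.X_sub_C_ne_zero c) hθ',
        Polynomial.natDegree_X_sub_C] at hd
      omega
    have hktc : kt (Polynomial.X - Polynomial.C c) = (X 0 - C c : B3 k) := by
      simp [kt, algebraMap_eq]
    rw [map_mul, hktc] at h
    by_cases hc0 : c = 0
    · subst hc0
      obtain ⟨m, G', hG'⟩ := ih θ' hθ' hd' (X 0 * b) G (by rw [← h]; simp; ring)
      exact ⟨m + 1, G', by rw [← hG']; ring⟩
    · rw [mul_assoc] at h
      obtain ⟨G', hG', -⟩ := kap_div c (hinj c hc0) h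
      exact ih θ' hθ' hd' b G' hG'

theorem cons2 [IsAlgClosed k] (hGV : GV P s)
    (hinj : ∀ c, c ≠ 0 → Function.Injective (ev2 (evc c P) (evc c s))) (b : B3 k) :
    ∃ m G, X 0 ^ m * b = kap P s G := by
  obtain ⟨θ, hθ, G, hG⟩ := hGV b
  exact cons2_aux hinj _ θ hθ le_rfl b G hG

def VP (P : B3 k) : Prop := ∃ s, Function.Surjective (kap P s)

theorem cons3 [IsAlgClosed k] (hGV : GV P s)
    (hinj : ∀ c, Function.Injective (ev2 (evc c P) (evc c s))) : VP P := by
  refine ⟨s, fun b => ?_⟩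
  obtain ⟨m, G, h⟩ := cons2 hGV (fun c _ => hinj c) b
  induction m generalizing G with
  | zero => exact ⟨G, by rw [← h]; simp⟩
  | succ m ih =>
    obtain ⟨G', hG', -⟩ := kap_div 0 (hinj 0) (b := X 0 ^ m * b) (G := G) (by rw [← h]; simp; ring)
    exact ih G' hG'

/-! ### Stage 2 -/

def SatP (P s : B3 k) : Prop := ∀ b, ∃ g : Polynomial k, g ≠ 0 ∧ ∃ (ρ : ℕ) (G : W3 k),
  Polynomial.aeval P g * X 0 ^ ρ * b = kap P s G

theorem stage2_aux (htr : ∀ g : Polynomial k, Polynomial.aeval (evc 0 P) g = 0 → g = 0) :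
    ∀ (r : ℕ) (s : B3 k) (g j : Polynomial k), g ≠ 0 → j.eval 0 ≠ 0 → SatP P s →
      DB P s = Polynomial.aeval P g * X 0 ^ r * kt j →
      ∃ s, SatP P s ∧ ∀ Γ : Polynomial (Polynomial k), Γ ≠ 0 → ev2 (evc 0 P) (evc 0 s) Γ = 0 →
        2 ≤ Γ.natDegree := by
  intro r
  induction r with
  | zero =>
    intro s g j hg hj hsat hDB
    refine ⟨s, hsat, fun Γ hΓ h0 => ?_⟩
    by_contra hd
    rw [Polynomial.eq_X_add_C_of_natDegree_le_one (by omega : Γ.natDegree ≤ 1)] at h0 hΓ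
    set g1 := Γ.coeff 1
    set g0 := Γ.coeff 0
    have hg1 : g1 ≠ 0 := by
      intro h1
      rw [h1] at h0 hΓ
      simp only [map_zero, zero_mul, zero_add, ev2_C] at h0 hΓ
      rw [htr _ h0] at hΓ
      simp at hΓ
    rw [map_add, map_mul, ev2_C, ev2_C, ev2_X, Polynomial.aeval_algHom_apply,
      Polynomial.aeval_algHom_apply, ← map_mul, ← map_add, ← dvd_iff_evc] at h0
    obtain ⟨s', hs'⟩ := h0
    have h2 := congrArg (DB P) hs'
    have hD0 : DB P (X 0 - C 0) = 0 := by
      rw [map_sub, DB_X0]; simp [DB_apply]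
    rw [map_add, Derivation.leibniz, Derivation.leibniz, DB_aeval, DB_aeval, hD0, hDB] at h2
    simp only [smul_eq_mul, mul_zero, add_zero, pow_zero, mul_one] at h2
    have h3 := congrArg (evc 0) h2
    have hX : evc (0:k) (X 0 - C 0) = 0 := by simp
    rw [map_mul, map_mul, map_mul, hX, zero_mul, evc_kt, ← Polynomial.aeval_algHom_apply,
      ← Polynomial.aeval_algHom_apply] at h3
    rcases mul_eq_zero.1 h3 with h | h
    · exact hg1 (htr _ h)
    · rcases mul_eq_zero.1 h with h | h
      · exact hg (htr _ h)
      · rw [C_eq_zero] at h; exact hj h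
  | succ r ih =>
    intro s g j hg hj hsat hDB
    by_cases hall : ∀ Γ : Polynomial (Polynomial k), Γ ≠ 0 → ev2 (evc 0 P) (evc 0 s) Γ = 0 →
        2 ≤ Γ.natDegree
    · exact ⟨s, hsat, hall⟩
    push Not at hall
    obtain ⟨Γ, hΓ, h0, hd⟩ := hall
    rw [Polynomial.eq_X_add_C_of_natDegree_le_one (by omega : Γ.natDegree ≤ 1)] at h0 hΓ
    set g1 := Γ.coeff 1
    set g0 := Γ.coeff 0
    have hg1 : g1 ≠ 0 := by
      intro h1
      rw [h1] at h0 hΓ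
      simp only [map_zero, zero_mul, zero_add, ev2_C] at h0 hΓ
      rw [htr _ h0] at hΓ
      simp at hΓ
    rw [map_add, map_mul, ev2_C, ev2_C, ev2_X, Polynomial.aeval_algHom_apply,
      Polynomial.aeval_algHom_apply, ← map_mul, ← map_add, ← dvd_iff_evc] at h0
    obtain ⟨s', hs'⟩ := h0
    have h2 := congrArg (DB P) hs'
    have hD0 : DB P (X 0 - C 0) = 0 := by
      rw [map_sub, DB_X0]; simp [DB_apply]
    rw [map_add, Derivation.leibniz, Derivation.leibniz, DB_aeval, DB_aeval, hD0, hDB] at h2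
    simp only [smul_eq_mul, mul_zero, add_zero, map_zero, sub_zero] at h2 hs'
    refine ih s' (g1 * g) j (mul_ne_zero hg1 hg) hj ?_ ?_
    · intro b
      let S : Subring (B3 k) := RingHom.range (R := W3 k) (kap P s')
      let M : Submonoid (B3 k) :=
        { carrier := {m | ∃ g : Polynomial k, g ≠ 0 ∧ ∃ ρ : ℕ, m = Polynomial.aeval P g * X 0 ^ ρ}
          mul_mem' := by
            rintro _ _ ⟨g, hg, ρ, rfl⟩ ⟨g', hg', ρ', rfl⟩
            exact ⟨g * g', mul_ne_zero hg hg', ρ + ρ', by rw [map_mul]; ring⟩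
          one_mem' := ⟨1, one_ne_zero, 0, by simp⟩ }
      have hM : M ≤ S.toSubmonoid := by
        rintro _ ⟨g, hg, ρ, rfl⟩
        exact S.mul_mem (kap_range_aeval g) (S.pow_mem kap_range_X0 ρ)
      have hsS : s ∈ satur M S hM := by
        refine ⟨Polynomial.aeval P g1, ⟨g1, hg1, 0, by simp⟩, ?_⟩
        have : Polynomial.aeval P g1 * s = X 0 * s' - Polynomial.aeval P g0 := by
          linear_combination hs'
        rw [this]
        exact S.sub_mem (S.mul_mem kap_range_X0 kap_range_s) (kap_range_aeval g0)
      obtain ⟨g', hg', ρ, G, hG⟩ := hsat b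
      have hb : b ∈ satur M S hM := by
        refine satur_of_mul (m := Polynomial.aeval P g' * X 0 ^ ρ) ⟨g', hg', ρ, rfl⟩ ?_
        rw [hG]
        exact kap_mem _ (fun r => le_satur (kap_range_C r)) (le_satur kap_range_X0)
          (le_satur kap_range_P) hsS G
      obtain ⟨_, ⟨g, hg, ρ, rfl⟩, G, hG⟩ := hb
      exact ⟨g, hg, ρ, G, hG.symm⟩
    · apply mul_left_cancel₀ (X_ne_zero 0 : (X 0 : B3 k) ≠ 0)
      rw [← h2, map_mul]; ring

theorem stage2 [IsAlgClosed k] (hGV : GV P s)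
    (hinj : ∀ c, c ≠ 0 → Function.Injective (ev2 (evc c P) (evc c s)))
    (hj : ∃ j : Polynomial k, j ≠ 0 ∧ DB P s = kt j)
    (htr : ∀ g : Polynomial k, Polynomial.aeval (evc 0 P) g = 0 → g = 0) :
    ∃ s, SatP P s ∧ ∀ Γ : Polynomial (Polynomial k), Γ ≠ 0 → ev2 (evc 0 P) (evc 0 s) Γ = 0 →
        2 ≤ Γ.natDegree := by
  obtain ⟨j, hj, hDB⟩ := hj
  obtain ⟨j', hj', hj2⟩ := Polynomial.exists_eq_pow_rootMultiplicity_mul_and_not_dvd j hj 0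
  refine stage2_aux htr (j.rootMultiplicity 0) s 1 j' one_ne_zero ?_ ?_ ?_
  · rwa [Polynomial.dvd_iff_isRoot] at hj2
  · intro b
    obtain ⟨m, G, h⟩ := cons2 hGV hinj b
    exact ⟨1, one_ne_zero, m, G, by rw [← h]; simp⟩
  · conv_lhs => rw [hDB, hj']
    rw [map_mul, map_pow]
    simp [kt]

/-- Type I -/
theorem typeI (hsat : SatP P s) (hinj : Function.Injective (ev2 (evc 0 P) (evc 0 s))) :
    Prime (evc 0 P) := by
  have haev : Function.Injective (Polynomial.aeval (evc 0 P) : Polynomial k →ₐ[k] _) := by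
    intro a b h
    rw [← ev2_C (evc 0 P) (evc 0 s), ← ev2_C (evc 0 P) (evc 0 s)] at h
    exact Polynomial.C_injective (hinj h)
  have h1 : ∀ b : MvPolynomial (Fin 2) k, ∃ g : Polynomial k, g ≠ 0 ∧
      ∃ H, Polynomial.aeval (evc 0 P) g * b = ev2 (evc 0 P) (evc 0 s) H := by
    intro b
    obtain ⟨g, hg, ρ, G, h⟩ := hsat (inc b)
    induction ρ generalizing G with
    | zero =>
      have := congrArg (evc 0) h
      rw [evc_kap, pow_zero, mul_one, map_mul, evc_inc, ← Polynomial.aeval_algHom_apply] at this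
      exact ⟨g, hg, _, this⟩
    | succ m ih =>
      obtain ⟨G', hG', -⟩ := kap_div 0 hinj (b := Polynomial.aeval P g * X 0 ^ m * inc b) (G := G)
        (by rw [← h]; simp; ring)
      exact ih G' hG'
  obtain ⟨e, he⟩ := lift_exists (ev2 (evc 0 P) (evc 0 s)) hinj
    ((nonZeroDivisors (Polynomial k)).map Polynomial.C) (by
      rintro ⟨g, hg, h0⟩
      exact nonZeroDivisors.ne_zero hg (Polynomial.C_eq_zero.1 h0)) (by
      intro r
      obtain ⟨g, hg, H, hH⟩ := h1 r
      exact ⟨Polynomial.C g, ⟨g, mem_nonZeroDivisors_of_ne_zero hg, rfl⟩, H, by rw [ev2_C, hH]⟩)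
    (Polynomial.mapRingHom (ktoF (k := k))) (by
      rintro _ ⟨g, hg, rfl⟩
      rw [Polynomial.coe_mapRingHom, Polynomial.map_C, Polynomial.isUnit_C]
      exact (RatFunc.algebraMap_ne_zero (nonZeroDivisors.ne_zero hg)).isUnit)
  have := irred_abstract (evc 0 P) (fun d hd => by
      rw [MvPolynomial.isUnit_iff_eq_C_of_isReduced] at hd
      obtain ⟨a, -, ha⟩ := hd
      exact ⟨a, ha⟩) haev e (by
      rw [injective_iff_map_eq_zero]
      intro d hd
      obtain ⟨g, hg, H, hH⟩ := h1 d
      have h2 : Polynomial.mapRingHom (ktoF (k := k)) H = 0 := by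
        rw [← he, ← hH, map_mul, hd, mul_zero]
      have h3 : H = 0 := Polynomial.map_injective _ (RatFunc.algebraMap_injective k)
        (h2.trans (map_zero (Polynomial.mapRingHom (ktoF (k := k)))).symm)
      rw [h3, map_zero] at hH
      refine (mul_eq_zero.1 hH).resolve_left fun h => hg (haev (by rw [h, map_zero])))
    (by
      intro θ
      rw [← ev2_C _ (evc 0 s), he]; simp) 0
  rw [map_zero, sub_zero] at this
  exact this.prime

end SLP
end

end

section
section
namespace Polynomial
open SLP


variable {L : Type*} [Field L]

/-- evaluation of bivariate polynomials in an `L`-algebra -/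
def E2 {A : Type*} [CommRing A] [Algebra L A] (p s : A) : Polynomial (Polynomial L) →+* A :=
  Polynomial.eval₂RingHom (Polynomial.aeval (R := L) p : L[X] →ₐ[L] A).toRingHom s

section
variable {A B : Type*} [CommRing A] [Algebra L A] [CommRing B] [Algebra L B]
@[simp] theorem E2_X (p s : A) : E2 (L := L) p s Polynomial.X = s := by simp [E2]
@[simp] theorem E2_C (p s : A) (g : L[X]) : E2 p s (Polynomial.C g) = Polynomial.aeval p g := by
  simp [E2]

theorem E2_comp_hom (f : A →ₐ[L] B) (p s : A) (G : L[X][X]) :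
    f (E2 p s G) = E2 (f p) (f s) G := by
  have : f.toRingHom.comp (E2 (L := L) p s) = E2 (f p) (f s) := by
    apply ev2_hom_ext <;> simp [E2]
  exact RingHom.congr_fun this G

theorem E2_comp (p s : A) (p' s' : L[X][X]) (G : L[X][X]) :
    E2 p s (E2 p' s' G) = E2 (E2 p s p') (E2 p s s') G := by
  have : (E2 (L := L) p s).comp (E2 (L := L) p' s') = E2 (E2 p s p') (E2 p s s') := by
    apply ev2_hom_ext
    · intro r
      have h1 : algebraMap L L[X][X] r = C (C r) := rfl
      simp [h1]
    · simp
    · simp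
  exact RingHom.congr_fun this G

theorem E2_zero_X (G : L[X][X]) : E2 (0 : L[X]) X G = G.map (evalRingHom 0) := by
  have : E2 (0 : L[X]) X = mapRingHom (evalRingHom (0:L)) := by
    apply ev2_hom_ext
    · intro r; simp
    · simp
    · simp
  exact RingHom.congr_fun this G

theorem E2_sum (p s : A) (G : L[X][X]) : E2 p s G = G.sum fun i a => aeval p a * s ^ i := by
  simp [E2, eval₂_eq_sum]
end

/-! ### abstract discrete valuations with a bracket -/

structure Vl (L : Type*) [Field L] {M : Type*} [Field M] [Algebra L M] (v : M → ℤ) : Prop where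
  mul : ∀ a b, a ≠ 0 → b ≠ 0 → v (a * b) = v a + v b
  add : ∀ a b, a ≠ 0 → b ≠ 0 → a + b ≠ 0 → min (v a) (v b) ≤ v (a + b)
  triv : ∀ c : L, c ≠ 0 → v (algebraMap L M c) = 0

structure Br (L : Type*) [Field L] {M : Type*} [Field M] [Algebra L M] (v : M → ℤ) (δ : ℤ)
    (br : M → M → M) : Prop where
  left : ∀ a b, br (b * a) b = b * br a b
  right : ∀ a b, br a (a * b) = a * br a b
  trans : ∀ a b (c : L), br a (b - algebraMap L M c) = br a b
  zero : ∀ a, br a 0 = 0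
  zero' : ∀ a, br 0 a = 0
  bound : ∀ a b, br a b ≠ 0 → v a + v b - δ ≤ v (br a b)

section
variable {M : Type*} [Field M] [Algebra L M] {v : M → ℤ}

theorem Vl.one (hv : Vl L v) : v 1 = 0 := by
  have := hv.triv 1 one_ne_zero
  simpa using this

theorem Vl.pow (hv : Vl L v) {a : M} (ha : a ≠ 0) (n : ℕ) : v (a ^ n) = n * v a := by
  induction n with
  | zero => simp [hv.one]
  | succ n ih => rw [pow_succ, hv.mul _ _ (pow_ne_zero _ ha) ha, ih]; push_cast; ring

theorem Vl.neg (hv : Vl L v) {a : M} (ha : a ≠ 0) : v (-a) = v a := by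
  have h1 : v (-1) = 0 := by
    have := hv.triv (-1) (by simp)
    simpa using this
  rw [neg_eq_neg_one_mul, hv.mul _ _ (by simp) ha, h1, zero_add]

theorem Vl.inv (hv : Vl L v) {a : M} (ha : a ≠ 0) : v a⁻¹ = - v a := by
  have := hv.mul a a⁻¹ ha (inv_ne_zero ha)
  rw [mul_inv_cancel₀ ha, hv.one] at this
  linarith

theorem Vl.div (hv : Vl L v) {a b : M} (ha : a ≠ 0) (hb : b ≠ 0) : v (a / b) = v a - v b := by
  rw [div_eq_mul_inv, hv.mul _ _ ha (inv_ne_zero hb), hv.inv hb]; ring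

/-- valuation ring -/
def Vl.ring (hv : Vl L v) : Subring M where
  carrier := {x | x = 0 ∨ 0 ≤ v x}
  mul_mem' := by
    rintro a b ha hb
    by_cases ha0 : a = 0
    · left; simp [ha0]
    by_cases hb0 : b = 0
    · left; simp [hb0]
    right
    rw [hv.mul _ _ ha0 hb0]
    have := ha.resolve_left ha0
    have := hb.resolve_left hb0
    omega
  one_mem' := Or.inr hv.one.ge
  add_mem' := by
    rintro a b ha hb
    by_cases ha0 : a = 0
    · simpa [ha0] using hb
    by_cases hb0 : b = 0
    · simpa [hb0] using ha
    by_cases hab : a + b = 0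
    · exact Or.inl hab
    right
    have := hv.add _ _ ha0 hb0 hab
    have := ha.resolve_left ha0
    have := hb.resolve_left hb0
    omega
  zero_mem' := Or.inl rfl
  neg_mem' := by
    rintro a ha
    by_cases ha0 : a = 0
    · left; simp [ha0]
    right
    rw [hv.neg ha0]; exact ha.resolve_left ha0

theorem Vl.mem_ring (hv : Vl L v) {x : M} : x ∈ hv.ring ↔ x = 0 ∨ 0 ≤ v x := Iff.rfl

theorem Vl.alg_mem (hv : Vl L v) (c : L) : algebraMap L M c ∈ hv.ring := by
  by_cases h : c = 0
  · left; simp [h]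
  · right; exact (hv.triv c h).ge

theorem Vl.aeval_mem (hv : Vl L v) {a : M} (ha : a ∈ hv.ring) (g : L[X]) :
    aeval a g ∈ hv.ring := by
  rw [aeval_eq_sum_range]
  refine Subring.sum_mem _ fun i _ => ?_
  rw [Algebra.smul_def]
  exact Subring.mul_mem _ (hv.alg_mem _) (Subring.pow_mem _ ha _)

theorem Vl.E2_mem (hv : Vl L v) {a b : M} (ha : a ∈ hv.ring) (hb : b ∈ hv.ring) (G : L[X][X]) :
    E2 a b G ∈ hv.ring := by
  rw [E2_sum]
  exact Subring.sum_mem _ fun i _ => Subring.mul_mem _ (hv.aeval_mem ha _) (Subring.pow_mem _ hb _)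

/-- adding an element of positive valuation to a unit -/
theorem Vl.unit_add (hv : Vl L v) {a b : M} (ha : a ≠ 0) (ha0 : v a = 0) (hb : b = 0 ∨ 0 < v b) :
    a + b ≠ 0 ∧ v (a + b) = 0 := by
  by_cases hb0 : b = 0
  · simp [hb0, ha, ha0]
  have hb1 := hb.resolve_left hb0
  have hne : a + b ≠ 0 := by
    intro h
    have : a = -b := by linear_combination h
    rw [this, hv.neg hb0] at ha0
    omega
  refine ⟨hne, ?_⟩
  have h1 := hv.add _ _ ha hb0 hne
  have h2 := hv.add (a + b) (-b) hne (neg_ne_zero.2 hb0) (by simpa using ha)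
  rw [add_neg_cancel_right, hv.neg hb0, ha0] at h2
  omega

theorem Vl.aeval_unit [IsAlgClosed L] (hv : Vl L v) {b : M}
    (hb : ∀ c : L, b - algebraMap L M c ≠ 0 ∧ v (b - algebraMap L M c) = 0) (g : L[X]) (hg : g ≠ 0) :
    aeval b g ≠ 0 ∧ v (aeval b g) = 0 := by
  induction hn : g.natDegree generalizing g with
  | zero =>
    rw [natDegree_eq_zero] at hn
    obtain ⟨c, rfl⟩ := hn
    have hc : c ≠ 0 := by simpa using hg
    rw [aeval_C]
    exact ⟨by simpa using hc, hv.triv c hc⟩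
  | succ n ih =>
    obtain ⟨c, hc⟩ := IsAlgClosed.exists_root g (by
      rw [degree_eq_natDegree hg, hn]; exact_mod_cast Nat.succ_ne_zero n)
    rw [← dvd_iff_isRoot] at hc
    obtain ⟨g', rfl⟩ := hc
    have hg' : g' ≠ 0 := right_ne_zero_of_mul hg
    have := ih g' hg' (by
      rw [natDegree_mul (X_sub_C_ne_zero c) hg', natDegree_X_sub_C] at hn; omega)
    rw [map_mul, map_sub, aeval_X, aeval_C]
    exact ⟨mul_ne_zero (hb c).1 this.1, by rw [hv.mul _ _ (hb c).1 this.1, (hb c).2, this.2]; rfl⟩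

theorem exists_cancel' (H : L[X][X]) (hH : H ≠ 0) : ∃ (n : ℕ) (H' : L[X][X]),
    H = C X ^ n * H' ∧ E2 (0 : L[X]) X H' ≠ 0 := by
  obtain ⟨n, H', h1, h2⟩ := exists_cancel (0 : L) H hH
  refine ⟨n, H', ?_, by rwa [E2_zero_X]⟩
  rw [h1]; simp

theorem red_split (H : L[X][X]) : ∃ H' : L[X][X], H = C X * H' + (E2 (0 : L[X]) X H).map C := by
  have : (C X : L[X][X]) ∣ H - (E2 (0 : L[X]) X H).map C := by
    rw [C_dvd_iff_dvd_coeff]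
    intro i
    rw [coeff_sub, coeff_map, E2_zero_X, coeff_map, coe_evalRingHom]
    have := X_sub_C_dvd_sub_C_eval (a := (0:L)) (p := H.coeff i)
    simpa using this
  obtain ⟨H', h⟩ := this
  exact ⟨H', by linear_combination h⟩

theorem E2_map_C {A : Type*} [CommRing A] [Algebra L A] (a b : A) (g : L[X]) :
    E2 a b (g.map C) = aeval b g := by
  rw [E2, coe_eval₂RingHom, eval₂_map, aeval_def]
  congr 1
  ext r
  simp

theorem blow_coeff (H : L[X][X]) (j : ℕ) :
    (E2 (C X : L[X][X]) (C X * X) H).coeff j = X ^ j * H.coeff j := by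
  have h1 : ∀ a : L[X], aeval (C X : L[X][X]) a = C a := by
    intro a
    have : (aeval (C X : L[X][X]) : L[X] →ₐ[L] L[X][X]).toRingHom = C := by
      apply Polynomial.ringHom_ext'
      · ext r; simp
      · simp
    exact RingHom.congr_fun this a
  rw [E2_sum, Polynomial.sum, finsetSum_coeff]
  simp only [h1, mul_pow, ← C_pow, ← mul_assoc]
  simp only [← C_mul, coeff_C_mul, coeff_X_pow, mul_ite, mul_one, mul_zero]
  rw [Finset.sum_ite_eq]
  split_ifs with h
  · ring
  · rw [notMem_support_iff] at h; simp [h]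

/-- Lemma L. -/
theorem lemmaL [IsAlgClosed L] (hv : Vl L v) {δ : ℤ} {br : M → M → M} (hb : Br L v δ br) :
    ∀ (n : ℕ) (a b : M) (H : L[X][X]) (m : ℕ), br a b ≠ 0 → 0 < v a → 0 < v b →
      v (br a b) + δ ≤ n → (E2 (0 : L[X]) X H).coeff m ≠ 0 →
      E2 a b H ≠ 0 ∧ v (E2 a b H) ≤ m * (v (br a b) + δ - v a) := by
  intro n
  induction n using Nat.strong_induction_on with
  | _ n ih =>
  intro a b H m hbr hva hvb hn hm
  have ha : a ≠ 0 := by rintro rfl; exact hbr (hb.zero' b)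
  have hb0 : b ≠ 0 := by rintro rfl; exact hbr (hb.zero a)
  have hA := hb.bound a b hbr
  by_cases hlt : v b < v a
  · -- first case
    obtain ⟨a1, rfl⟩ : ∃ a1, a = b * a1 := ⟨a / b, by field_simp⟩
    have ha1 : a1 ≠ 0 := right_ne_zero_of_mul ha
    rw [hb.left] at hbr
    rw [hb.left, hv.mul _ _ hb0 (right_ne_zero_of_mul hbr), hv.mul _ _ hb0 ha1] at *
    have hbr1 := right_ne_zero_of_mul hbr
    have key := ih (n - 1) (by omega) a1 b (E2 (C X * X) X H) m hbr1 (by omega) hvb (by omega) (by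
      rw [E2_comp]; simpa using hm)
    rw [E2_comp] at key
    have e1 : E2 a1 b (C X * X : L[X][X]) = b * a1 := by
      rw [map_mul, E2_C, E2_X, aeval_X, mul_comm]
    rw [e1, E2_X] at key
    refine ⟨key.1, key.2.trans (le_of_eq (by ring))⟩
  · -- second case
    obtain ⟨b1, rfl⟩ : ∃ b1, b = a * b1 := ⟨b / a, by field_simp⟩
    have hb1 : b1 ≠ 0 := right_ne_zero_of_mul hb0
    have hbrr := hb.right a b1
    rw [hbrr] at hbr
    have hbr1 := right_ne_zero_of_mul hbr
    rw [hbrr, hv.mul _ _ ha hbr1] at hA hn ⊢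
    rw [hv.mul _ _ ha hb1] at hlt hvb hA
    have hm1 : ¬ (X : L[X]) ∣ H.coeff m := by
      rw [E2_zero_X, coeff_map, coe_evalRingHom, ← coeff_zero_eq_eval_zero] at hm
      rwa [X_dvd_iff]
    obtain ⟨μ, H1, hH1, hH10⟩ := exists_cancel' (E2 (C X : L[X][X]) (C X * X) H) (by
      intro h
      have := blow_coeff H m
      rw [h, coeff_zero] at this
      apply hm1
      rw [(mul_eq_zero.1 this.symm).resolve_left (pow_ne_zero _ X_ne_zero)]
      exact dvd_zero _)
    have hcf : ∀ j, X ^ μ * H1.coeff j = X ^ j * H.coeff j := by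
      intro j
      rw [← blow_coeff, hH1, ← C_pow, coeff_C_mul]
    have hμ : μ ≤ m := by
      by_contra hlt
      apply hm1
      have h1 := hcf m
      obtain ⟨e, he⟩ : ∃ e, μ = m + (e + 1) := ⟨μ - m - 1, by omega⟩
      rw [he, pow_add, mul_assoc] at h1
      rw [← mul_left_cancel₀ (pow_ne_zero _ X_ne_zero) h1, pow_succ]
      exact ⟨X ^ e * H1.coeff m, by ring⟩
    have hdeg : (E2 (0 : L[X]) X H1).natDegree ≤ μ := by
      rw [natDegree_le_iff_coeff_eq_zero]
      intro j hj
      rw [E2_zero_X, coeff_map, coe_evalRingHom, ← coeff_zero_eq_eval_zero, ← X_dvd_iff]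
      have h1 := hcf j
      obtain ⟨e, he⟩ : ∃ e, j = μ + (e + 1) := ⟨j - μ - 1, by omega⟩
      rw [he, pow_add, mul_assoc] at h1
      rw [he, mul_left_cancel₀ (pow_ne_zero _ X_ne_zero) h1, pow_succ]
      exact ⟨X ^ e * H.coeff (μ + (e+1)), by ring⟩
    have hval : E2 a (a * b1) H = a ^ μ * E2 a b1 H1 := by
      have h1 : E2 a b1 (E2 (C X : L[X][X]) (C X * X) H) = E2 a (a * b1) H := by
        rw [E2_comp]; simp
      rw [← h1, hH1]; simp
    rw [hval]
    have hbd1 := hb.bound a b1 hbr1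
    have haμ : a ^ μ ≠ 0 := pow_ne_zero _ ha
    suffices hs : E2 a b1 H1 ≠ 0 ∧ μ * v a + v (E2 a b1 H1) ≤ m * (v (br a b1) + δ) by
      refine ⟨mul_ne_zero haμ hs.1, ?_⟩
      rw [hv.mul _ _ haμ hs.1, hv.pow ha]
      exact hs.2.trans (le_of_eq (by ring))
    have hmμ : (μ : ℤ) ≤ m := by exact_mod_cast hμ
    by_cases hex : ∃ c : L, 0 < v (b1 - algebraMap L M c)
    · obtain ⟨c, hc⟩ := hex
      have hbr2 : br a (b1 - algebraMap L M c) = br a b1 := hb.trans _ _ _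
      have hbd2 := hb.bound a _ (hbr2 ▸ hbr1)
      rw [hbr2] at hbd2
      have e0 : E2 (0 : L[X]) X (E2 (C X : L[X][X]) (X + C (C c)) H1)
          = (E2 (0 : L[X]) X H1).comp (X + C c) := by
        rw [E2_comp]
        have := E2_comp_hom (L := L) (aeval (X + C c) : L[X] →ₐ[L] L[X]) 0 X H1
        rw [map_zero, aeval_X, ← comp_eq_aeval] at this
        rw [this]; simp
      have key := ih (n - 1) (by omega) a (b1 - algebraMap L M c)
        (E2 (C X : L[X][X]) (X + C (C c)) H1) (E2 (0 : L[X]) X H1).natDegree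
        (by rwa [hbr2]) hva hc (by rw [hbr2]; omega) (by
          rw [e0]
          have h2 : ((E2 (0 : L[X]) X H1).comp (X + C c)).natDegree
            = (E2 (0 : L[X]) X H1).natDegree := by
            rw [natDegree_comp, natDegree_X_add_C, mul_one]
          rw [← h2, coeff_natDegree, Ne, leadingCoeff_eq_zero]
          intro h3
          rw [comp_eq_zero_iff] at h3
          rcases h3 with h3 | h3
          · exact hH10 h3
          · have := congrArg natDegree h3.2
            rw [natDegree_X_add_C, natDegree_C] at this
            omega)
      rw [E2_comp, hbr2] at key
      have e1 : E2 a (b1 - algebraMap L M c) (C X : L[X][X]) = a := by simp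
      have e2 : E2 a (b1 - algebraMap L M c) (X + C (C c) : L[X][X]) = b1 := by simp
      rw [e1, e2] at key
      refine ⟨key.1, ?_⟩
      have h5 : ((E2 (0 : L[X]) X H1).natDegree : ℤ) ≤ μ := by exact_mod_cast hdeg
      have h6 : 0 ≤ v (br a b1) + δ - v a := by omega
      nlinarith [key.2, mul_le_mul_of_nonneg_right h5 h6, mul_le_mul_of_nonneg_right hmμ
        (by omega : 0 ≤ v (br a b1) + δ)]
    · push Not at hex
      have hb1r : b1 ∈ hv.ring := Or.inr (by omega)
      have hunit : ∀ c : L, b1 - algebraMap L M c ≠ 0 ∧ v (b1 - algebraMap L M c) = 0 := by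
        intro c
        have hne : b1 - algebraMap L M c ≠ 0 := by
          intro h
          have := hb.trans a b1 c
          rw [h, hb.zero] at this
          exact hbr1 this.symm
        refine ⟨hne, le_antisymm (hex c) ?_⟩
        exact (hv.mem_ring.1 (Subring.sub_mem _ hb1r (hv.alg_mem c))).resolve_left hne
      obtain ⟨H', hH'⟩ := red_split H1
      have h7 := hv.aeval_unit hunit _ hH10
      have h8 : E2 a b1 H1 = aeval b1 (E2 (0 : L[X]) X H1) + a * E2 a b1 H' := by
        conv_lhs => rw [hH']
        rw [map_add, E2_map_C, map_mul, E2_C, aeval_X, add_comm]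
      have h9 := hv.unit_add h7.1 h7.2 (b := a * E2 a b1 H') (by
        by_cases h0 : E2 a b1 H' = 0
        · left; simp [h0]
        right
        rw [hv.mul _ _ ha h0]
        have := (hv.mem_ring.1 (hv.E2_mem (Or.inr hva.le : a ∈ hv.ring) hb1r H')).resolve_left h0
        omega)
      rw [← h8] at h9
      refine ⟨h9.1, ?_⟩
      rw [h9.2]
      nlinarith [mul_le_mul_of_nonneg_right hmμ hva.le, mul_le_mul_of_nonneg_left
        (by omega : v a ≤ v (br a b1) + δ) (by positivity : (0:ℤ) ≤ m)]

end

end Polynomial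
end

end

section
section
namespace Polynomial
open SLP

section ext
variable {L : Type*} [Field L] {A : Type*} [CommRing A] [IsDomain A] [Algebra L A]
  {M : Type*} [Field M] [Algebra A M] [IsFractionRing A M] [Algebra L M] [IsScalarTower L A M]

theorem frac_ex (f : M) : ∃ p q : A, q ≠ 0 ∧ f = algebraMap A M p / algebraMap A M q := by
  obtain ⟨p, q, hq, h⟩ := IsFractionRing.div_surjective (A := A) f
  exact ⟨p, q, nonZeroDivisors.ne_zero hq, h.symm⟩

theorem am_ne {q : A} (hq : q ≠ 0) : algebraMap A M q ≠ 0 := by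
  rwa [Ne, IsFractionRing.to_map_eq_zero_iff]

theorem frac_eq {p q r s : A} (hq : q ≠ 0) (hs : s ≠ 0)
    (h : algebraMap A M p / algebraMap A M q = algebraMap A M r / algebraMap A M s) :
    p * s = r * q := by
  rw [div_eq_div_iff (am_ne hq) (am_ne hs), ← map_mul, ← map_mul] at h
  exact IsFractionRing.injective A M h

theorem ext_der (D : Derivation L A A) : ∃ D' : Derivation L M M,
    ∀ a, D' (algebraMap A M a) = algebraMap A M (D a) := by
  choose num den hden hfr using fun f : M => frac_ex (A := A) f
  let ι := algebraMap A M
  let E : M → M := fun f =>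
    (ι (den f) * ι (D (num f)) - ι (num f) * ι (D (den f))) / ι (den f) ^ 2
  have hE : ∀ p q : A, q ≠ 0 → E (ι p / ι q) = (ι q * ι (D p) - ι p * ι (D q)) / ι q ^ 2 := by
    intro p q hq
    have h1 := frac_eq (M := M) hq (hden (ι p / ι q)) (hfr (ι p / ι q))
    have hd := hden (ι p / ι q)
    have hD := congrArg D h1
    simp only [Derivation.leibniz, smul_eq_mul] at hD
    have h1' := congrArg ι h1
    have hD' := congrArg ι hD
    simp only [map_mul, map_add] at h1' hD'
    have hq' : ι q ≠ 0 := am_ne hq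
    have hd' : ι (den (ι p / ι q)) ≠ 0 := am_ne hd
    simp only [E]
    rw [div_eq_div_iff (pow_ne_zero _ hd') (pow_ne_zero _ hq')]
    generalize ι (den (ι p / ι q)) = s at *
    generalize ι (num (ι p / ι q)) = r at *
    generalize ι (D (den (ι p / ι q))) = s' at *
    generalize ι (D (num (ι p / ι q))) = r' at *
    linear_combination (-(s * ι q)) * hD' + (ι q * s' + s * ι (D q)) * h1'
  have hadd : ∀ f g, E (f + g) = E f + E g := by
    intro f g
    obtain ⟨p, q, hq, rfl⟩ := frac_ex (A := A) f
    obtain ⟨r, s, hs, rfl⟩ := frac_ex (A := A) g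
    have hq' : ι q ≠ 0 := am_ne hq
    have hs' : ι s ≠ 0 := am_ne hs
    have h1 : ι p / ι q + ι r / ι s = ι (p * s + r * q) / ι (q * s) := by
      simp only [map_add, map_mul]; field_simp
    change E (ι p / ι q + ι r / ι s) = E (ι p / ι q) + E (ι r / ι s)
    rw [h1, hE _ _ (mul_ne_zero hq hs), hE _ _ hq, hE _ _ hs]
    simp only [map_add, map_mul, Derivation.leibniz, smul_eq_mul]
    field_simp
    ring
  have hmul : ∀ f g, E (f * g) = f * E g + g * E f := by
    intro f g
    obtain ⟨p, q, hq, rfl⟩ := frac_ex (A := A) f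
    obtain ⟨r, s, hs, rfl⟩ := frac_ex (A := A) g
    have hq' : ι q ≠ 0 := am_ne hq
    have hs' : ι s ≠ 0 := am_ne hs
    have h1 : ι p / ι q * (ι r / ι s) = ι (p * r) / ι (q * s) := by
      simp only [map_mul]; field_simp
    change E (ι p / ι q * (ι r / ι s)) = ι p / ι q * E (ι r / ι s) + ι r / ι s * E (ι p / ι q)
    rw [h1, hE _ _ (mul_ne_zero hq hs), hE _ _ hq, hE _ _ hs]
    simp only [map_add, map_mul, Derivation.leibniz, smul_eq_mul]
    field_simp
    ring
  have hbase : ∀ a, E (ι a) = ι (D a) := by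
    intro a
    have := hE a 1 one_ne_zero
    simpa using this
  refine ⟨Derivation.mk' { toFun := E, map_add' := hadd, map_smul' := ?_ } ?_, hbase⟩
  · intro c f
    rw [Algebra.smul_def, hmul, IsScalarTower.algebraMap_apply L A M]
    have := hbase (algebraMap L A c)
    rw [Derivation.map_algebraMap, map_zero] at this
    change _ * E f + f * E (ι _) = _
    rw [this, RingHom.id_apply, Algebra.smul_def, IsScalarTower.algebraMap_apply L A M, mul_zero,
      add_zero]
  · intro f g
    exact hmul f g

theorem ext_val (w : A → ℤ) (hmul : ∀ a b, a ≠ 0 → b ≠ 0 → w (a * b) = w a + w b)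
    (hadd : ∀ a b, a ≠ 0 → b ≠ 0 → a + b ≠ 0 → min (w a) (w b) ≤ w (a + b))
    (htriv : ∀ c : L, c ≠ 0 → w (algebraMap L A c) = 0) :
    ∃ v : M → ℤ, Vl L v ∧ ∀ a, a ≠ 0 → v (algebraMap A M a) = w a := by
  choose num den hden hfr using fun f : M => frac_ex (A := A) f
  let ι := algebraMap A M
  let E : M → ℤ := fun f => w (num f) - w (den f)
  have hE : ∀ p q : A, p ≠ 0 → q ≠ 0 → E (ι p / ι q) = w p - w q := by
    intro p q hp hq
    have h1 := frac_eq (M := M) hq (hden (ι p / ι q)) (hfr (ι p / ι q))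
    have hd := hden (ι p / ι q)
    have hn : num (ι p / ι q) ≠ 0 := by
      intro h0
      rw [h0, zero_mul] at h1
      exact mul_ne_zero hp hd h1
    have := congrArg w h1
    rw [hmul _ _ hp hd, hmul _ _ hn hq] at this
    simp only [E]
    linarith
  have w1 : w 1 = 0 := by simpa using htriv 1 one_ne_zero
  have hbase : ∀ a, a ≠ 0 → E (ι a) = w a := by
    intro a ha
    have := hE a 1 ha one_ne_zero
    simpa [w1] using this
  have nz : ∀ p q : A, algebraMap A M p / algebraMap A M q ≠ 0 → p ≠ 0 := by
    rintro p q h rfl; simp at h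
  refine ⟨E, ⟨?_, ?_, ?_⟩, hbase⟩
  · intro f g hf hg
    obtain ⟨p, q, hq, rfl⟩ := frac_ex (A := A) f
    obtain ⟨r, s, hs, rfl⟩ := frac_ex (A := A) g
    have hp := nz _ _ hf
    have hr := nz _ _ hg
    have hq' : ι q ≠ 0 := am_ne hq
    have hs' : ι s ≠ 0 := am_ne hs
    have h1 : ι p / ι q * (ι r / ι s) = ι (p * r) / ι (q * s) := by
      simp only [map_mul]; field_simp
    change E (ι p / ι q * (ι r / ι s)) = E (ι p / ι q) + E (ι r / ι s)
    rw [h1, hE _ _ (mul_ne_zero hp hr) (mul_ne_zero hq hs), hE _ _ hp hq, hE _ _ hr hs,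
      hmul _ _ hp hr, hmul _ _ hq hs]
    ring
  · intro f g hf hg hfg
    obtain ⟨p, q, hq, rfl⟩ := frac_ex (A := A) f
    obtain ⟨r, s, hs, rfl⟩ := frac_ex (A := A) g
    have hp := nz _ _ hf
    have hr := nz _ _ hg
    have hq' : ι q ≠ 0 := am_ne hq
    have hs' : ι s ≠ 0 := am_ne hs
    have h1 : ι p / ι q + ι r / ι s = ι (p * s + r * q) / ι (q * s) := by
      simp only [map_add, map_mul]; field_simp
    change min (E (ι p / ι q)) (E (ι r / ι s)) ≤ E (ι p / ι q + ι r / ι s)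
    change ι p / ι q + ι r / ι s ≠ 0 at hfg
    rw [h1] at hfg ⊢
    have hn := nz _ _ hfg
    rw [hE _ _ hn (mul_ne_zero hq hs), hE _ _ hp hq, hE _ _ hr hs]
    have := hadd _ _ (mul_ne_zero hp hs) (mul_ne_zero hr hq) hn
    rw [hmul _ _ hp hs, hmul _ _ hr hq] at this
    rw [hmul _ _ hq hs]
    omega
  · intro c hc
    rw [IsScalarTower.algebraMap_apply L A M]
    have hc' : algebraMap L A c ≠ 0 := by simpa using hc
    exact (hbase _ hc').trans (htriv c hc)

/-- Jacobian bracket of two derivations -/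
def jb {A : Type*} [CommRing A] [Algebra L A] (D1 D2 : Derivation L A A) (f g : A) : A :=
  D1 f * D2 g - D2 f * D1 g

theorem Vl.add' {v : M → ℤ} (hv : Vl L v) {a b : M} {n : ℤ} (ha : a = 0 ∨ n ≤ v a)
    (hb : b = 0 ∨ n ≤ v b) : a + b = 0 ∨ n ≤ v (a + b) := by
  by_cases ha0 : a = 0
  · simpa [ha0] using hb
  by_cases hb0 : b = 0
  · simpa [hb0] using ha
  by_cases hab : a + b = 0
  · exact Or.inl hab
  right
  have := hv.add _ _ ha0 hb0 hab
  have := ha.resolve_left ha0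
  have := hb.resolve_left hb0
  omega

theorem Vl.neg' {v : M → ℤ} (hv : Vl L v) {a : M} {n : ℤ} (ha : a = 0 ∨ n ≤ v a) :
    -a = 0 ∨ n ≤ v (-a) := by
  by_cases ha0 : a = 0
  · simp [ha0]
  right; rw [hv.neg ha0]; exact ha.resolve_left ha0

theorem Vl.mul' {v : M → ℤ} (hv : Vl L v) {a b : M} {n m : ℤ} (ha : a = 0 ∨ n ≤ v a)
    (hb : b = 0 ∨ m ≤ v b) : a * b = 0 ∨ n + m ≤ v (a * b) := by
  by_cases ha0 : a = 0
  · simp [ha0]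
  by_cases hb0 : b = 0
  · simp [hb0]
  right
  rw [hv.mul _ _ ha0 hb0]
  have := ha.resolve_left ha0
  have := hb.resolve_left hb0
  omega

theorem ext_br (D1 D2 : Derivation L A A) (D1' D2' : Derivation L M M)
    (h1 : ∀ a, D1' (algebraMap A M a) = algebraMap A M (D1 a))
    (h2 : ∀ a, D2' (algebraMap A M a) = algebraMap A M (D2 a))
    {v : M → ℤ} (hv : Vl L v) {δ : ℤ}
    (hbd : ∀ a b : A, jb D1 D2 a b ≠ 0 → v (algebraMap A M a) + v (algebraMap A M b) - δ ≤
      v (algebraMap A M (jb D1 D2 a b))) : Br L v δ (jb D1' D2') := by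
  refine ⟨?_, ?_, ?_, ?_, ?_, ?_⟩
  · intro a b; simp only [jb, Derivation.leibniz, smul_eq_mul]; ring
  · intro a b; simp only [jb, Derivation.leibniz, smul_eq_mul]; ring
  · intro a b c; simp only [jb, map_sub, Derivation.map_algebraMap, sub_zero]
  · intro a; simp [jb]
  · intro a; simp [jb]
  · intro f g hfg
    have hf : f ≠ 0 := by rintro rfl; simp [jb] at hfg
    have hg : g ≠ 0 := by rintro rfl; simp [jb] at hfg
    obtain ⟨p, q, hq, rfl⟩ := frac_ex (A := A) f
    obtain ⟨r, s, hs, rfl⟩ := frac_ex (A := A) g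
    set ι := algebraMap A M with hι
    have hq' : ι q ≠ 0 := am_ne hq
    have hs' : ι s ≠ 0 := am_ne hs
    have hp' : ι p ≠ 0 := by intro h; simp [h] at hf
    have hr' : ι r ≠ 0 := by intro h; simp [h] at hg
    have hbd' : ∀ a b : A, ι (jb D1 D2 a b) = 0 ∨ v (ι a) + v (ι b) - δ ≤ v (ι (jb D1 D2 a b)) := by
      intro a b
      by_cases h : jb D1 D2 a b = 0
      · left; rw [h, map_zero]
      · right; exact hbd a b h
    have key : jb D1' D2' (ι p / ι q) (ι r / ι s) * (ι q ^ 2 * ι s ^ 2) =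
        ι (jb D1 D2 p r) * (ι q * ι s) + -(ι (jb D1 D2 p s) * (ι q * ι r)) +
        (-(ι (jb D1 D2 q r) * (ι p * ι s)) + ι (jb D1 D2 q s) * (ι p * ι r)) := by
      simp only [jb, Derivation.leibniz_div, h1, h2, map_sub, map_mul, smul_eq_mul]
      field_simp
      ring
    have hm : ∀ a b : A, ι a ≠ 0 → ι b ≠ 0 → (ι a * ι b = 0 ∨ v (ι a) + v (ι b) ≤ v (ι a * ι b)) :=
      fun a b ha hb => Or.inr (hv.mul _ _ ha hb).ge
    have hX : ∀ {x : M} {n m : ℤ}, (x = 0 ∨ n ≤ v x) → n = m → (x = 0 ∨ m ≤ v x) := by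
      rintro x n m h rfl; exact h
    set N := v (ι p) + v (ι q) + v (ι r) + v (ι s) - δ with hN
    have t1 := hX (hv.mul' (hbd' p r) (hm q s hq' hs')) (show _ = N by rw [hN]; ring)
    have t2 := hX (hv.mul' (hbd' p s) (hm q r hq' hr')) (show _ = N by rw [hN]; ring)
    have t3 := hX (hv.mul' (hbd' q r) (hm p s hp' hs')) (show _ = N by rw [hN]; ring)
    have t4 := hX (hv.mul' (hbd' q s) (hm p r hp' hr')) (show _ = N by rw [hN]; ring)
    have t := hv.add' (hv.add' t1 (hv.neg' t2)) (hv.add' (hv.neg' t3) t4)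
    rw [← key] at t
    have hqs : ι q ^ 2 * ι s ^ 2 ≠ 0 := mul_ne_zero (pow_ne_zero _ hq') (pow_ne_zero _ hs')
    have t' := t.resolve_left (mul_ne_zero hfg hqs)
    rw [hv.mul _ _ hfg hqs, hv.mul _ _ (pow_ne_zero _ hq') (pow_ne_zero _ hs'), hv.pow hq',
      hv.pow hs'] at t'
    rw [hv.div hp' hq', hv.div hr' hs']
    push_cast at t'
    linarith

end ext

theorem coeff_der {L F : Type*} [Field L] [Field F] [Algebra L F] (d : Derivation L F F) :
    ∃ D : Derivation L F[X] F[X], ∀ p i, (D p).coeff i = d (p.coeff i) :=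
  ⟨PolynomialModule.equivPolynomialSelf.compDer d.mapCoeffs, fun p i => rfl⟩

end Polynomial
end

end

section
section
namespace Polynomial
open SLP

section
variable {F : Type*} [Field F]

theorem fin_mult {π a : F[X]} (hπ : Prime π) (ha : a ≠ 0) : FiniteMultiplicity π a :=
  FiniteMultiplicity.of_prime_left hπ ha

theorem sum_mult (t : F[X]) (ht : t ≠ 0) : ∃ S : Finset F[X], (∀ π ∈ S, Prime π ∧ π ∣ t) ∧
    (∑ π ∈ S, multiplicity π t * natDegree π = natDegree t) ∧
    ∀ J : F[X], J ≠ 0 → ∑ π ∈ S, multiplicity π J * natDegree π ≤ natDegree J := by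
  classical
  have hcount : ∀ π ∈ UniqueFactorizationMonoid.normalizedFactors t, ∀ J : F[X], J ≠ 0 →
      multiplicity π J = (UniqueFactorizationMonoid.normalizedFactors J).count π := by
    intro π hπ J hJ
    have hirr := UniqueFactorizationMonoid.irreducible_of_normalized_factor π hπ
    have h1 := UniqueFactorizationMonoid.emultiplicity_eq_count_normalizedFactors hirr hJ
    rw [UniqueFactorizationMonoid.normalize_normalized_factor π hπ] at h1
    exact multiplicity_eq_of_emultiplicity_eq_some h1
  have hdeg : ∀ J : F[X], J ≠ 0 → natDegree J =
      ∑ π ∈ (UniqueFactorizationMonoid.normalizedFactors J).toFinset,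
        (UniqueFactorizationMonoid.normalizedFactors J).count π * natDegree π := by
    intro J hJ
    have h1 := UniqueFactorizationMonoid.prod_normalizedFactors hJ
    rw [← natDegree_eq_of_degree_eq (degree_eq_degree_of_associated h1), natDegree_multiset_prod,
      Finset.sum_multiset_map_count]
    · simp
    · exact UniqueFactorizationMonoid.zero_notMem_normalizedFactors J
  refine ⟨(UniqueFactorizationMonoid.normalizedFactors t).toFinset, ?_, ?_, ?_⟩
  · intro π hπ
    rw [Multiset.mem_toFinset] at hπ
    exact ⟨UniqueFactorizationMonoid.prime_of_normalized_factor π hπ,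
      UniqueFactorizationMonoid.dvd_of_mem_normalizedFactors hπ⟩
  · rw [hdeg t ht]
    apply Finset.sum_congr rfl
    intro π hπ
    rw [Multiset.mem_toFinset] at hπ
    rw [hcount π hπ t ht]
  · intro J hJ
    rw [hdeg J hJ]
    calc _ = ∑ π ∈ (UniqueFactorizationMonoid.normalizedFactors t).toFinset,
        (UniqueFactorizationMonoid.normalizedFactors J).count π * natDegree π := by
          apply Finset.sum_congr rfl
          intro π hπ
          rw [Multiset.mem_toFinset] at hπ
          rw [hcount π hπ J hJ]
      _ ≤ _ := by
        apply Finset.sum_le_sum_of_ne_zero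
        intro π _ hne
        rw [Multiset.mem_toFinset, ← Multiset.count_pos]
        exact Nat.pos_of_ne_zero (left_ne_zero_of_mul hne)

variable {L : Type*} [Field L] [Algebra L F]

/-- the derivation in the variable -/
def Dz (L : Type*) [Field L] [Algebra L F] : Derivation L F[X] F[X] :=
  (derivative' : Derivation F F[X] F[X]).restrictScalars L

theorem Dz_apply (p : F[X]) : Dz L p = derivative p := rfl

theorem jb_pow_dvd {A : Type*} [CommRing A] [Algebra L A] (D1 D2 : Derivation L A A) (π f g : A)
    (e1 e2 : ℕ) (h1 : π ^ e1 ∣ f) (h2 : π ^ e2 ∣ g) : π ^ (e1 + e2 - 1) ∣ jb D1 D2 f g := by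
  obtain ⟨f, rfl⟩ := h1
  obtain ⟨g, rfl⟩ := h2
  rcases e1 with _ | e1
  · rcases e2 with _ | e2
    · simp
    · have : 0 + (e2 + 1) - 1 = e2 := by omega
      rw [this]
      refine ⟨π * jb D1 D2 f g + (e2 + 1 : ℕ) * g * jb D1 D2 f π, ?_⟩
      simp only [jb, Derivation.leibniz, Derivation.leibniz_pow, smul_eq_mul, nsmul_eq_mul,
        pow_zero, one_mul, Nat.add_sub_cancel]
      push_cast
      ring
  · rcases e2 with _ | e2
    · have : (e1 + 1) + 0 - 1 = e1 := by omega
      rw [this]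
      refine ⟨π * jb D1 D2 f g + (e1 + 1 : ℕ) * f * jb D1 D2 π g, ?_⟩
      simp only [jb, Derivation.leibniz, Derivation.leibniz_pow, smul_eq_mul, nsmul_eq_mul,
        pow_zero, one_mul, Nat.add_sub_cancel]
      push_cast
      ring
    · have : (e1 + 1) + (e2 + 1) - 1 = e1 + e2 + 1 := by omega
      rw [this]
      refine ⟨π * jb D1 D2 f g + (e1 + 1 : ℕ) * f * jb D1 D2 π g + 
        (e2 + 1 : ℕ) * g * jb D1 D2 f π, ?_⟩
      simp only [jb, Derivation.leibniz, Derivation.leibniz_pow, smul_eq_mul, nsmul_eq_mul,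
        Nat.add_sub_cancel]
      push_cast
      ring

theorem jb_deg (D1 : Derivation L F[X] F[X]) (hD1 : ∀ p, degree (D1 p) ≤ degree p) (a b : F[X])
    (h : jb D1 (Dz L) a b ≠ 0) :
    natDegree (jb D1 (Dz L) a b) + 1 ≤ natDegree a + natDegree b := by
  have ha : a ≠ 0 := by rintro rfl; simp [jb] at h
  have hb : b ≠ 0 := by rintro rfl; simp [jb] at h
  have h1 : ∀ p q : F[X], p ≠ 0 → q ≠ 0 → degree (D1 p * Dz L q) < degree p + degree q := by
    intro p q hp hq
    by_cases h0 : D1 p = 0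
    · rw [h0, zero_mul, degree_zero, degree_eq_natDegree hp, degree_eq_natDegree hq, ← Nat.cast_add]
      exact WithBot.bot_lt_coe _
    rw [degree_mul, Dz_apply]
    have h2 := degree_derivative_lt hq
    exact WithBot.add_lt_add_of_le_of_lt (by simpa using h0) (hD1 p) h2
  have h2 : degree (jb D1 (Dz L) a b) < degree a + degree b := by
    apply (degree_sub_le _ _).trans_lt
    rw [max_lt_iff]
    refine ⟨h1 a b ha hb, ?_⟩
    rw [mul_comm (Dz L a), add_comm]
    exact h1 b a hb ha
  rw [degree_eq_natDegree h, degree_eq_natDegree ha, degree_eq_natDegree hb] at h2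
  have : natDegree (jb D1 (Dz L) a b) < natDegree a + natDegree b := by exact_mod_cast h2
  omega

/-- the polynomial used at infinity -/
theorem inf_poly (T1 : L[X][X]) (hT : T1 ≠ 0) (j : ℕ) (hj : ∀ l, natDegree (T1.coeff l) ≤ j)
    {M : Type*} [Field M] [Algebra L M] (t s : M) (ht : t ≠ 0) :
    ∃ H : L[X][X], (E2 (0 : L[X]) X H).coeff T1.natDegree ≠ 0 ∧
      E2 t⁻¹ (s * (t⁻¹) ^ j) H * t ^ (natDegree T1.leadingCoeff + T1.natDegree * j) = E2 t s T1 := by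
  set i := T1.natDegree with hi
  set b := natDegree T1.leadingCoeff with hb
  set N : ℕ → ℕ := fun l => b + (i - l) * j with hN
  let H : L[X][X] := ∑ l ∈ Finset.range (i + 1), C (reflect (N l) (T1.coeff l)) * X ^ l
  have hNl : ∀ l ∈ Finset.range (i + 1), natDegree (T1.coeff l) ≤ N l := by
    intro l hl
    rw [Finset.mem_range] at hl
    by_cases h : l = i
    · subst h; simp only [hN, hb, hi, Nat.sub_self, zero_mul, add_zero]; rfl
    · have h1 : 1 ≤ i - l := by omega
      have := hj l
      simp only [hN]
      nlinarith
  refine ⟨H, ?_, ?_⟩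
  · rw [E2_zero_X, coeff_map]
    have h1 : H.coeff i = reflect b T1.leadingCoeff := by
      simp only [H, finsetSum_coeff, coeff_C_mul, coeff_X_pow, mul_ite, mul_one, mul_zero]
      rw [Finset.sum_ite_eq]
      rw [if_pos (Finset.mem_range.2 (Nat.lt_succ_self i))]
      simp only [hN, Nat.sub_self, zero_mul, add_zero]; rfl
    rw [h1, coe_evalRingHom, ← coeff_zero_eq_eval_zero, coeff_reflect, revAt_le (by omega), hb]
    simpa using hT
  · letI : Invertible t := invertibleOfNonzero ht
    simp only [H, map_sum, map_mul, map_pow, E2_C, E2_X]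
    have h2 : E2 t s T1 = ∑ l ∈ Finset.range (i + 1), aeval t (T1.coeff l) * s ^ l := by
      conv_lhs => rw [T1.as_sum_range_C_mul_X_pow]
      simp [hi]
    rw [h2, Finset.sum_mul]
    apply Finset.sum_congr rfl
    intro l hl
    have h3 := eval₂_reflect_mul_pow (algebraMap L M) t (N l) (T1.coeff l) (hNl l hl)
    rw [invOf_eq_inv] at h3
    rw [aeval_def, aeval_def, ← h3]
    have hl' : l ≤ i := by rw [Finset.mem_range] at hl; omega
    have h4 : b + i * j = N l + l * j := by
      simp only [hN]
      obtain ⟨e, he⟩ := Nat.exists_eq_add_of_le hl'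
      rw [he, Nat.add_sub_cancel_left]; ring
    rw [h4, pow_add, mul_pow, ← pow_mul, mul_comm l j, inv_pow]
    field_simp

/-- Theorem U -/
theorem thmU [IsAlgClosed L] (D1 : Derivation L F[X] F[X]) (hD1 : ∀ p, degree (D1 p) ≤ degree p)
    (t s : F[X]) (hd : 1 ≤ natDegree t) (hJ : jb D1 (Dz L) t s ≠ 0)
    (hJt : t ^ 2 ∣ jb D1 (Dz L) t s) (T1 : L[X][X]) (ρ : ℕ) (c : F)
    (hc : ∀ l : L, algebraMap L F l ≠ c) (hT1 : E2 t s T1 = C c * t ^ ρ)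
    (hT0 : E2 (0 : L[X]) X T1 ≠ 0)
    (hroot : ∀ π : F[X], Prime π → π ∣ t → ∃ a : L, π ∣ s - C (algebraMap L F a) ∧
      2 * rootMultiplicity a (E2 (0 : L[X]) X T1) ≤ T1.natDegree) : False := by
  have hc0 : c ≠ 0 := by rintro rfl; exact hc 0 (by simp)
  have ht0 : t ≠ 0 := by rintro rfl; simp at hd
  have hT : T1 ≠ 0 := by rintro rfl; simp at hT0
  set J := jb D1 (Dz L) t s with hJdef
  set M := RatFunc F
  obtain ⟨D1', hD1'⟩ := ext_der (L := L) (A := F[X]) (M := M) D1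
  obtain ⟨D2', hD2'⟩ := ext_der (L := L) (A := F[X]) (M := M) (Dz L)
  let ι := algebraMap F[X] M
  have hιt : ι t ≠ 0 := am_ne ht0
  have hbrts : ∀ f g, jb D1' D2' (ι f) (ι g) = ι (jb D1 (Dz L) f g) := by
    intro f g
    simp only [jb, map_sub, map_mul]
    rw [hD1', hD1', hD2', hD2']
  have hE2ι : E2 (ι t) (ι s) T1 = ι (C c) * ι t ^ ρ := by
    have := E2_comp_hom (L := L) (IsScalarTower.toAlgHom L F[X] M) t s T1
    rw [hT1] at this
    simpa [ι] using this.symm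
  have halg : ∀ a : L, algebraMap L F[X] a = C (algebraMap L F a) := fun a => rfl
  set i := T1.natDegree with hi
  have hCc : (C c : F[X]) ≠ 0 := by simpa using hc0
  have hdegJ : 2 * natDegree t ≤ natDegree J := by
    have := natDegree_le_of_dvd hJt hJ
    rwa [natDegree_pow] at this
  -- infinity
  have hinf : (i : ℤ) * (natDegree J + 1 - natDegree t) ≤ ρ * natDegree t := by
    obtain ⟨v, hv, hvw⟩ := ext_val (L := L) (A := F[X]) (M := M) (fun p => -(natDegree p : ℤ))
      (by intro a b ha hb; rw [natDegree_mul ha hb]; push_cast; ring)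
      (by
        intro a b ha hb hab
        have := natDegree_add_le a b
        omega)
      (by intro a ha; rw [halg, natDegree_C]; simp)
    have hbr : Br L v (-1) (jb D1' D2') := by
      apply ext_br D1 (Dz L) D1' D2' hD1' hD2' hv
      intro a b hab
      have ha : a ≠ 0 := by rintro rfl; simp [jb] at hab
      have hb : b ≠ 0 := by rintro rfl; simp [jb] at hab
      rw [hvw a ha, hvw b hb, hvw _ hab]
      have := jb_deg D1 hD1 a b hab
      omega
    have hvt : v (ι t) = -natDegree t := hvw t ht0
    have hs0 : s ≠ 0 := by rintro rfl; simp [hJdef, jb] at hJ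
    have hvs : v (ι s) = -natDegree s := hvw s hs0
    have hιs : ι s ≠ 0 := am_ne hs0
    set j : ℕ := natDegree s + 1 + (Finset.range (i + 1)).sup (fun l => natDegree (T1.coeff l))
      with hj
    obtain ⟨H, hH1, hH2⟩ := inf_poly T1 hT j (by
      intro l
      by_cases hl : l ≤ i
      · have := Finset.le_sup (f := fun l => natDegree (T1.coeff l))
          (Finset.mem_range.2 (Nat.lt_succ_of_le hl) : l ∈ Finset.range (i + 1))
        omega
      · rw [coeff_eq_zero_of_natDegree_lt (by omega)]; simp) (ι t) (ι s) hιt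
    have hbre : jb D1' D2' (ι t)⁻¹ (ι s * (ι t)⁻¹ ^ j) = -(ι J * (ι t)⁻¹ ^ (2 + j)) := by
      rw [hJdef, ← hbrts]
      simp only [jb, Derivation.leibniz, Derivation.leibniz_pow, Derivation.leibniz_inv,
        smul_eq_mul, nsmul_eq_mul]
      ring
    have hιJ : ι J ≠ 0 := am_ne hJ
    have hti : (ι t)⁻¹ ≠ 0 := inv_ne_zero hιt
    have hJti : ι J * (ι t)⁻¹ ^ (2 + j) ≠ 0 := mul_ne_zero hιJ (pow_ne_zero _ hti)
    have hvbr : v (jb D1' D2' (ι t)⁻¹ (ι s * (ι t)⁻¹ ^ j)) = (2 + j) * natDegree t - natDegree J := by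
      rw [hbre, hv.neg hJti, hv.mul _ _ hιJ (pow_ne_zero _ hti), hv.pow hti, hv.inv hιt, hvt]
      rw [show v (ι J) = -natDegree J from hvw J hJ]
      push_cast; ring
    have key := lemmaL hv hbr (v (jb D1' D2' (ι t)⁻¹ (ι s * (ι t)⁻¹ ^ j)) + (-1)).toNat
      (ι t)⁻¹ (ι s * (ι t)⁻¹ ^ j) H i (by rw [hbre]; exact neg_ne_zero.2 hJti)
      (by rw [hv.inv hιt, hvt]; omega)
      (by
        rw [hv.mul _ _ hιs (pow_ne_zero _ hti), hv.pow hti, hv.inv hιt, hvt, hvs]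
        have h1 : (natDegree s : ℤ) + 1 ≤ j := by omega
        have h2 : (1 : ℤ) ≤ natDegree t := by exact_mod_cast hd
        nlinarith)
      (Int.self_le_toNat _) hH1
    rw [hE2ι] at hH2
    have h5 := congrArg v hH2
    rw [hv.mul _ _ key.1 (pow_ne_zero _ hιt), hv.pow hιt, hv.mul _ _ (am_ne hCc) (pow_ne_zero _ hιt),
      hv.pow hιt, hvt, show v (ι (C c)) = -natDegree (C c) from hvw _ hCc, natDegree_C] at h5
    have h6 := key.2
    rw [hvbr, hv.inv hιt, hvt] at h6
    push_cast at h5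
    have h7 : (0:ℤ) ≤ (natDegree T1.leadingCoeff : ℤ) * natDegree t := by positivity
    nlinarith
  -- case i = 0
  by_cases hi0 : i = 0
  · rw [hi, natDegree_eq_zero] at hi0
    obtain ⟨q, hq⟩ := hi0
    rw [← hq, E2_C] at hT1
    rw [← hq, E2_C] at hT0
    have hq0 : q.eval 0 ≠ 0 := by
      intro h
      apply hT0
      rw [show (0 : L[X]) = algebraMap L L[X] 0 by simp, aeval_algebraMap_apply]
      simp [h]
    have hqm : aeval t q = (q.map (algebraMap L F)).comp t := by
      rw [comp, eval₂_map, aeval_def]; rfl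
    rcases ρ with _ | ρ
    · rw [pow_zero, mul_one] at hT1
      have h1 := congrArg natDegree hT1
      rw [hqm, natDegree_comp, natDegree_C, natDegree_map] at h1
      have h2 : q.natDegree = 0 := by
        rcases Nat.mul_eq_zero.1 h1 with h | h
        · exact h
        · omega
      rw [natDegree_eq_zero] at h2
      obtain ⟨l, rfl⟩ := h2
      rw [aeval_C, halg] at hT1
      exact hc l (C_injective hT1)
    · have h1 : t ∣ aeval t q - C (algebraMap L F (q.eval 0)) := by
        have h2 : (X : L[X]) ∣ q - C (q.eval 0) := by
          have := X_sub_C_dvd_sub_C_eval (a := (0:L)) (p := q)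
          simpa using this
        have h3 := _root_.map_dvd (aeval (R := L) t : L[X] →ₐ[L] F[X]) h2
        rw [map_sub, aeval_X, aeval_C] at h3
        exact h3
      rw [hT1] at h1
      have h2 : t ∣ C (algebraMap L F (q.eval 0)) := by
        rw [dvd_sub_right (Dvd.intro_left _ (by rw [pow_succ, ← mul_assoc]))] at h1
        exact h1
      have h3 := natDegree_le_of_dvd h2 (by simpa using hq0)
      rw [natDegree_C] at h3
      omega
  -- finite places
  obtain ⟨S, hS1, hS2, hS3⟩ := sum_mult t ht0
  have hfin : ∀ π ∈ S, 2 * (ρ * (multiplicity π t : ℤ)) ≤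
      i * ((multiplicity π J : ℤ) + 1 - multiplicity π t) := by
    intro π hπ
    obtain ⟨hπp, hπt⟩ := hS1 π hπ
    obtain ⟨a, ha1, ha2⟩ := hroot π hπp hπt
    obtain ⟨v, hv, hvw⟩ := ext_val (L := L) (A := F[X]) (M := M) (fun p => (multiplicity π p : ℤ))
      (by
        intro a b ha hb
        rw [multiplicity_mul hπp (fin_mult hπp (mul_ne_zero ha hb))]; push_cast; ring)
      (by
        intro a b ha hb hab
        have h1 := pow_multiplicity_dvd π a
        have h2 := pow_multiplicity_dvd π b
        have h3 : min (multiplicity π a) (multiplicity π b) ≤ multiplicity π (a + b) := by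
          rw [← (fin_mult hπp hab).pow_dvd_iff_le_multiplicity]
          exact dvd_add ((pow_dvd_pow _ (min_le_left _ _)).trans h1)
            ((pow_dvd_pow _ (min_le_right _ _)).trans h2)
        omega)
      (by
        intro a ha
        have h1 : ¬ π ∣ algebraMap L F[X] a := by
          intro h
          apply hπp.not_isUnit
          apply isUnit_of_dvd_unit h
          rw [halg]
          exact isUnit_C.2 (by simpa using ha)
        rw [multiplicity_eq_zero.2 h1]; rfl)
    have hbr : Br L v 1 (jb D1' D2') := by
      apply ext_br D1 (Dz L) D1' D2' hD1' hD2' hv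
      intro a b hab
      have ha : a ≠ 0 := by rintro rfl; simp [jb] at hab
      have hb : b ≠ 0 := by rintro rfl; simp [jb] at hab
      rw [hvw a ha, hvw b hb, hvw _ hab]
      have h1 := jb_pow_dvd D1 (Dz L) π a b _ _ (pow_multiplicity_dvd π a) (pow_multiplicity_dvd π b)
      rw [(fin_mult hπp hab).pow_dvd_iff_le_multiplicity] at h1
      omega
    have hvt : v (ι t) = multiplicity π t := hvw t ht0
    have hpos : ∀ f : F[X], f ≠ 0 → π ∣ f → 1 ≤ multiplicity π f := by
      intro f hf h
      rw [← (fin_mult hπp hf).pow_dvd_iff_le_multiplicity, pow_one]; exact h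
    have hJs : jb D1 (Dz L) t (s - C (algebraMap L F a)) = J := by
      rw [← halg, hJdef]; simp only [jb, map_sub, Derivation.map_algebraMap, sub_zero]
    have hsa : s - C (algebraMap L F a) ≠ 0 := by
      intro h
      rw [h] at hJs
      apply hJ
      rw [← hJs]; simp [jb]
    have hvs : v (ι (s - C (algebraMap L F a))) = multiplicity π (s - C (algebraMap L F a)) :=
      hvw _ hsa
    have h1t := hpos t ht0 hπt
    have h1s := hpos _ hsa ha1
    have hvJ : v (ι J) = multiplicity π J := hvw J hJ
    set H : L[X][X] := E2 (C X : L[X][X]) (X + C (C a)) T1 with hH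
    have hH0 : E2 (0 : L[X]) X H = (E2 (0 : L[X]) X T1).comp (X + C a) := by
      rw [hH, E2_comp]
      have := E2_comp_hom (L := L) (aeval (X + C a) : L[X] →ₐ[L] L[X]) 0 X T1
      rw [map_zero, aeval_X, ← comp_eq_aeval] at this
      rw [this]; simp
    have hHe : E2 (ι t) (ι (s - C (algebraMap L F a))) H = ι (C c) * ι t ^ ρ := by
      rw [hH, E2_comp, ← hE2ι]
      congr 1
      rw [map_add, E2_X, E2_C, E2_C, aeval_X, aeval_C, map_sub,
        IsScalarTower.algebraMap_apply L F[X] M, halg, sub_add_cancel]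
    have key := lemmaL hv hbr (v (ι J) + 1).toNat (ι t) (ι (s - C (algebraMap L F a))) H
      (rootMultiplicity a (E2 (0 : L[X]) X T1))
      (by rw [hbrts, hJs]; exact am_ne hJ) (by omega) (by omega)
      (by rw [hbrts, hJs]; exact Int.self_le_toNat _)
      (by
        rw [hH0, rootMultiplicity_eq_natTrailingDegree]
        have h3 : (E2 (0 : L[X]) X T1).comp (X + C a) ≠ 0 := by
          intro h3
          rw [comp_eq_zero_iff] at h3
          rcases h3 with h3 | h3
          · exact hT0 h3
          · have := congrArg natDegree h3.2
            rw [natDegree_X_add_C, natDegree_C] at this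
            omega
        exact trailingCoeff_nonzero_iff_nonzero.2 h3)
    rw [hHe, hbrts, hJs, hvJ, hvt, hv.mul _ _ (am_ne hCc) (pow_ne_zero _ hιt), hv.pow hιt, hvt,
      show v (ι (C c)) = multiplicity π (C c) from hvw _ hCc] at key
    have hbd := hbr.bound (ι t) (ι (s - C (algebraMap L F a))) (by rw [hbrts, hJs]; exact am_ne hJ)
    rw [hbrts, hJs, hvt, hvs, hvJ] at hbd
    have h8 := key.2
    have h9 : (2 : ℤ) * rootMultiplicity a (E2 (0 : L[X]) X T1) ≤ i := by exact_mod_cast ha2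
    have h10 : (0:ℤ) ≤ (multiplicity π J : ℤ) + 1 - multiplicity π t := by omega
    have h11 : (0:ℤ) ≤ multiplicity π (C c) := by positivity
    nlinarith [mul_le_mul_of_nonneg_right h9 h10]
  have hsum : 2 * (ρ * (natDegree t : ℤ)) ≤ i * natDegree J := by
    have h1 : ∑ π ∈ S, (2 * (ρ * (multiplicity π t : ℤ))) * natDegree π ≤
        ∑ π ∈ S, (i * ((multiplicity π J : ℤ) + 1 - multiplicity π t)) * natDegree π :=
      Finset.sum_le_sum fun π hπ => mul_le_mul_of_nonneg_right (hfin π hπ) (by positivity)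
    have h2 : ∑ π ∈ S, (2 * (ρ * (multiplicity π t : ℤ))) * natDegree π =
        2 * (ρ * (natDegree t : ℤ)) := by
      rw [← hS2]; push_cast
      rw [Finset.mul_sum, Finset.mul_sum]
      apply Finset.sum_congr rfl; intro π _; ring
    have h3 : ∑ π ∈ S, (i * ((multiplicity π J : ℤ) + 1 - multiplicity π t)) * natDegree π =
        i * ((∑ π ∈ S, (multiplicity π J : ℤ) * natDegree π) + ∑ π ∈ S, (natDegree π : ℤ) -
          ∑ π ∈ S, (multiplicity π t : ℤ) * natDegree π) := by
      rw [← Finset.sum_add_distrib, ← Finset.sum_sub_distrib, Finset.mul_sum]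
      apply Finset.sum_congr rfl; intro π _; ring
    have h4 : ∑ π ∈ S, (natDegree π : ℤ) ≤ ∑ π ∈ S, (multiplicity π t : ℤ) * natDegree π := by
      apply Finset.sum_le_sum
      intro π hπ
      obtain ⟨hπp, hπt⟩ := hS1 π hπ
      have : 1 ≤ multiplicity π t := by
        rw [← (fin_mult hπp ht0).pow_dvd_iff_le_multiplicity, pow_one]; exact hπt
      have : (1:ℤ) ≤ multiplicity π t := by exact_mod_cast this
      nlinarith [(by positivity : (0:ℤ) ≤ natDegree π)]
    have h5 : ∑ π ∈ S, (multiplicity π J : ℤ) * natDegree π ≤ natDegree J := by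
      exact_mod_cast hS3 J hJ
    rw [h2, h3] at h1
    refine h1.trans (mul_le_mul_of_nonneg_left ?_ (by positivity))
    linarith
  have hipos : (1:ℤ) ≤ i := by omega
  have hdJ : (2:ℤ) * natDegree t ≤ natDegree J := by exact_mod_cast hdegJ
  nlinarith

end
end Polynomial
end

end

section
section
namespace Polynomial
open SLP

variable {k : Type*} [Field k]

theorem pth_root [IsAlgClosed k] (q : ℕ) [Fact q.Prime] [CharP k q] (a : k[X])
    (h : derivative a = 0) : ∃ b : k[X], b ^ q = a := by
  have hp : q ≠ 0 := (Fact.out : q.Prime).ne_zero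
  have h1 := expand_contract q h hp
  have : PerfectRing k q := inferInstance
  refine ⟨(contract q a).map (frobeniusEquiv k q).symm.toRingHom, ?_⟩
  rw [← map_frobenius_expand (R := k) (p := q), ← map_expand, h1, Polynomial.map_map]
  have : (frobenius k q).comp (frobeniusEquiv k q).symm.toRingHom = RingHom.id k := by
    ext x
    simp
  rw [this, Polynomial.map_id]

/-- coefficientwise derivative -/
def cder (Γ : k[X][X]) : k[X][X] := PolynomialModule.equivPolynomialSelf.compDer (Derivation.mapCoeffs (derivative' : Derivation k k[X] k[X])) Γ

theorem cder_coeff (Γ : k[X][X]) (i : ℕ) : (cder Γ).coeff i = derivative (Γ.coeff i) := rfl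

theorem cder_chain {A : Type*} [CommRing A] [Algebra k A] (D : Derivation k A A) (p s : A)
    (Γ : k[X][X]) : D (E2 p s Γ) = E2 p s (cder Γ) * D p + E2 p s (derivative Γ) * D s := by
  induction Γ using Polynomial.induction_on' with
  | add a b ha hb =>
    have : cder (a + b) = cder a + cder b := by simp [cder]
    simp only [map_add, ha, hb, this]; ring
  | monomial n a =>
    have : cder (monomial n a) = C (derivative a) * X ^ n := by
      ext i : 1
      rw [cder_coeff, coeff_C_mul, coeff_X_pow, coeff_monomial]
      split_ifs <;> simp_all
    rw [this, ← C_mul_X_pow_eq_monomial, derivative_C_mul_X_pow]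
    simp only [map_mul, map_pow, E2_C, E2_X, Derivation.leibniz, Derivation.leibniz_pow,
      Derivation.map_aeval, smul_eq_mul, nsmul_eq_mul, map_natCast]
    ring

theorem sepPoly [IsAlgClosed k] (p s : MvPolynomial (Fin 2) k)
    (htr : ∀ g : k[X], aeval p g = 0 → g = 0) (hpd : ∃ i, pderiv i p ≠ 0)
    (hrel : ∃ Γ : k[X][X], Γ ≠ 0 ∧ ev2 p s Γ = 0)
    (h2 : ∀ Γ : k[X][X], Γ ≠ 0 → ev2 p s Γ = 0 → 2 ≤ Γ.natDegree) :
    ∃ Γ : k[X][X], ev2 p s Γ = 0 ∧ Irreducible (Γ.map (algebraMap k[X] (RatFunc k))) ∧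
      (Γ.map (algebraMap k[X] (RatFunc k))).Separable ∧ 2 ≤ Γ.natDegree := by
  classical
  have hE : ev2 p s = E2 (L := k) p s := rfl
  simp only [hE] at *
  -- minimal relation
  let S1 : Set ℕ := {n | ∃ Γ : k[X][X], Γ ≠ 0 ∧ E2 p s Γ = 0 ∧ Γ.natDegree = n}
  have hS1 : S1.Nonempty := by
    obtain ⟨Γ, h, h'⟩ := hrel
    exact ⟨_, Γ, h, h', rfl⟩
  let n := sInf S1
  have hn : n ∈ S1 := Nat.sInf_mem hS1
  have hmin : ∀ Γ : k[X][X], Γ ≠ 0 → E2 p s Γ = 0 → n ≤ Γ.natDegree :=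
    fun Γ h h' => Nat.sInf_le ⟨Γ, h, h', rfl⟩
  let S2 : Set ℕ := {m | ∃ Γ : k[X][X], Γ ≠ 0 ∧ E2 p s Γ = 0 ∧ Γ.natDegree = n ∧
    (Γ.coeff n).natDegree = m}
  have hS2 : S2.Nonempty := by
    obtain ⟨Γ, h, h', h''⟩ := hn
    exact ⟨_, Γ, h, h', h'', rfl⟩
  obtain ⟨Γ, hΓ0, hΓ, hΓn, hΓm⟩ := Nat.sInf_mem hS2
  have hmin2 : ∀ Γ' : k[X][X], Γ' ≠ 0 → E2 p s Γ' = 0 → Γ'.natDegree = n →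
      (Γ.coeff n).natDegree ≤ (Γ'.coeff n).natDegree := by
    intro Γ' h h' h''
    rw [hΓm]; exact Nat.sInf_le ⟨Γ', h, h', h'', rfl⟩
  have hn2 : 2 ≤ n := hΓn ▸ h2 Γ hΓ0 hΓ
  have hlc : Γ.coeff n ≠ 0 := by
    rw [← hΓn]; exact leadingCoeff_ne_zero.2 hΓ0
  -- derivative in Y nonzero
  have hder : derivative Γ ≠ 0 := by
    intro hd
    obtain ⟨i, hi⟩ := hpd
    have h3 := cder_chain (pderiv i) p s Γ
    rw [hΓ, hd, map_zero, map_zero, zero_mul, add_zero] at h3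
    have h4 : E2 p s (cder Γ) = 0 := (mul_eq_zero.1 h3.symm).resolve_right hi
    have hle : (cder Γ).natDegree ≤ n := by
      rw [natDegree_le_iff_coeff_eq_zero]
      intro N hN
      rw [cder_coeff, coeff_eq_zero_of_natDegree_lt (hΓn ▸ hN), derivative_zero]
    have h5 : cder Γ = 0 := by
      by_contra h5
      have h6 := le_antisymm hle (hmin _ h5 h4)
      have h7 := hmin2 _ h5 h4 h6
      rw [cder_coeff] at h7
      have h8 : derivative (Γ.coeff n) ≠ 0 := by
        have := leadingCoeff_ne_zero.2 h5
        rwa [leadingCoeff, h6, cder_coeff] at this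
      have h9 : (Γ.coeff n).natDegree ≠ 0 := by
        intro h9
        rw [eq_C_of_natDegree_eq_zero h9, derivative_C] at h8
        exact h8 rfl
      have := natDegree_derivative_lt h9
      omega
    obtain ⟨q, hq⟩ := CharP.exists k
    rcases CharP.char_is_prime_or_zero k q with hp | rfl
    · have : Fact q.Prime := ⟨hp⟩
      have hp0 : q ≠ 0 := hp.ne_zero
      have : CharP k[X] q := inferInstance
      have h6 : ∀ i, ∃ b : k[X], b ^ q = Γ.coeff i := by
        intro i
        apply pth_root q
        rw [← cder_coeff, h5, coeff_zero]
      have h7 : contract q Γ ∈ lifts (frobenius k[X] q) := by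
        rw [lifts_iff_coeff_lifts]
        intro i
        rw [coeff_contract hp0]
        obtain ⟨b, hb⟩ := h6 (i * q)
        exact ⟨b, by rw [frobenius_def, hb]⟩
      obtain ⟨Γ1, h8⟩ := h7
      rw [coe_mapRingHom] at h8
      have h9 : Γ1 ^ q = Γ := by
        rw [← map_frobenius_expand, map_expand, h8, expand_contract q hd hp0]
      have h10 : Γ1 ≠ 0 := by
        rintro rfl
        rw [zero_pow hp0] at h9
        exact hΓ0 h9.symm
      have h11 : E2 p s Γ1 = 0 := by
        rw [← h9, map_pow] at hΓ
        exact pow_eq_zero_iff hp0 |>.1 hΓ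
      have h12 := hmin _ h10 h11
      rw [← hΓn, ← h9, natDegree_pow] at h12
      have h13 := h2 _ h10 h11
      have h14 := hp.two_le
      nlinarith
    · have : CharZero k := CharP.charP_to_charZero k
      have := natDegree_eq_zero_of_derivative_eq_zero hd
      omega
  -- irreducibility
  let K := RatFunc k
  let M := FractionRing (MvPolynomial (Fin 2) k)
  let f0 : k[X] →+* M := (algebraMap (MvPolynomial (Fin 2) k) M).comp (aeval p : k[X] →ₐ[k] _).toRingHom
  have hf0 : Function.Injective f0 := by
    rw [injective_iff_map_eq_zero]
    intro g hg
    exact htr g (IsFractionRing.injective (MvPolynomial (Fin 2) k) M (by simpa [f0] using hg))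
  let f : K →+* M := IsFractionRing.lift (A := k[X]) hf0
  have hf : ∀ g : k[X], f (algebraMap _ _ g) = f0 g := fun g => IsFractionRing.lift_algebraMap hf0 g
  let _ : Algebra K M := f.toAlgebra
  let σ : M := algebraMap _ M s
  have hev : ∀ G : k[X][X], aeval σ (G.map (algebraMap k[X] K)) = algebraMap _ M (E2 p s G) := by
    intro G
    have : ((aeval σ : K[X] →ₐ[K] M).toRingHom.comp (mapRingHom (algebraMap k[X] K))) =
        (algebraMap _ M).comp (E2 (L := k) p s) := by
      apply Polynomial.ringHom_ext
      · intro g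
        have : algebraMap K M (algebraMap k[X] K g) = f0 g := hf g
        simp [this, f0]
      · simp [σ]
    exact RingHom.congr_fun this G
  have hinjK : Function.Injective (algebraMap k[X] K) := IsFractionRing.injective _ _
  have hpne : Γ.map (algebraMap k[X] K) ≠ 0 := (Polynomial.map_ne_zero_iff hinjK).2 hΓ0
  have halg : aeval σ (Γ.map (algebraMap k[X] K)) = 0 := by rw [hev, hΓ, map_zero]
  have hInteg : IsIntegral K σ := IsAlgebraic.isIntegral ⟨_, hpne, halg⟩
  have hmp : n ≤ (minpoly K σ).natDegree := by
    have hm0 := minpoly.ne_zero hInteg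
    obtain ⟨b, hb⟩ := IsLocalization.integerNormalization_map_to_map (nonZeroDivisors k[X]) (minpoly K σ)
    set N := IsLocalization.integerNormalization (nonZeroDivisors k[X]) (minpoly K σ) with hN
    have hb0 : (algebraMap k[X] K b) ≠ 0 := by
      rw [map_ne_zero_iff _ hinjK]; exact nonZeroDivisors.ne_zero b.2
    have hb' : N.map (algebraMap k[X] K) = C (algebraMap k[X] K b) * minpoly K σ := by
      rw [hb, Algebra.smul_def]; rfl
    have h3 : N ≠ 0 := by
      intro h3
      rw [h3, Polynomial.map_zero] at hb'
      exact mul_ne_zero (C_ne_zero.2 hb0) hm0 hb'.symm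
    have h4 : E2 p s N = 0 := by
      apply IsFractionRing.injective (MvPolynomial (Fin 2) k) M
      rw [← hev, hb', map_mul, minpoly.aeval, mul_zero, map_zero]
    have h5 := hmin _ h3 h4
    rwa [← natDegree_map_eq_of_injective hinjK, hb', natDegree_C_mul hb0] at h5
  have hirr : Irreducible (Γ.map (algebraMap k[X] K)) := by
    have hd := minpoly.dvd K σ halg
    have : Associated (minpoly K σ) (Γ.map (algebraMap k[X] K)) := by
      apply associated_of_dvd_of_natDegree_le hd hpne
      rwa [natDegree_map_eq_of_injective hinjK, hΓn]
    exact this.irreducible (minpoly.irreducible hInteg)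
  refine ⟨Γ, hΓ, hirr, ?_, hΓn ▸ hn2⟩
  rw [separable_iff_derivative_ne_zero hirr, derivative_map]
  exact (Polynomial.map_ne_zero_iff hinjK).2 hder

end Polynomial
end

end

section
section
namespace Polynomial
open SLP

variable {k : Type*} [Field k]

/-- evaluation of trivariate polynomials -/
def E3 {D : Type*} [CommRing D] [Algebra k D] (q τ σ : D) : W3 k →+* D :=
  eval₂RingHom (eval₂RingHom (aeval q : k[X] →ₐ[k] D).toRingHom τ) σ

section
variable {D : Type*} [CommRing D] [Algebra k D] (q τ σ : D)
@[simp] theorem E3_X : E3 (k := k) q τ σ X = σ := by simp [E3]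
@[simp] theorem E3_CX : E3 (k := k) q τ σ (C X) = τ := by simp [E3]
@[simp] theorem E3_CC (g : k[X]) : E3 (k := k) q τ σ (C (C g)) = aeval q g := by simp [E3]

theorem E3_comp {D' : Type*} [CommRing D'] [Algebra k D'] (f : D →ₐ[k] D') (G : W3 k) :
    f (E3 q τ σ G) = E3 (f q) (f τ) (f σ) G := by
  have : f.toRingHom.comp (E3 (k := k) q τ σ) = E3 (f q) (f τ) (f σ) := by
    apply W3_hom_ext <;> simp
  exact RingHom.congr_fun this G

theorem kap_eq (P s : B3 k) : kap P s = E3 P (MvPolynomial.X 0) s := rfl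

theorem hom_kap (f : SL2Ring k →ₐ[k] D) (P s : B3 k) (G : W3 k) :
    f (etaStar k (kap P s G)) = E3 (f (etaStar k P)) (f tR) (f (etaStar k s)) G := by
  rw [kap_eq, E3_comp, E3_comp, eta_X0]
end

structure Good (P s : B3 k) : Prop where
  sat : ∀ b, ∃ m G, MvPolynomial.X 0 ^ m * b = kap P s G
  inj : Function.Injective (kap P s)
  tr : ∀ g : k[X], aeval P g ∈ IH k → g = 0

theorem Good.satR {P s : B3 k} (h : Good P s) (r : SL2Ring k) :
    ∃ m G, tR ^ m * r = etaStar k (kap P s G) := by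
  obtain ⟨n, b, hb⟩ := exists_t_pow r
  obtain ⟨m, G, hG⟩ := h.sat b
  refine ⟨m + n, G, ?_⟩
  rw [← hG, map_mul, map_pow, eta_X0, ← hb]; ring

theorem lift_good {Q s : B3 k} (h : Good Q s) {D : Type*} [CommRing D] [Algebra k D] (q τ σ : D)
    (hτ : IsUnit τ) : ∃ e : SL2Ring k →ₐ[k] D, e (etaStar k Q) = q ∧ e tR = τ ∧
      e (etaStar k s) = σ := by
  let f : W3 k →+* SL2Ring k := (etaStar k).toRingHom.comp (kap Q s)
  have hf : ∀ G, f G = etaStar k (kap Q s G) := fun _ => rfl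
  obtain ⟨e, he⟩ := lift_exists f (eta_inj.comp h.inj) (Submonoid.powers (C X : W3 k))
    (by
      rintro ⟨n, hn⟩
      exact pow_ne_zero n (C_ne_zero.2 X_ne_zero) hn)
    (by
      intro r
      obtain ⟨m, G, hG⟩ := h.satR r
      refine ⟨_, ⟨m, rfl⟩, G, ?_⟩
      simp only [map_pow]
      rw [hf, kap_CX, eta_X0, hG, hf])
    (E3 q τ σ) (by
      rintro _ ⟨n, rfl⟩
      simp only [map_pow, E3_CX]
      exact hτ.pow n)
  have hk : ∀ c : k, e (algebraMap k _ c) = algebraMap k D c := by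
    intro c
    have := he (C (C (C c)))
    rw [hf, kap_CC] at this
    simpa using this
  refine ⟨{ e with commutes' := hk }, ?_, ?_, ?_⟩
  · have := he (C (C X))
    rw [hf, kap_CC] at this
    simpa using this
  · have := he (C X)
    rw [hf, kap_CX, eta_X0] at this
    simpa using this
  · have := he X
    rw [hf, kap_X] at this
    simpa using this

/-- Divisibility of brackets. -/
theorem dvd_bracket {P : B3 k} (h1 : ∃ g : k[X], g ≠ 0 ∧ ∃ a, aeval P g - hyp P * a ∈ IH k)
    {D : Type*} [CommRing D] [Algebra k D] (ι : SL2Ring k →ₐ[k] D)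
    (hu : ∀ g : k[X], g ≠ 0 → IsUnit (ι (etaStar k (aeval P g))))
    (E : Derivation k D D) (hEt : E (ι tR) = 0) (hEP : E (ι (etaStar k P)) = 0) (b : B3 k) :
    ι tR ∣ E (ι (etaStar k b)) := by
  obtain ⟨g, hg, a, ha⟩ := h1
  have hug := hu g hg
  have hIH : ∀ b ∈ IH k, ι tR ∣ ι (etaStar k b) := fun b hb => _root_.map_dvd ι (eta_IH hb)
  let j : B3 k →ₐ[k] D := ι.comp (etaStar k)
  have hj : ∀ b, ι (etaStar k b) = j b := fun _ => rfl
  have hj0 : j (MvPolynomial.X 0) = ι tR := by rw [← hj, eta_X0]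
  have hj1 : j (MvPolynomial.X 1) = ι xR := by rw [← hj, eta_X1]
  have hj2 : j (MvPolynomial.X 2) = ι yR := by rw [← hj, eta_X2]
  have hch : ∀ b, E (j b) = j (pderiv 1 b) * E (ι xR) + j (pderiv 2 b) * E (ι yR) := by
    intro b
    rw [chain_rule j E b, Fin.sum_univ_three, hj0, hj1, hj2, hEt]
    ring
  have hrel : ι yR * E (ι xR) + ι xR * E (ι yR) = ι tR * E (ι uR) := by
    have := congrArg (fun r => E (ι r)) (rel_R (k := k))
    simp only [map_mul, map_add, map_one, Derivation.leibniz, Derivation.map_one_eq_zero,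
      smul_eq_mul, hEt] at this
    linear_combination this
  have hrel2 : ι xR * ι yR = ι tR * ι uR + 1 := by
    rw [← map_mul, rel_R, map_add, map_mul, map_one]
  have hP0 := hch P
  rw [← hj, hEP] at hP0
  have hh : j (hyp P) = ι xR * j (pderiv 1 P) - ι yR * j (pderiv 2 P) := by
    rw [hyp_apply, map_sub, map_mul, map_mul, hj1, hj2]
  have hx : ι tR ∣ E (ι xR) := by
    rw [← IsUnit.dvd_mul_left hug]
    obtain ⟨w, hw⟩ := hIH _ ha
    rw [hj, map_sub, map_mul, sub_eq_iff_eq_add] at hw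
    rw [hj, hw, hh]
    refine ⟨w * E (ι xR) - j a * j (pderiv 2 P) * E (ι uR), ?_⟩
    linear_combination (-j a * ι xR) * hP0 - (j a * j (pderiv 2 P)) * hrel
  have hy : ι tR ∣ E (ι yR) := by
    obtain ⟨w, hw⟩ := hx
    refine ⟨ι yR * E (ι uR) - ι yR * ι yR * w - ι uR * E (ι yR), ?_⟩
    linear_combination ι yR * hrel - E (ι yR) * hrel2 - ι yR ^ 2 * hw
  rw [hj, hch]
  exact dvd_add (hx.mul_left _) (hy.mul_left _)

end Polynomial
end

end

section
section
namespace Polynomial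
open SLP

theorem rootMult_bound {K L : Type*} [Field K] [Field L] (f : K →+* L) (p q : K[X])
    (hp : Irreducible p) (hs : p.Separable) (hq : q ≠ 0) (a : L) (ha : (p.map f).IsRoot a) :
    p.natDegree * rootMultiplicity a (q.map f) ≤ q.natDegree := by
  obtain ⟨n, q', hq', rfl⟩ := WfDvdMonoid.max_power_factor hq hp
  have hq0 : q' ≠ 0 := by rintro rfl; simp at hq'
  have hpm : p.map f ≠ 0 := (Polynomial.map_ne_zero_iff f.injective).2 hp.ne_zero
  have hqm : q'.map f ≠ 0 := (Polynomial.map_ne_zero_iff f.injective).2 hq0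
  have hcop : IsCoprime p q' := (hp.coprime_iff_not_dvd).2 hq'
  have h1 : rootMultiplicity a (p.map f) = 1 := by
    apply le_antisymm
    · exact rootMultiplicity_le_one_of_separable (hs.map) a
    · exact (rootMultiplicity_pos hpm).2 ha
  have h2 : rootMultiplicity a (q'.map f) = 0 := by
    apply rootMultiplicity_eq_zero
    intro h
    obtain ⟨u, v, huv⟩ := hcop
    have := congrArg (fun r => (r.map f).eval a) huv
    simp only [Polynomial.map_add, Polynomial.map_mul, eval_add, eval_mul, ha.eq_zero, h.eq_zero,
      Polynomial.map_one, eval_one] at this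
    simp at this
  rw [Polynomial.map_mul, Polynomial.map_pow, rootMultiplicity_mul (mul_ne_zero (pow_ne_zero _ hpm) hqm),
    h2, natDegree_mul (pow_ne_zero _ hp.ne_zero) hq0, natDegree_pow]
  have h3 : rootMultiplicity a (p.map f ^ n) = n := by
    have : ∀ m : ℕ, rootMultiplicity a (p.map f ^ m) = m := by
      intro m
      induction m with
      | zero => simp
      | succ m ih =>
        rw [pow_succ, rootMultiplicity_mul (mul_ne_zero (pow_ne_zero _ hpm) hpm), ih, h1]
    exact this n
  rw [h3, mul_comm, add_zero]; omega

variable {k : Type*} [Field k]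

section
variable {L F : Type*} [Field L] [Algebra k L] [Field F] [Algebra L F] [Algebra k F]
  [IsScalarTower k L F]

/-- `k[X][T][S] → L[T][S]` -/
def toL (x : L) : W3 k →+* L[X][X] := mapRingHom (mapRingHom (aeval x : k[X] →ₐ[k] L).toRingHom)

theorem toL_inj (x : L) (hx : ∀ g : k[X], aeval x g = 0 → g = 0) :
    Function.Injective (toL (k := k) x) := by
  apply Polynomial.map_injective
  apply Polynomial.map_injective
  rw [injective_iff_map_eq_zero]
  exact hx

theorem E3_toL {A : Type*} [CommRing A] [Algebra L A] [Algebra k A] [IsScalarTower k L A] (x : L)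
    (t s : A) (G : W3 k) :
    E3 (algebraMap L A x) t s G = E2 t s (toL x G) := by
  have : E3 (k := k) (algebraMap L A x) t s = (E2 (L := L) t s).comp (toL x) := by
    apply W3_hom_ext
    · intro r
      simp [toL, ← IsScalarTower.algebraMap_apply]
    · simp [toL]
    · simp [toL]
    · simp [toL]
  exact RingHom.congr_fun this G

theorem toL_eval0 (x : L) (G : W3 k) : E2 (0 : L[X]) X (toL x G) =
    (G.map (evalRingHom (0 : k[X]))).map (aeval x : k[X] →ₐ[k] L).toRingHom := by
  have : (E2 (L := L) (0 : L[X]) X).comp (toL (k := k) x) =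
      (mapRingHom (aeval x : k[X] →ₐ[k] L).toRingHom).comp (mapRingHom (evalRingHom (0 : k[X]))) := by
    apply W3_hom_ext <;> simp [toL]
  exact RingHom.congr_fun this G

/-- any derivation killing `t̂, ŝ` kills everything -/
theorem der_kill {P s : B3 k} (hsat : SatP P s) {A : Type*} [CommRing A] [IsDomain A] [Algebra L A]
    [Algebra k A] [IsScalarTower k L A] (x : L) (hx : ∀ g : k[X], aeval x g = 0 → g = 0)
    (ι : SL2Ring k →ₐ[k] A) (hP : ι (etaStar k P) = algebraMap L A x) (ht : ι tR ≠ 0)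
    (E : Derivation L A A) (hEt : E (ι tR) = 0) (hEs : E (ι (etaStar k s)) = 0) (r : SL2Ring k) :
    E (ι r) = 0 := by
  obtain ⟨n, b, hb⟩ := exists_t_pow r
  obtain ⟨g, hg, ρ, G, hG⟩ := hsat b
  have h1 := congrArg (fun b => ι (etaStar k b)) hG
  simp only [hom_kap, hP, E3_toL, map_mul, map_pow, eta_X0, ← hb] at h1
  rw [← Polynomial.aeval_algHom_apply, ← Polynomial.aeval_algHom_apply, hP,
    Polynomial.aeval_algebraMap_apply] at h1
  have h2 := congrArg E h1
  rw [cder_chain, hEt, hEs] at h2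
  simp only [Derivation.leibniz, Derivation.leibniz_pow, hEt, Derivation.map_algebraMap,
    smul_zero, add_zero, mul_zero, smul_eq_mul] at h2
  have h3 : algebraMap L A (aeval x g) ≠ 0 := by
    rw [map_ne_zero_iff _ (FaithfulSMul.algebraMap_injective L A)]
    exact fun h => hg (hx g h)
  have h4 := (mul_eq_zero.1 h2).resolve_left (mul_ne_zero h3 (pow_ne_zero _ ht))
  exact (mul_eq_zero.1 h4).resolve_left (pow_ne_zero _ ht)

theorem lift_K (x : L) (hx : ∀ g : k[X], aeval x g = 0 → g = 0) :
    ∃ f : RatFunc k →+* L, ∀ g : k[X], f (algebraMap _ _ g) = aeval x g := by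
  have hf0 : Function.Injective (aeval x : k[X] →ₐ[k] L).toRingHom := by
    rw [injective_iff_map_eq_zero]; exact hx
  exact ⟨IsFractionRing.lift (A := k[X]) hf0, fun g => IsFractionRing.lift_algebraMap hf0 g⟩

theorem gamma_eq {P s : B3 k} {Γ : k[X][X]} (hΓ : ev2 (evc 0 P) (evc 0 s) Γ = 0) :
    ∃ w, kap P s (Γ.map C) = MvPolynomial.X 0 * w := by
  have h1 : evc 0 (kap P s (Γ.map C)) = 0 := by
    rw [evc_kap, Polynomial.map_map]
    have : (evalRingHom (C (0:k))).comp C = RingHom.id k[X] := by ext <;> simp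
    rw [this, Polynomial.map_id, hΓ]
  rw [← dvd_iff_evc, MvPolynomial.C_0, sub_zero] at h1
  exact h1

theorem E3_gamma {A : Type*} [CommRing A] [Algebra L A] [Algebra k A] [IsScalarTower k L A] (x : L)
    (t s : A) (Γ : k[X][X]) :
    E3 (algebraMap L A x) t s (Γ.map C) =
      aeval s (Γ.map (aeval x : k[X] →ₐ[k] L).toRingHom) := by
  have : (E3 (k := k) (algebraMap L A x) t s).comp (mapRingHom C) =
      (aeval s : L[X] →ₐ[L] A).toRingHom.comp (mapRingHom (aeval x : k[X] →ₐ[k] L).toRingHom) := by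
    apply ev2_hom_ext
    · intro r
      simp [← IsScalarTower.algebraMap_apply]
    · simp
    · simp
  exact RingHom.congr_fun this Γ

theorem dvd_sub_root {A : Type*} [CommRing A] [IsDomain A] [Algebra L A] [IsAlgClosed L]
    (p : L[X]) (hp : p ≠ 0) (s π : A) (hπ : Prime π) (h : π ∣ aeval s p) :
    ∃ a, p.IsRoot a ∧ π ∣ s - algebraMap L A a := by
  have hsp := (IsAlgClosed.splits p).eq_prod_roots
  rw [hsp, map_mul, aeval_C, map_multiset_prod, Multiset.map_map] at h
  rcases hπ.dvd_or_dvd h with h | h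
  · exfalso
    apply hπ.not_isUnit
    apply isUnit_of_dvd_unit h
    exact (isUnit_iff_ne_zero.2 (leadingCoeff_ne_zero.2 hp)).map _
  · obtain ⟨q, hq, hd⟩ := (hπ.exists_mem_multiset_dvd h)
    obtain ⟨a, ha, rfl⟩ := Multiset.mem_map.1 hq
    exact ⟨a, isRoot_of_mem_roots ha, by simpa using hd⟩
end

section
variable {L F : Type*} [Field L] [IsAlgClosed L] [Algebra k L] [Field F] [Algebra L F] [Algebra k F]
  [IsScalarTower k L F]

theorem U_app {P s : B3 k} (h1b : ∃ g : k[X], g ≠ 0 ∧ ∃ a, aeval P g - hyp P * a ∈ IH k)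
    (hsat : SatP P s) {Γ : k[X][X]} (hΓ : ev2 (evc 0 P) (evc 0 s) Γ = 0)
    (hirr : Irreducible (Γ.map (algebraMap k[X] (RatFunc k))))
    (hsep : (Γ.map (algebraMap k[X] (RatFunc k))).Separable) (h2 : 2 ≤ Γ.natDegree)
    (x : L) (hx : ∀ g : k[X], aeval x g = 0 → g = 0) (d : Derivation L F F) (c : F) (hdc : d c = 1)
    (ι : SL2Ring k →ₐ[k] F[X]) (hP : ι (etaStar k P) = algebraMap L F[X] x) (r1 r2 : SL2Ring k)
    (hr1 : ι r1 = C c) (hr2 : ι r2 = X) (ht0 : ι tR ≠ 0) : natDegree (ι tR) = 0 := by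
  classical
  by_contra hd
  have hd1 : 1 ≤ natDegree (ι tR) := Nat.one_le_iff_ne_zero.2 hd
  obtain ⟨D1, hD1⟩ := coeff_der d
  have hD1deg : ∀ p, degree (D1 p) ≤ degree p := by
    intro p
    rw [degree_le_iff_coeff_zero]
    intro m hm
    rw [hD1, coeff_eq_zero_of_degree_lt hm, map_zero]
  have hD1X : D1 X = 0 := by
    ext i
    rw [hD1, coeff_X]
    split_ifs <;> simp
  have hD1c : D1 (C c) = 1 := by
    ext i
    rw [hD1, coeff_C, coeff_one]
    split_ifs <;> simp [hdc]
  have hc0 : c ≠ 0 := by rintro rfl; simp at hdc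
  have hcL : ∀ l : L, algebraMap L F l ≠ c := by
    rintro l rfl
    rw [Derivation.map_algebraMap] at hdc
    exact zero_ne_one hdc
  have hDzX : Dz L (X : F[X]) = 1 := by rw [Dz_apply, derivative_X]
  have hDzc : Dz L (C c : F[X]) = 0 := by rw [Dz_apply, derivative_C]
  set t := ι tR with htdef
  set ŝ := ι (etaStar k s) with hsdef
  obtain ⟨f, hf⟩ := lift_K x hx
  have hfc : f.comp (algebraMap k[X] (RatFunc k)) = (aeval x : k[X] →ₐ[k] L).toRingHom := by
    refine RingHom.ext fun g => ?_
    exact hf g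
  set p1 : L[X] := Γ.map (aeval x : k[X] →ₐ[k] L).toRingHom with hp1
  have hp1f : p1 = (Γ.map (algebraMap k[X] (RatFunc k))).map f := by
    rw [Polynomial.map_map, hfc]
  have hp1sep : p1.Separable := by rw [hp1f]; exact hsep.map
  have hp10 : p1 ≠ 0 := hp1sep.ne_zero
  obtain ⟨w, hw⟩ := gamma_eq hΓ
  have hpw : aeval ŝ p1 = t * ι (etaStar k w) := by
    rw [← E3_gamma x t ŝ Γ, ← hP, ← hom_kap, hw, map_mul, map_mul, eta_X0]
  -- nonvanishing bracket
  have hJ : jb D1 (Dz L) t ŝ ≠ 0 := by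
    intro hJ
    have kill := fun E h1 h2 => der_kill hsat x hx ι hP ht0 E h1 h2
    have key : ∀ f : F[X], jb D1 (Dz L) t f = 0 → jb D1 (Dz L) f ŝ = 0 →
        D1 f = 0 ∧ Dz L f = 0 := by
      intro f h1 h2
      have hE1 : ∀ r, ((Dz L f) • D1 - (D1 f) • Dz L : Derivation L F[X] F[X]) (ι r) = 0 := by
        apply kill
        · simp only [Derivation.coe_sub, Derivation.coe_smul, Pi.sub_apply, Pi.smul_apply, smul_eq_mul]
          rw [jb] at h1
          linear_combination h1
        · simp only [Derivation.coe_sub, Derivation.coe_smul, Pi.sub_apply, Pi.smul_apply, smul_eq_mul]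
          rw [jb] at h2
          linear_combination -h2
      have a1 := hE1 r1
      have a2 := hE1 r2
      rw [hr1] at a1
      rw [hr2] at a2
      simp only [Derivation.coe_sub, Derivation.coe_smul, Pi.sub_apply, Pi.smul_apply, smul_eq_mul,
        hD1c, hDzc, hD1X, hDzX] at a1 a2
      constructor
      · linear_combination -a2
      · linear_combination a1
    obtain ⟨b1, -⟩ := key t (by rw [jb]; ring) hJ
    obtain ⟨b3, -⟩ := key ŝ hJ (by rw [jb]; ring)
    have := kill D1 b1 b3 r1
    rw [hr1, hD1c] at this
    exact one_ne_zero this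
  -- t^2 divides the bracket
  have hJt : t ^ 2 ∣ jb D1 (Dz L) t ŝ := by
    let E : Derivation L F[X] F[X] := (Dz L t) • D1 - (D1 t) • Dz L
    have hE : ∀ f, E f = - jb D1 (Dz L) t f := by
      intro f
      simp only [E, jb, Derivation.coe_sub, Derivation.coe_smul, Pi.sub_apply, Pi.smul_apply, smul_eq_mul]
      ring
    have hEt : E t = 0 := by rw [hE, jb]; ring
    have hb : ∀ b, t ∣ E (ι (etaStar k b)) := by
      intro b
      refine dvd_bracket h1b ι ?_ (E.restrictScalars k) hEt ?_ b
      · intro g hg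
        rw [← Polynomial.aeval_algHom_apply, ← Polynomial.aeval_algHom_apply, hP,
          Polynomial.aeval_algebraMap_apply]
        exact (isUnit_iff_ne_zero.2 (fun h => hg (hx g h))).map _
      · rw [hP]
        exact Derivation.map_algebraMap E x
    have h3 : t ^ 2 ∣ aeval ŝ (derivative p1) * E ŝ := by
      have := congrArg E hpw
      rw [Derivation.map_aeval, Derivation.leibniz, hEt, smul_zero, add_zero, smul_eq_mul,
        smul_eq_mul] at this
      rw [this, pow_two]
      exact mul_dvd_mul_left t (hb w)
    obtain ⟨u, v, huv⟩ := hp1sep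
    have h4 := congrArg (aeval ŝ) huv
    simp only [map_add, map_mul, hpw, map_one] at h4
    have h5 : E ŝ = aeval ŝ u * ι (etaStar k w) * (t * E ŝ) +
        aeval ŝ v * (aeval ŝ (derivative p1) * E ŝ) := by
      linear_combination (-E ŝ) * h4
    have h6 : t ∣ E ŝ := hb s
    have h7 : t ^ 2 ∣ E ŝ := by
      rw [h5]
      apply dvd_add (Dvd.dvd.mul_left _ _) (h3.mul_left _)
      rw [pow_two]; exact mul_dvd_mul_left t h6
    rwa [hE, dvd_neg] at h7
  -- the polynomial T1
  have hex : ∃ ρ : ℕ, ∃ (g : k[X]) (G : W3 k), g ≠ 0 ∧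
      etaStar k (aeval P g) * tR ^ ρ * r1 = etaStar k (kap P s G) := by
    obtain ⟨n, b, hb⟩ := exists_t_pow r1
    obtain ⟨g, hg, ρ, G, hG⟩ := hsat b
    refine ⟨ρ + n, g, G, hg, ?_⟩
    rw [← hG, map_mul, map_mul, map_pow, eta_X0, ← hb]; ring
  obtain ⟨g, G, hg, hG⟩ := Nat.find_spec hex
  set ρ := Nat.find hex with hρ
  have hgx : aeval x g ≠ 0 := fun h => hg (hx g h)
  have hE : E2 t ŝ (toL x G) = C (algebraMap L F (aeval x g)) * t ^ ρ * C c := by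
    have := congrArg ι hG
    rw [hom_kap, hP, E3_toL, map_mul, map_mul, map_pow, hr1, ← Polynomial.aeval_algHom_apply,
      ← Polynomial.aeval_algHom_apply, hP, Polynomial.aeval_algebraMap_apply] at this
    rw [← this]; rfl
  set G0 := G.map (evalRingHom (0 : k[X])) with hG0
  have hG0ne : G0 ≠ 0 := by
    intro h0
    have h0' := h0
    have h3 : (evalRingHom (0 : k[X])) = evalRingHom (C (0 : k)) := by simp
    rw [hG0, h3] at h0
    rw [← C_dvd_iff_map, C_0, C_0, sub_zero] at h0
    obtain ⟨G', hG'⟩ := h0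
    rcases Nat.eq_zero_or_pos ρ with h | h
    · rw [h, pow_zero, mul_one, hG', map_mul, map_mul] at hE
      have h4 : t ∣ C (algebraMap L F (aeval x g)) * C c := by
        rw [← hE]
        refine dvd_mul_of_dvd_left ?_ _
        simp [toL]
      have h5 : IsUnit t := by
        apply isUnit_of_dvd_unit h4
        rw [← C_mul, isUnit_C]
        apply isUnit_iff_ne_zero.2
        exact mul_ne_zero (by simpa using hgx) hc0
      exact hd (natDegree_eq_zero_of_isUnit h5)
    · refine Nat.find_min hex (m := ρ - 1) (by omega) ⟨g, G', hg, ?_⟩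
      rw [hG', map_mul, kap_CX, map_mul, eta_X0] at hG
      apply mul_left_cancel₀ (tR_ne (k := k))
      rw [← hG]
      obtain ⟨m, hm⟩ : ∃ m, ρ = m + 1 := ⟨ρ - 1, by omega⟩
      rw [hm, Nat.add_sub_cancel]; ring
  let T1 : L[X][X] := C (C (aeval x g)⁻¹) * toL x G
  have hT1 : E2 t ŝ T1 = C c * t ^ ρ := by
    simp only [T1, map_mul, hE, E2_C, aeval_C]
    have : algebraMap L F[X] (aeval x g)⁻¹ = C (algebraMap L F (aeval x g)⁻¹) := rfl
    rw [this, ← mul_assoc, ← mul_assoc, ← C_mul, ← map_mul, inv_mul_cancel₀ hgx]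
    simp; ring
  have hT0 : E2 (0 : L[X]) X T1 = C (aeval x g)⁻¹ * (G0.map (algebraMap k[X] (RatFunc k))).map f := by
    rw [Polynomial.map_map, hfc, map_mul, toL_eval0]
    simp [hG0]
  have hinjK : Function.Injective (algebraMap k[X] (RatFunc k)) := IsFractionRing.injective _ _
  have hG0K : G0.map (algebraMap k[X] (RatFunc k)) ≠ 0 := (Polynomial.map_ne_zero_iff hinjK).2 hG0ne
  have hCne : (C (aeval x g)⁻¹ : L[X]) ≠ 0 := C_ne_zero.2 (inv_ne_zero hgx)
  have hT0ne : E2 (0 : L[X]) X T1 ≠ 0 := by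
    rw [hT0]
    exact mul_ne_zero hCne ((Polynomial.map_ne_zero_iff f.injective).2 hG0K)
  refine thmU D1 hD1deg t ŝ hd1 hJ hJt T1 ρ c hcL hT1 hT0ne ?_
  intro π hπ hπt
  obtain ⟨a, ha, hπa⟩ := dvd_sub_root p1 hp10 ŝ π hπ (by rw [hpw]; exact hπt.mul_right _)
  refine ⟨a, hπa, ?_⟩
  have h3 := rootMult_bound f _ _ hirr hsep hG0K a (by rw [← hp1f]; exact ha)
  have h4 : rootMultiplicity a (E2 (0 : L[X]) X T1) =
      rootMultiplicity a ((G0.map (algebraMap k[X] (RatFunc k))).map f) := by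
    rw [hT0, rootMultiplicity_mul (by rw [← hT0]; exact hT0ne), rootMultiplicity_C, zero_add]
  rw [h4]
  have h5 : natDegree (G0.map (algebraMap k[X] (RatFunc k))) ≤ T1.natDegree := by
    rw [← natDegree_map_eq_of_injective f.injective]
    have : natDegree ((G0.map (algebraMap k[X] (RatFunc k))).map f) =
        natDegree (E2 (0 : L[X]) X T1) := by
      rw [hT0, natDegree_C_mul (inv_ne_zero hgx)]
    rw [this, E2_zero_X]
    exact natDegree_map_le
  rw [natDegree_map_eq_of_injective hinjK] at h3
  refine le_trans ?_ (h3.trans h5)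
  exact Nat.mul_le_mul_right _ h2
end

end Polynomial
end

end

section
section
namespace Polynomial
open SLP

variable {k : Type*} [Field k]

theorem mem_IH_of_dvd {b : B3 k} (h : tR ∣ etaStar k b) : b ∈ IH k := by
  obtain ⟨N, p, hp⟩ := red_IH b
  have h1 := chi_eta hp
  obtain ⟨r, hr⟩ := h
  rw [hr, map_mul, chi_t, zero_mul, mul_zero] at h1
  have h2 : p = 0 := by
    apply IsFractionRing.injective k[X] (RatFunc k)
    rw [map_zero]; exact h1.symm
  rw [← mH_eq_zero, hp, h2, map_zero, mul_zero]

theorem E3_C {D : Type*} [CommRing D] [Algebra k D] (q τ σ : D) (G : k[X][X]) :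
    E3 (k := k) q τ σ (C G) = E2 q τ G := by
  simp [E3, E2]

theorem E3_map {F : Type*} [CommRing F] [Algebra k F] (q c : F) (G : W3 k) :
    E3 (C q) (C c) X G = G.map (E2 (L := k) q c) := by
  have : E3 (k := k) (C q) (C c) X = mapRingHom (E2 (L := k) q c) := by
    apply W3_hom_ext <;> simp
  exact RingHom.congr_fun this G

theorem const_mem {Q s : B3 k} (h : Good Q s) {F : Type*} [Field F] [Algebra k F] (q c : F)
    (hqc : Function.Injective (E2 (L := k) q c)) (hc : c ≠ 0) (e : SL2Ring k →ₐ[k] F[X])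
    (heQ : e (etaStar k Q) = C q) (het : e tR = C c) (hes : e (etaStar k s) = X)
    (r : SL2Ring k) (hr : natDegree (e r) = 0) :
    ∃ G0 : k[X][X], r = etaStar k (kap Q s (C G0)) := by
  classical
  have hex : ∃ n : ℕ, ∃ G : W3 k, tR ^ n * r = etaStar k (kap Q s G) := h.satR r
  obtain ⟨G, hG⟩ := Nat.find_spec hex
  set n := Nat.find hex with hn
  have hG0 : G.natDegree = 0 := by
    have := congrArg (fun r => natDegree (e r)) hG
    simp only [hom_kap, heQ, het, hes, E3_map, map_mul, map_pow] at this
    rw [natDegree_map_eq_of_injective hqc, ← C_pow, natDegree_C_mul (pow_ne_zero _ hc), hr] at this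
    exact this.symm
  obtain ⟨G0, rfl⟩ : ∃ G0, G = C G0 := ⟨_, eq_C_of_natDegree_eq_zero hG0⟩
  rcases Nat.eq_zero_or_pos n with h0 | h0
  · rw [h0, pow_zero, one_mul] at hG
    exact ⟨G0, hG⟩
  · exfalso
    obtain ⟨m, hm⟩ : ∃ m, n = m + 1 := ⟨n - 1, by omega⟩
    have h1 : kap Q s (C G0) = MvPolynomial.X 0 * kap Q s (C (divX G0)) + aeval Q (G0.coeff 0) := by
      conv_lhs => rw [← X_mul_divX_add G0]
      rw [C_add, C_mul, map_add, map_mul, kap_CX, kap_CC]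
    rw [h1, map_add, map_mul, eta_X0, hm, pow_succ] at hG
    have h2 : tR ∣ etaStar k (aeval Q (G0.coeff 0)) :=
      ⟨tR ^ m * r - etaStar k (kap Q s (C (divX G0))), by linear_combination -hG⟩
    have h3 := h.tr _ (mem_IH_of_dvd h2)
    rw [h3, map_zero, map_zero, add_zero] at hG
    refine Nat.find_min hex (m := m) (by omega) ⟨C (divX G0), ?_⟩
    apply mul_left_cancel₀ (tR_ne (k := k))
    rw [← hG]; ring

theorem good_inj {Q s : B3 k} (h : Good Q s) {F : Type*} [Field F] [Algebra k F] (q c : F)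
    (hqc : Function.Injective (E2 (L := k) q c)) (e : SL2Ring k →ₐ[k] F[X])
    (heQ : e (etaStar k Q) = C q) (het : e tR = C c) (hes : e (etaStar k s) = X)
    (r : SL2Ring k) (hr : e r = 0) : r = 0 := by
  obtain ⟨n, G, hG⟩ := h.satR r
  have := congrArg e hG
  rw [map_mul, hr, mul_zero, hom_kap, heQ, het, hes, E3_map] at this
  have h0 : G = 0 := Polynomial.map_injective _ hqc (by rw [← this, Polynomial.map_zero])
  rw [h0, map_zero, map_zero] at hG
  exact (mul_eq_zero.1 hG).resolve_left (pow_ne_zero _ tR_ne)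

theorem hom_E2 {D : Type*} [CommRing D] [Algebra k D] (f : SL2Ring k →ₐ[k] D) (P s : B3 k)
    (G : k[X][X]) :
    f (etaStar k (kap P s (C G))) = E2 (f (etaStar k P)) (f tR) G := by
  rw [hom_kap, E3_C]

theorem E2_comp_poly {F : Type*} [CommRing F] [Algebra k F] (q : F) (σ : F[X]) (G : k[X][X]) :
    E2 (C q) σ G = (G.map (aeval q : k[X] →ₐ[k] F).toRingHom).comp σ := by
  have : E2 (L := k) (C q) σ = (compRingHom σ).comp (mapRingHom (aeval q : k[X] →ₐ[k] F).toRingHom) := by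
    apply ev2_hom_ext
    · intro r; simp
    · simp
    · simp
  exact RingHom.congr_fun this G

theorem E2_inj {L : Type*} [Field L] [Algebra k L] (x : L) (hx : ∀ g : k[X], aeval x g = 0 → g = 0) :
    Function.Injective (E2 (L := k) (algebraMap L (RatFunc L) x) (RatFunc.X : RatFunc L)) := by
  have h1 : E2 (L := k) (algebraMap L (RatFunc L) x) (RatFunc.X : RatFunc L) =
      (algebraMap L[X] (RatFunc L)).comp (mapRingHom (aeval x : k[X] →ₐ[k] L).toRingHom) := by
    apply ev2_hom_ext
    · intro r
      simp
      rfl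
    · simp
    · simp
  rw [h1]
  apply (IsFractionRing.injective L[X] (RatFunc L)).comp
  apply Polynomial.map_injective
  rw [injective_iff_map_eq_zero]
  exact hx

theorem typeII_concl {P Q sP sQ s : B3 k} (gP : Good P sP) (gQ : Good Q sQ)
    (h1b : ∃ g : k[X], g ≠ 0 ∧ ∃ a, aeval P g - hyp P * a ∈ IH k)
    (hsat : SatP P s) {Γ : k[X][X]} (hΓ : ev2 (evc 0 P) (evc 0 s) Γ = 0)
    (hirr : Irreducible (Γ.map (algebraMap k[X] (RatFunc k))))
    (hsep : (Γ.map (algebraMap k[X] (RatFunc k))).Separable) (h2 : 2 ≤ Γ.natDegree)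
    (Φ : SL2Ring k ≃ₐ[k] SL2Ring k) (ε : k) (hε : ε ≠ 0)
    (hΦ : Φ (etaStar k P) = algebraMap k _ ε * etaStar k Q) :
    ∃ γ : k, γ ≠ 0 ∧ Φ tR = algebraMap k _ γ * tR := by
  let L := AlgebraicClosure (RatFunc k)
  let F := RatFunc L
  let x : L := algebraMap (RatFunc k) L (algebraMap k[X] (RatFunc k) X)
  have hx : ∀ g : k[X], aeval x g = 0 → g = 0 := by
    intro g hg
    rw [Polynomial.aeval_algebraMap_apply, ktoF_aeval] at hg
    apply IsFractionRing.injective k[X] (RatFunc k)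
    rw [map_zero]
    exact (algebraMap (RatFunc k) L).injective (by rw [hg, map_zero])
  let x' : L := algebraMap k L ε⁻¹ * x
  have hxx' : algebraMap k L ε * x' = x := by
    simp only [x']
    rw [← mul_assoc, ← map_mul, mul_inv_cancel₀ hε, map_one, one_mul]
  have hx' : ∀ g : k[X], aeval x' g = 0 → g = 0 := by
    intro g hg
    have h1 : aeval x' g = aeval x (g.comp (C ε⁻¹ * X)) := by
      rw [aeval_comp]; simp [x']
    rw [h1] at hg
    have h3 := hx _ hg
    have h4 : (g.comp (C ε⁻¹ * X)).comp (C ε * X) = g := by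
      rw [comp_assoc]
      have : (C ε⁻¹ * X : k[X]).comp (C ε * X) = X := by
        rw [mul_comp, C_comp, X_comp, ← mul_assoc, ← C_mul, inv_mul_cancel₀ hε, C_1, one_mul]
      rw [this, comp_X]
    rw [← h4, h3, zero_comp]
  let c : F := RatFunc.X
  have hc0 : c ≠ 0 := RatFunc.X_ne_zero
  have hinj := E2_inj x hx
  have hinj' := E2_inj x' hx'
  have hcu : IsUnit (C c : F[X]) := isUnit_C.2 (isUnit_iff_ne_zero.2 hc0)
  -- derivation
  obtain ⟨d, hd⟩ := ext_der (L := L) (A := L[X]) (M := F) (derivative' : Derivation L L[X] L[X])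
  have hdc : d c = 1 := by
    have := hd X
    rw [RatFunc.algebraMap_X] at this
    simpa using this
  -- the lift for Q
  obtain ⟨e, heQ, het, hes⟩ := lift_good gQ (D := F[X]) (C (algebraMap L F x')) (C c) X hcu
  let ι : SL2Ring k →ₐ[k] F[X] := e.comp Φ.toAlgHom
  have hι : ∀ r, ι r = e (Φ r) := fun _ => rfl
  have hιP : ι (etaStar k P) = algebraMap L F[X] x := by
    rw [hι, hΦ, map_mul, heQ, AlgHom.commutes]
    have h3 : algebraMap L F[X] x = algebraMap L F[X] (algebraMap k L ε) * algebraMap L F[X] x' := by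
      rw [← map_mul, hxx']
    rw [h3, ← IsScalarTower.algebraMap_apply k L F[X]]
    rfl
  have hdeg : natDegree (ι tR) = 0 := by
    apply U_app h1b hsat hΓ hirr hsep h2 x hx d c hdc ι hιP (Φ.symm tR) (Φ.symm (etaStar k sQ))
    · rw [hι, AlgEquiv.apply_symm_apply, het]
    · rw [hι, AlgEquiv.apply_symm_apply, hes]
    · intro h0
      have h3 := good_inj gQ _ c hinj' e heQ het hes (Φ tR) h0
      rw [EmbeddingLike.map_eq_zero_iff] at h3
      exact tR_ne h3
  obtain ⟨G0, hG0⟩ := const_mem gQ _ c hinj' hc0 e heQ het hes (Φ tR) hdeg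
  -- the inverse
  have hΦs : Φ.symm (etaStar k Q) = algebraMap k _ ε⁻¹ * etaStar k P := by
    rw [AlgEquiv.symm_apply_eq, map_mul, hΦ, AlgEquiv.commutes, ← mul_assoc, ← map_mul,
      inv_mul_cancel₀ hε, map_one, one_mul]
  have ht : tR = E2 (algebraMap k _ ε⁻¹ * etaStar k P) (Φ.symm tR) G0 := by
    have := congrArg Φ.symm hG0
    rw [AlgEquiv.symm_apply_apply] at this
    rw [← hΦs]
    conv_lhs => rw [this]
    exact hom_E2 Φ.symm.toAlgHom Q sQ G0
  obtain ⟨e1, he1P, he1t, he1s⟩ := lift_good gP (D := F[X]) (C (algebraMap L F x)) (C c) X hcu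
  have hdeg1 : natDegree (e1 (Φ.symm tR)) = 0 := by
    by_contra hne
    have h3 := congrArg e1 ht
    rw [E2_comp_hom, map_mul, AlgHom.commutes, he1t, he1P] at h3
    have h4 : algebraMap k F[X] ε⁻¹ * C (algebraMap L F x) = C (algebraMap L F x') := by
      simp only [x', map_mul, ← IsScalarTower.algebraMap_apply]
      rfl
    rw [h4, E2_comp_poly] at h3
    have h5 := congrArg natDegree h3
    rw [natDegree_C, natDegree_comp] at h5
    have h6 := (mul_eq_zero.1 h5.symm).resolve_right hne
    have hxF : Function.Injective (aeval (algebraMap L F x') : k[X] →ₐ[k] F).toRingHom := by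
      rw [injective_iff_map_eq_zero]
      intro g hg
      apply hx'
      have : aeval (algebraMap L F x') g = 0 := hg
      rw [Polynomial.aeval_algebraMap_apply] at this
      exact (algebraMap L F).injective (by rw [this, map_zero])
    rw [natDegree_map_eq_of_injective hxF] at h6
    rw [eq_C_of_natDegree_eq_zero h6, map_C, C_comp] at h3
    have h7 := C_injective h3
    have h8 : E2 (L := k) (algebraMap L F x') c X = E2 (algebraMap L F x') c (C (G0.coeff 0)) := by
      rw [E2_X, E2_C, h7]; rfl
    have h9 := congrArg natDegree (hinj' h8)
    rw [natDegree_X, natDegree_C] at h9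
    exact one_ne_zero h9
  obtain ⟨G1, hG1⟩ := const_mem gP _ c hinj hc0 e1 he1P he1t he1s (Φ.symm tR) hdeg1
  -- composition
  have hcomp : (X : k[X][X]) = (G1.map (aeval (C ε * X) : k[X] →ₐ[k] k[X]).toRingHom).comp G0 := by
    rw [← E2_comp_poly]
    apply C_injective (R := k[X][X])
    apply gQ.inj
    apply eta_inj
    have h3 := congrArg Φ hG1
    rw [AlgEquiv.apply_symm_apply] at h3
    rw [kap_CX, eta_X0]
    conv_lhs => rw [h3]
    have h4 := hom_E2 Φ.toAlgHom P sP G1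
    have h5 : Φ.toAlgHom (etaStar k P) = algebraMap k _ ε * etaStar k Q := hΦ
    have h6 : Φ.toAlgHom tR = etaStar k (kap Q sQ (C G0)) := hG0
    rw [h5, h6] at h4
    refine h4.trans ?_
    let f : k[X][X] →ₐ[k] SL2Ring k :=
      { ((etaStar k).toRingHom.comp (kap Q sQ)).comp C with
        commutes' := by
          intro r
          show etaStar k (kap Q sQ (C (C (C r)))) = _
          rw [kap_CC]; simp }
    have hf : ∀ G, f G = etaStar k (kap Q sQ (C G)) := fun _ => rfl
    rw [← hf, ← hf, E2_comp_hom]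
    congr 2
    rw [hf, kap_CC]
    simp
  have hdg := congrArg natDegree hcomp
  rw [natDegree_X, natDegree_comp] at hdg
  obtain ⟨ha, hb⟩ : natDegree (G1.map (aeval (C ε * X) : k[X] →ₐ[k] k[X]).toRingHom) = 1 ∧
    natDegree G0 = 1 := by
    exact mul_eq_one.1 hdg.symm
  obtain ⟨u, hu0, v, huv⟩ := natDegree_eq_one.1 ha
  obtain ⟨g1, hg10, g0, hg⟩ := natDegree_eq_one.1 hb
  have hug : u * g1 = 1 := by
    rw [← huv, ← hg] at hcomp
    have := congrArg (fun p => p.coeff 1) hcomp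
    simp [coeff_C, coeff_X] at this
    exact this.symm
  obtain ⟨γ, hγu, rfl⟩ := isUnit_iff.1 (IsUnit.of_mul_eq_one_right _ hug)
  have hγ : γ ≠ 0 := hγu.ne_zero
  have hΦt : ∀ {D : Type _} [CommRing D] [Algebra k D] (f : SL2Ring k →ₐ[k] D),
      f (Φ tR) = algebraMap k D γ * f tR + aeval (f (etaStar k Q)) g0 := by
    intro D _ _ f
    rw [hG0, hom_E2, ← hg, map_add, map_mul, E2_C, E2_X, E2_C, aeval_C]
  refine ⟨γ, hγ, ?_⟩
  suffices hg0 : g0 = 0 by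
    have := hΦt (AlgHom.id k _)
    simpa [hg0] using this
  by_contra hg0
  let q : RatFunc k := algebraMap k[X] (RatFunc k) (C ε⁻¹ * X)
  have hq : aeval q g0 ≠ 0 := by
    intro h0
    have h3 : aeval q g0 = algebraMap k[X] (RatFunc k) (aeval (C ε⁻¹ * X) g0) :=
      Polynomial.aeval_algebraMap_apply _ _ _
    rw [h3] at h0
    have h4 : aeval (C ε⁻¹ * X) g0 = 0 :=
      IsFractionRing.injective k[X] (RatFunc k) (by rw [h0, map_zero])
    apply hg0
    apply hx'
    have h5 := congrArg (aeval x) h4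
    rw [← Polynomial.aeval_algHom_apply, map_zero] at h5
    simpa [x'] using h5
  have hγK : algebraMap k (RatFunc k) γ ≠ 0 := by simpa using hγ
  let τ : RatFunc k := - aeval q g0 / algebraMap k _ γ
  have hτ : IsUnit τ := isUnit_iff_ne_zero.2 (div_ne_zero (neg_ne_zero.2 hq) hγK)
  obtain ⟨e2, he2Q, he2t, -⟩ := lift_good gQ q τ (0 : RatFunc k) hτ
  let ι2 : SL2Ring k →ₐ[k] RatFunc k := e2.comp Φ.toAlgHom
  have hι2 : ∀ r, ι2 r = e2 (Φ r) := fun _ => rfl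
  have hiotaT : ι2 tR = 0 := by
    rw [hι2, hΦt e2, he2t, he2Q]
    simp only [τ]
    field_simp
    ring
  let X' : RatFunc k := algebraMap k[X] (RatFunc k) X
  have hiotaP : ι2 (etaStar k P) = algebraMap (RatFunc k) (RatFunc k) X' := by
    rw [hι2, hΦ, map_mul, AlgHom.commutes, he2Q]
    simp only [q, X', Algebra.algebraMap_self, RingHom.id_apply]
    rw [IsScalarTower.algebraMap_apply k k[X] (RatFunc k), ← map_mul]
    congr 1
    show C ε * (C ε⁻¹ * X) = X
    rw [← mul_assoc, ← C_mul, mul_inv_cancel₀ hε, C_1, one_mul]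
  obtain ⟨w, hw⟩ := gamma_eq hΓ
  have h3 := congrArg (fun b => ι2 (etaStar k b)) hw
  simp only [hom_kap, map_mul, eta_X0, hiotaT, zero_mul, hiotaP, E3_gamma] at h3
  have h4 : (aeval X' : k[X] →ₐ[k] RatFunc k).toRingHom = algebraMap k[X] (RatFunc k) := by
    refine RingHom.ext fun g => ?_
    exact ktoF_aeval g
  rw [h4] at h3
  have h5 := degree_eq_one_of_irreducible_of_root hirr
    (x := ι2 (etaStar k s)) (by rw [IsRoot, ← coe_aeval_eq_eval]; exact h3)
  have h6 : natDegree (Γ.map (algebraMap k[X] (RatFunc k))) = 1 := natDegree_eq_of_degree_eq_some h5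
  rw [natDegree_map_eq_of_injective (IsFractionRing.injective _ _)] at h6
  omega

end Polynomial
end

end

section
section
namespace Polynomial
open SLP

variable {k : Type*} [Field k]

theorem analyse [IsAlgClosed k] {P : B3 k} (hP : IsVarOverRatFunc k P)
    {φ : SL2Ring k →ₐ[k] MvPolynomial (Fin 2) k} (hφ : PlaneHom P φ) :
    ∃ sP, Good P sP ∧ (∃ g : k[X], g ≠ 0 ∧ ∃ a, aeval P g - hyp P * a ∈ IH k) ∧
      (VP P ∨ ∃ (s : B3 k) (Γ : k[X][X]), SatP P s ∧ ev2 (evc 0 P) (evc 0 s) Γ = 0 ∧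
        Irreducible (Γ.map (algebraMap k[X] (RatFunc k))) ∧
        (Γ.map (algebraMap k[X] (RatFunc k))).Separable ∧ 2 ≤ Γ.natDegree) := by
  have hP0 := isVar_ne_zero hP
  obtain ⟨h1b, htr⟩ := one_b hφ hP0 (S1 hP hφ 0)
  obtain ⟨sP, hGV, hj, hprime⟩ := stage1 hP
  have hinj : ∀ c : k, c ≠ 0 → Function.Injective (ev2 (evc c P) (evc c sP)) :=
    fun c hc => hprime c (prime_evc c hc (S1 hP hφ c) hφ hP0)
  have hmem : ∀ b : B3 k, evc 0 b = 0 → b ∈ IH k := by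
    intro b hb
    rw [← dvd_iff_evc, MvPolynomial.C_0, sub_zero] at hb
    exact Ideal.mem_of_dvd _ hb X0_mem_IH
  have htr0 : ∀ g : k[X], aeval (evc 0 P) g = 0 → g = 0 := by
    intro g hg
    rw [Polynomial.aeval_algHom_apply] at hg
    exact htr g (hmem _ hg)
  refine ⟨sP, ⟨cons2 hGV hinj, kap_inj 1 (hinj 1 one_ne_zero), htr⟩, h1b, ?_⟩
  obtain ⟨s, hsat, hdeg⟩ := stage2 hGV hinj hj htr0
  by_cases hi : Function.Injective (ev2 (evc 0 P) (evc 0 s))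
  · left
    apply cons3 hGV
    intro c
    by_cases hc : c = 0
    · subst hc
      exact hprime 0 (typeI hsat hi)
    · exact hinj c hc
  · right
    have hrel : ∃ Γ : k[X][X], Γ ≠ 0 ∧ ev2 (evc 0 P) (evc 0 s) Γ = 0 := by
      rw [injective_iff_map_eq_zero] at hi
      push Not at hi
      obtain ⟨Γ, h1, h2⟩ := hi
      exact ⟨Γ, h2, h1⟩
    have hpd : ∃ i, pderiv i (evc 0 P) ≠ 0 := by
      by_contra hcon
      push Not at hcon
      have e1 : evc 0 (pderiv 1 P) = 0 := by
        have := chain_rule (evc (0:k)) (pderiv 0) P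
        rw [hcon, Fin.sum_univ_three] at this
        simpa [pderiv_X_of_ne] using this.symm
      have e2 : evc 0 (pderiv 2 P) = 0 := by
        have := chain_rule (evc (0:k)) (pderiv 1) P
        rw [hcon, Fin.sum_univ_three] at this
        simpa [pderiv_X_of_ne] using this.symm
      have e3 : hyp P ∈ IH k := by
        apply hmem
        rw [hyp_apply, map_sub, map_mul, map_mul, e1, e2]; simp
      obtain ⟨g, hg, a, ha⟩ := h1b
      apply hg
      apply htr
      have := (IH k).add_mem ha ((IH k).mul_mem_right a e3)
      rwa [sub_add_cancel] at this
    obtain ⟨Γ, a1, a2, a3, a4⟩ := sepPoly _ _ htr0 hpd hrel hdeg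
    exact ⟨s, Γ, hsat, a1, a2, a3, a4⟩

theorem core [IsAlgClosed k] {P Q : B3 k} (hP : IsVarOverRatFunc k P) (hQ : IsVarOverRatFunc k Q)
    {φ φ' : SL2Ring k →ₐ[k] MvPolynomial (Fin 2) k} (hφ : PlaneHom P φ) (hφ' : PlaneHom Q φ')
    (Φ : SL2Ring k ≃ₐ[k] SL2Ring k) (ε : k) (hε : ε ≠ 0)
    (hΦ : Φ (etaStar k P) = algebraMap k _ ε * etaStar k Q) :
    (VP P ∧ VP Q) ∨ ∃ γ : k, γ ≠ 0 ∧ Φ tR = algebraMap k _ γ * tR := by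
  obtain ⟨sP, gP, hP1, hP2⟩ := analyse hP hφ
  obtain ⟨sQ, gQ, hQ1, hQ2⟩ := analyse hQ hφ'
  have hΦs : Φ.symm (etaStar k Q) = algebraMap k _ ε⁻¹ * etaStar k P := by
    rw [AlgEquiv.symm_apply_eq, map_mul, hΦ, AlgEquiv.commutes, ← mul_assoc, ← map_mul,
      inv_mul_cancel₀ hε, map_one, one_mul]
  rcases hP2 with hP2 | ⟨s, Γ, a1, a2, a3, a4, a5⟩
  · rcases hQ2 with hQ2 | ⟨s, Γ, a1, a2, a3, a4, a5⟩
    · exact Or.inl ⟨hP2, hQ2⟩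
    · right
      obtain ⟨γ, hγ, h⟩ := typeII_concl gQ gP hQ1 a1 a2 a3 a4 a5 Φ.symm ε⁻¹ (inv_ne_zero hε) hΦs
      refine ⟨γ⁻¹, inv_ne_zero hγ, ?_⟩
      rw [AlgEquiv.symm_apply_eq, map_mul, AlgEquiv.commutes] at h
      conv_rhs => rw [h]
      rw [← mul_assoc, ← map_mul, inv_mul_cancel₀ hγ, map_one, one_mul]
  · right
    exact typeII_concl gP gQ hP1 a1 a2 a3 a4 a5 Φ ε hε hΦ

end Polynomial
end

end

section
section
namespace SLP
variable {k : Type*} [Field k]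

/-! ### Automorphisms of `R` fixing `t` up to a scalar preserve `k[t,x,y]` -/

def ram (n : ℕ) : B3 k →ₐ[k] B3 k := aeval ![X 0 ^ n, X 1, X 2]

@[simp] theorem ram_X0 (n : ℕ) : ram n (X 0 : B3 k) = X 0 ^ n := by simp [ram]
@[simp] theorem ram_X1 (n : ℕ) : ram n (X 1 : B3 k) = X 1 := by simp [ram]
@[simp] theorem ram_X2 (n : ℕ) : ram n (X 2 : B3 k) = X 2 := by simp [ram]

theorem evc_ram {n : ℕ} (hn : n ≠ 0) (b : B3 k) : evc 0 (ram n b) = evc 0 b := by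
  have : (evc 0).comp (ram n) = evc (0 : k) := by
    apply algHomB_ext <;> simp [hn]
  exact congrArg (fun h : B3 k →ₐ[k] _ => h b) this

theorem exists_val (b : B3 k) : ∃ (w : ℕ) (c : B3 k), b = X 0 ^ w * c ∧ (b ≠ 0 → evc 0 c ≠ 0) := by
  by_cases hb : b = 0
  · exact ⟨0, 0, by simp [hb], fun h => absurd hb h⟩
  have hp : Prime (X 0 : B3 k) := MvPolynomial.X_prime
  have hf : FiniteMultiplicity (X 0 : B3 k) b := FiniteMultiplicity.of_not_isUnit hp.not_isUnit hb
  obtain ⟨c, h1, h2⟩ := hf.exists_eq_pow_mul_and_not_dvd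
  refine ⟨_, c, h1, fun _ h0 => h2 ?_⟩
  have := (dvd_iff_evc 0 c).2 h0
  simpa using this

theorem ramify (f : Fin 2 → Polynomial (B3 k)) (hf : ∃ j i, i ≠ 0 ∧ (f j).coeff i ≠ 0) :
    ∃ (n m : ℕ) (g : Fin 2 → Polynomial (B3 k)), n ≠ 0 ∧
      (∀ j, (f j).map (ram n).toRingHom
        = (g j).comp (Polynomial.C (X 0 ^ m) * Polynomial.X)) ∧
      ∃ j i, i ≠ 0 ∧ evc 0 ((g j).coeff i) ≠ 0 := by
  classical
  choose w c hwc hc using exists_val (k := k)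
  let S : Finset (Fin 2 × ℕ) :=
    (Finset.univ ×ˢ (Finset.range ((f 0).natDegree + (f 1).natDegree + 1))).filter
      (fun p => p.2 ≠ 0 ∧ (f p.1).coeff p.2 ≠ 0)
  have hlt : ∀ j i, (f j).coeff i ≠ 0 → i < (f 0).natDegree + (f 1).natDegree + 1 := by
    intro j i h
    have := Polynomial.le_natDegree_of_ne_zero h
    fin_cases j
    · simp only [Fin.zero_eta] at this; omega
    · simp only [Fin.mk_one] at this; omega
  have hS : ∀ j i, i ≠ 0 → (f j).coeff i ≠ 0 → (j, i) ∈ S := by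
    intro j i hi h
    simp only [S, Finset.mem_filter, Finset.mem_product, Finset.mem_univ, true_and,
      Finset.mem_range]
    exact ⟨hlt j i h, hi, h⟩
  have hne : S.Nonempty := by
    obtain ⟨j, i, hi, h⟩ := hf
    exact ⟨(j, i), hS j i hi h⟩
  obtain ⟨⟨j0, i0⟩, h0, hmin⟩ := S.exists_min_image
    (fun p => (w ((f p.1).coeff p.2) : ℚ) / (p.2 : ℚ)) hne
  have h0' : i0 ≠ 0 ∧ (f j0).coeff i0 ≠ 0 := by
    simpa using (Finset.mem_filter.1 h0).2
  obtain ⟨hi0, hb0⟩ := h0'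
  set w0 := w ((f j0).coeff i0) with hw0
  have key : ∀ j i, (f j).coeff i ≠ 0 → w0 * i ≤ i0 * w ((f j).coeff i) := by
    intro j i h
    by_cases hi : i = 0
    · simp [hi]
    have h1 := hmin (j, i) (hS j i hi h)
    simp only at h1
    rw [div_le_div_iff₀ (by positivity) (by positivity)] at h1
    have h2 : w0 * i ≤ w ((f j).coeff i) * i0 := by exact_mod_cast h1
    rw [mul_comm i0]; exact h2
  let cf : Fin 2 → ℕ → B3 k := fun j i => if (f j).coeff i = 0 then 0 else
    X 0 ^ (i0 * w ((f j).coeff i) - w0 * i) * ram i0 (c ((f j).coeff i))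
  let g : Fin 2 → Polynomial (B3 k) := fun j =>
    ∑ i ∈ Finset.range ((f 0).natDegree + (f 1).natDegree + 1), Polynomial.monomial i (cf j i)
  have hg : ∀ j i, (g j).coeff i = cf j i := by
    intro j i
    simp only [g, Polynomial.finsetSum_coeff, Polynomial.coeff_monomial, Finset.sum_ite_eq',
      Finset.mem_range]
    split_ifs with h
    · rfl
    · by_cases h2 : (f j).coeff i = 0
      · simp [cf, h2]
      · exact absurd (hlt j i h2) h
  refine ⟨i0, w0, g, hi0, ?_, j0, i0, hi0, ?_⟩
  · intro j
    ext1 i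
    rw [Polynomial.coeff_map, Polynomial.comp_C_mul_X_coeff, hg]
    simp only [cf]
    split_ifs with h
    · simp [h]
    · have h1 := key j i h
      have h2 := congrArg (ram i0) (hwc ((f j).coeff i))
      rw [map_mul, map_pow, ram_X0] at h2
      show ram i0 ((f j).coeff i) = _
      conv_lhs => rw [h2]
      rw [mul_right_comm, ← pow_mul, ← pow_mul, ← pow_add, Nat.sub_add_cancel h1]
  · rw [hg]
    simp only [cf, if_neg hb0, ← hw0, mul_comm i0 w0, Nat.sub_self, pow_zero, one_mul]
    rw [evc_ram hi0]
    exact hc _ hb0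

theorem scale_inj {A : Type*} [CommRing A] [IsDomain A] {a : A} (ha : a ≠ 0) :
    Function.Injective (fun f : Polynomial A => f.comp (Polynomial.C a * Polynomial.X)) := by
  intro f g h
  ext1 i
  have := congrArg (fun q => Polynomial.coeff q i) h
  simp only [Polynomial.comp_C_mul_X_coeff] at this
  exact mul_right_cancel₀ (pow_ne_zero _ ha) this

theorem lemA (δ : B3 k →ₐ[k] Polynomial (B3 k)) (h0 : δ (X 0) = Polynomial.C (X 0))
    (h1 : (δ (X 1)).coeff 0 = X 1) (h2 : (δ (X 2)).coeff 0 = X 2) (v : B3 k)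
    (hv : δ v = Polynomial.C v) (hv0 : evc 0 v ≠ 0) (hvd : X 0 * X 1 - 1 ∣ evc 0 v) (i : ℕ)
    (hi : i ≠ 0) : (δ (X 1)).coeff i = 0 ∧ (δ (X 2)).coeff i = 0 := by
  by_contra hcon
  obtain ⟨n, m, g, hn, hg, j, i', hi', hne⟩ := ramify ![δ (X 1), δ (X 2)] (by
    by_cases h : (δ (X 1)).coeff i = 0
    · exact ⟨1, i, hi, fun h' => hcon ⟨h, h'⟩⟩
    · exact ⟨0, i, hi, h⟩)
  have hg0 := hg 0
  have hg1 := hg 1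
  simp only [Matrix.cons_val_zero, Matrix.cons_val_one] at hg0 hg1
  have hX : (X 0 ^ m : B3 k) ≠ 0 := pow_ne_zero _ (X_ne_zero 0)
  -- the ramified exponential map
  let δ' : B3 k →ₐ[k] Polynomial (B3 k) := aeval ![Polynomial.C (X 0), g 0, g 1]
  have hδ' : ∀ b, (δ b).map (ram n).toRingHom =
      (δ' (ram n b)).comp (Polynomial.C (X 0 ^ m) * Polynomial.X) := by
    intro b
    have : (Polynomial.mapAlgHom (ram n)).comp δ =
        ((Polynomial.aeval (Polynomial.C (X 0 ^ m : B3 k) * Polynomial.X) :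
          Polynomial (B3 k) →ₐ[B3 k] Polynomial (B3 k)).restrictScalars k).comp
          (δ'.comp (ram n)) := by
      apply algHomB_ext
      · simp [h0, δ']
      · have : δ' (X 1) = g 0 := by simp [δ']
        simp only [AlgHom.comp_apply, ram_X1, this, Polynomial.coe_mapAlgHom]
        exact hg0
      · have : δ' (X 2) = g 1 := by simp [δ']
        simp only [AlgHom.comp_apply, ram_X2, this, Polynomial.coe_mapAlgHom]
        exact hg1
    exact congrArg (fun h : B3 k →ₐ[k] _ => h b) this
  have hv' : δ' (ram n v) = Polynomial.C (ram n v) := by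
    apply scale_inj hX
    simp only
    rw [← hδ', hv]
    simp
  -- reduce modulo `t`
  let ξ := (g 0).map (evc (0 : k)).toRingHom
  let ζ := (g 1).map (evc (0 : k)).toRingHom
  let δb : MvPolynomial (Fin 2) k →ₐ[k] Polynomial (MvPolynomial (Fin 2) k) := aeval ![ξ, ζ]
  have hδb : ∀ b, (δ' b).map (evc (0 : k)).toRingHom = δb (evc 0 b) := by
    intro b
    have : (Polynomial.mapAlgHom (evc (0 : k))).comp δ' = δb.comp (evc 0) := by
      apply algHomB_ext
      · simp [δ', δb]
      · simp only [AlgHom.comp_apply, evc_X1, Polynomial.coe_mapAlgHom, δ', δb, aeval_X]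
        rfl
      · simp only [AlgHom.comp_apply, evc_X2, Polynomial.coe_mapAlgHom, δ', δb, aeval_X]
        rfl
    exact congrArg (fun h : B3 k →ₐ[k] _ => h b) this
  have h3 := hδb (ram n v)
  rw [hv', evc_ram hn, Polynomial.map_C] at h3
  have h3' : δb (evc 0 v) = Polynomial.C (evc 0 v) := by
    rw [← h3]
    show Polynomial.C (evc 0 (ram n v)) = _
    rw [evc_ram hn]
  obtain ⟨h, hh⟩ := hvd
  have h4 : δb (evc 0 v) = (ξ * ζ - 1) * δb h := by
    rw [hh]; simp [δb]
  have h5 : (ξ * ζ - 1) * δb h ≠ 0 := by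
    rw [← h4, h3']; simpa using hv0
  have h6 : (ξ * ζ - 1).natDegree = 0 := by
    have := congrArg Polynomial.natDegree (h4.symm.trans h3')
    rw [Polynomial.natDegree_C, Polynomial.natDegree_mul (left_ne_zero_of_mul h5)
      (right_ne_zero_of_mul h5)] at this
    omega
  have hξ0 : ξ.coeff 0 = X 0 := by
    have := congrArg (fun q => Polynomial.coeff q 0) hg0
    simp only [Polynomial.coeff_map, Polynomial.comp_C_mul_X_coeff, pow_zero, mul_one, h1] at this
    simp only [ξ, Polynomial.coeff_map, ← this]
    show evc 0 (ram n (X 1)) = _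
    simp
  have hζ0 : ζ.coeff 0 = X 1 := by
    have := congrArg (fun q => Polynomial.coeff q 0) hg1
    simp only [Polynomial.coeff_map, Polynomial.comp_C_mul_X_coeff, pow_zero, mul_one, h2] at this
    simp only [ζ, Polynomial.coeff_map, ← this]
    show evc 0 (ram n (X 2)) = _
    simp
  have hξ : ξ ≠ 0 := by intro h; rw [h] at hξ0; exact X_ne_zero _ hξ0.symm
  have hζ : ζ ≠ 0 := by intro h; rw [h] at hζ0; exact X_ne_zero _ hζ0.symm
  have h7 : (ξ * ζ).natDegree = 0 := by
    have : ξ * ζ = (ξ * ζ - 1) + 1 := by ring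
    rw [this]
    have := Polynomial.natDegree_add_le (ξ * ζ - 1) 1
    simp only [h6, Polynomial.natDegree_one, max_self] at this
    omega
  rw [Polynomial.natDegree_mul hξ hζ] at h7
  apply hne
  fin_cases j
  · have : ξ.coeff i' = 0 := Polynomial.coeff_eq_zero_of_natDegree_lt (by omega)
    simpa [ξ, Polynomial.coeff_map] using this
  · have : ζ.coeff i' = 0 := Polynomial.coeff_eq_zero_of_natDegree_lt (by omega)
    simpa [ζ, Polynomial.coeff_map] using this

theorem exists_scale (f : Polynomial (SL2Ring k)) : ∃ M, ∀ M' ≥ M, ∃ g : Polynomial (B3 k),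
    g.map (etaStar k).toRingHom =
      f.comp (Polynomial.C (tR ^ M') * Polynomial.X) - Polynomial.C (f.coeff 0) := by
  choose N b hb using exists_t_pow (k := k)
  refine ⟨∑ i ∈ Finset.range (f.natDegree + 1), N (f.coeff i), fun M' hM' => ?_⟩
  refine ⟨∑ i ∈ Finset.range (f.natDegree + 1), if i = 0 then 0 else
    Polynomial.monomial i (X 0 ^ (M' * i - N (f.coeff i)) * b (f.coeff i)), ?_⟩
  ext1 i
  have hcoe : ∀ b, (etaStar k).toRingHom b = etaStar k b := fun _ => rfl
  rw [Polynomial.coeff_map, Polynomial.coeff_sub, Polynomial.comp_C_mul_X_coeff,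
    Polynomial.finsetSum_coeff, Polynomial.coeff_C, hcoe]
  by_cases hi : i = 0
  · subst hi
    rw [Finset.sum_eq_zero]
    · simp
    · intro j _
      split_ifs with hj
      · simp
      · simp [Polynomial.coeff_monomial, hj]
  by_cases hi2 : i ∈ Finset.range (f.natDegree + 1)
  · rw [Finset.sum_eq_single i]
    · rw [if_neg hi, if_neg hi, Polynomial.coeff_monomial, if_pos rfl, map_mul, map_pow, eta_X0, ← hb,
        ← mul_assoc, ← pow_add, Nat.sub_add_cancel, ← pow_mul, sub_zero, mul_comm]
      have : N (f.coeff i) ≤ ∑ i ∈ Finset.range (f.natDegree + 1), N (f.coeff i) :=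
        Finset.single_le_sum (f := fun i => N (f.coeff i)) (fun _ _ => Nat.zero_le _) hi2
      have : 1 ≤ i := by omega
      nlinarith
    · intro j _ hj
      split_ifs
      · simp
      · simp [Polynomial.coeff_monomial, hj]
    · exact fun h => absurd hi2 h
  · rw [Finset.sum_eq_zero, if_neg hi, Polynomial.coeff_eq_zero_of_natDegree_lt]
    · simp
    · simp at hi2; omega
    · intro j hj
      have : j ≠ i := by rintro rfl; exact hi2 hj
      split_ifs
      · simp
      · simp [Polynomial.coeff_monomial, this]

theorem S6x (Φ : SL2Ring k ≃ₐ[k] SL2Ring k) (α : k) (hα : α ≠ 0)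
    (ht : Φ tR = algebraMap k _ α * tR) : ∃ b, Φ xR = etaStar k b := by
  classical
  have hex : ∃ N b, tR ^ N * Φ xR = etaStar k b := exists_t_pow _
  obtain ⟨v, hv⟩ := Nat.find_spec hex
  by_cases hN : Nat.find hex = 0
  · exact ⟨v, by rw [← hv, hN, pow_zero, one_mul]⟩
  exfalso
  have hαt : algebraMap k (SL2Ring k) α * tR ≠ 0 :=
    mul_ne_zero (by simpa using hα) tR_ne
  -- `v` is in the ideal `IH` and is not divisible by `t`
  have hvI : v ∈ IH k := Polynomial.mem_IH_of_dvd (by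
    rw [← hv]; exact Dvd.dvd.mul_right (dvd_pow_self _ hN) _)
  have hv0 : evc 0 v ≠ 0 := by
    intro h0
    obtain ⟨c, hc⟩ := (dvd_iff_evc 0 v).2 h0
    apply Nat.find_min hex (m := Nat.find hex - 1) (by omega)
    refine ⟨c, mul_left_cancel₀ (tR_ne (k := k)) ?_⟩
    rw [← mul_assoc, ← pow_succ', Nat.sub_add_cancel (by omega), hv, hc]
    simp
  have hvd : X 0 * X 1 - 1 ∣ evc 0 v := by
    obtain ⟨a, c, rfl⟩ := Ideal.mem_span_pair.1 hvI
    exact ⟨evc 0 c, by simp; ring⟩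
  -- the exponential map
  let e : SL2Ring k →ₐ[k] Polynomial (SL2Ring k) :=
    liftA (Polynomial.C (Φ tR)) (Polynomial.C (Φ uR) + Polynomial.C (Φ xR) * Polynomial.X)
      (Polynomial.C (Φ xR)) (Polynomial.C (Φ yR) + Polynomial.C (Φ tR) * Polynomial.X) (by
        have : Polynomial.C (Φ xR) * Polynomial.C (Φ yR) =
            Polynomial.C (Φ tR) * Polynomial.C (Φ uR) + 1 := by
          rw [← Polynomial.C_mul, ← map_mul, rel_R]; simp
        linear_combination this)
  let δ : SL2Ring k →ₐ[k] Polynomial (SL2Ring k) := e.comp Φ.symm.toAlgHom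
  have hδ : ∀ r, δ (Φ r) = e r := by intro r; simp [δ]
  have hδt : δ tR = Polynomial.C tR := by
    have h1 := hδ tR
    rw [ht, map_mul, AlgHom.commutes] at h1
    have h2 : e tR = algebraMap k _ α * Polynomial.C tR := by
      simp only [e, liftA_t, ht, Polynomial.C_mul]; rfl
    rw [h2] at h1
    exact mul_left_cancel₀ (by simpa using hα) h1
  have hδ0 : ∀ r, (δ r).coeff 0 = r := by
    intro r
    obtain ⟨r, rfl⟩ := Φ.surjective r
    rw [hδ]
    have : ((Polynomial.aeval (0 : SL2Ring k) :
        Polynomial (SL2Ring k) →ₐ[SL2Ring k] _).restrictScalars k).comp e = Φ.toAlgHom := by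
      apply homA_ext <;> simp [e]
    have := congrArg (fun h : SL2Ring k →ₐ[k] SL2Ring k => h r) this
    rw [Polynomial.coeff_zero_eq_eval_zero]
    simpa using this
  have hδv : δ (etaStar k v) = Polynomial.C (etaStar k v) := by
    rw [← hv, map_mul, map_pow, hδ, hδt]
    simp [e]
  obtain ⟨M1, hM1⟩ := exists_scale (δ xR)
  obtain ⟨M2, hM2⟩ := exists_scale (δ yR)
  obtain ⟨g1, hg1⟩ := hM1 (M1 + M2) (by omega)
  obtain ⟨g2, hg2⟩ := hM2 (M1 + M2) (by omega)
  rw [hδ0] at hg1 hg2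
  have htM : (tR ^ (M1 + M2) : SL2Ring k) ≠ 0 := pow_ne_zero _ tR_ne
  let δ1 : B3 k →ₐ[k] Polynomial (B3 k) :=
    aeval ![Polynomial.C (X 0), Polynomial.C (X 1) + g1, Polynomial.C (X 2) + g2]
  have hδ1 : ∀ b, (δ1 b).map (etaStar k).toRingHom =
      (δ (etaStar k b)).comp (Polynomial.C (tR ^ (M1 + M2)) * Polynomial.X) := by
    intro b
    have : (Polynomial.mapAlgHom (etaStar k)).comp δ1 =
        ((Polynomial.aeval (Polynomial.C (tR ^ (M1 + M2) : SL2Ring k) * Polynomial.X) :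
          Polynomial (SL2Ring k) →ₐ[SL2Ring k] Polynomial (SL2Ring k)).restrictScalars k).comp
          (δ.comp (etaStar k)) := by
      refine algHomB_ext (A := Polynomial (SL2Ring k)) ?_ ?_ ?_
      · simp [hδt, δ1]
      · have h1 : δ1 (X 1) = Polynomial.C (X 1) + g1 := by simp [δ1]
        simp only [AlgHom.comp_apply, h1, eta_X1, Polynomial.coe_mapAlgHom, map_add]
        show Polynomial.map (etaStar k).toRingHom (Polynomial.C (X 1)) +
          Polynomial.map (etaStar k).toRingHom g1 = Polynomial.comp _ _
        rw [hg1, Polynomial.map_C]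
        show Polynomial.C (etaStar k (X 1)) + _ = _
        rw [eta_X1]; ring
      · have h1 : δ1 (X 2) = Polynomial.C (X 2) + g2 := by simp [δ1]
        simp only [AlgHom.comp_apply, h1, eta_X2, Polynomial.coe_mapAlgHom, map_add]
        show Polynomial.map (etaStar k).toRingHom (Polynomial.C (X 2)) +
          Polynomial.map (etaStar k).toRingHom g2 = Polynomial.comp _ _
        rw [hg2, Polynomial.map_C]
        show Polynomial.C (etaStar k (X 2)) + _ = _
        rw [eta_X2]; ring
    exact congrArg (fun h : B3 k →ₐ[k] _ => h b) this
  have hc : ∀ b i, etaStar k ((δ1 b).coeff i) =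
      (δ (etaStar k b)).coeff i * (tR ^ (M1 + M2)) ^ i := by
    intro b i
    have := congrArg (fun q => Polynomial.coeff q i) (hδ1 b)
    simp only [Polynomial.coeff_map, Polynomial.comp_C_mul_X_coeff] at this
    exact this
  have hc0 : ∀ b, (δ1 b).coeff 0 = b := by
    intro b
    apply eta_inj
    rw [hc, hδ0, pow_zero, mul_one]
  have hdeltaV : δ1 v = Polynomial.C v := by
    ext1 i
    apply eta_inj
    rw [hc, hδv]
    by_cases hi : i = 0
    · subst hi; simp
    · simp [Polynomial.coeff_C, hi]
  have hA := lemA δ1 (by simp [δ1]) (hc0 _) (hc0 _) v hdeltaV hv0 hvd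
  have hconst : ∀ b r, etaStar k b = r → (∀ i, i ≠ 0 → (δ1 b).coeff i = 0) →
      δ r = Polynomial.C r := by
    rintro b r rfl h
    ext1 i
    by_cases hi : i = 0
    · subst hi; rw [hδ0]; simp
    · rw [Polynomial.coeff_C, if_neg hi]
      have := hc b i
      rw [h i hi, map_zero] at this
      exact (mul_eq_zero.1 this.symm).resolve_right (pow_ne_zero _ htM)
  have hx := hconst (X 1) xR eta_X1 (fun i hi => (hA i hi).1)
  have hy := hconst (X 2) yR eta_X2 (fun i hi => (hA i hi).2)
  have hu : δ uR = Polynomial.C uR := by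
    have h1 : δ xR * δ yR = δ tR * δ uR + 1 := by
      rw [← map_mul, rel_R]; simp
    have h2 : (Polynomial.C xR * Polynomial.C yR : Polynomial (SL2Ring k)) =
        Polynomial.C tR * Polynomial.C uR + 1 := by
      rw [← Polynomial.C_mul, rel_R]; simp
    rw [hx, hy, h2, hδt, add_left_inj] at h1
    exact (mul_left_cancel₀ (by simpa using tR_ne) h1).symm
  have hall : δ = (Algebra.ofId (SL2Ring k) (Polynomial (SL2Ring k))).restrictScalars k := by
    refine homA_ext (A := Polynomial (SL2Ring k)) ?_ ?_ ?_ ?_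
    · rw [hδt]; rfl
    · rw [hu]; rfl
    · rw [hx]; rfl
    · rw [hy]; rfl
  have h1 := hδ yR
  rw [hall] at h1
  have h2 : Polynomial.C (Φ yR) = e yR := h1
  have h3 := congrArg (fun q => Polynomial.coeff q 1) h2
  simp only [e, liftA_y, Polynomial.coeff_add, Polynomial.coeff_C_mul, Polynomial.coeff_X_one,
    mul_one, ht] at h3
  simp only [Polynomial.coeff_C_succ, zero_add] at h3
  exact hαt h3.symm

def swR : SL2Ring k ≃ₐ[k] SL2Ring k :=
  AlgEquiv.ofAlgHom (liftA tR uR yR xR (by rw [mul_comm, rel_R]))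
    (liftA tR uR yR xR (by rw [mul_comm, rel_R]))
    (by apply homA_ext <;> simp) (by apply homA_ext <;> simp)

theorem S6 (Φ : SL2Ring k ≃ₐ[k] SL2Ring k) (α : k) (hα : α ≠ 0)
    (ht : Φ tR = algebraMap k _ α * tR) (b : B3 k) : ∃ b', Φ (etaStar k b) = etaStar k b' := by
  obtain ⟨p, hp⟩ := S6x Φ α hα ht
  obtain ⟨q, hq⟩ := S6x (swR.trans Φ) α hα (by simp [swR, ht])
  have hq' : Φ yR = etaStar k q := by rw [← hq]; simp [swR]
  have : Φ.toAlgHom.comp (etaStar k) = (etaStar k).comp (aeval ![C α * X 0, p, q]) := by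
    apply algHomB_ext
    · simp [ht]
    · simp [hp]
    · simp [hq']
  exact ⟨_, congrArg (fun h : B3 k →ₐ[k] _ => h b) this⟩

theorem S6_equiv (Φ : SL2Ring k ≃ₐ[k] SL2Ring k) (α : k) (hα : α ≠ 0)
    (ht : Φ tR = algebraMap k _ α * tR) :
    ∃ ψ : B3 k ≃ₐ[k] B3 k, ∀ b, etaStar k (ψ b) = Φ (etaStar k b) := by
  choose f hf using S6 Φ α hα ht
  have ht' : Φ.symm tR = algebraMap k _ α⁻¹ * tR := by
    rw [AlgEquiv.symm_apply_eq, map_mul, AlgEquiv.commutes, ht, ← mul_assoc, ← map_mul,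
      inv_mul_cancel₀ hα, map_one, one_mul]
  choose g hg using S6 Φ.symm α⁻¹ (inv_ne_zero hα) ht'
  refine ⟨{ toFun := f, invFun := g, left_inv := ?_, right_inv := ?_, map_mul' := ?_,
            map_add' := ?_, commutes' := ?_ }, fun b => (hf b).symm⟩
  · intro b; apply eta_inj; rw [← hg, ← hf]; simp
  · intro b; apply eta_inj; rw [← hf, ← hg]; simp
  · intro a b; apply eta_inj; rw [map_mul, ← hf, ← hf, ← hf]; simp
  · intro a b; apply eta_inj; rw [map_add, ← hf, ← hf, ← hf]; simp
  · intro r; apply eta_inj; rw [← hf, AlgHom.commutes, AlgEquiv.commutes]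

end SLP
end

end

section
section
namespace SLP
variable {k : Type*} [Field k]

/-! ### Base change -/

variable (K : Type*) [Field K] [Algebra k K]

def bc : B3 k →+* B3 K := MvPolynomial.map (algebraMap k K)

@[simp] theorem bc_X (i : Fin 3) : bc K (X i : B3 k) = X i := by simp [bc]
@[simp] theorem bc_C (c : k) : bc K (C c : B3 k) = C (algebraMap k K c) := by simp [bc]

theorem bc_inj : Function.Injective (bc (k := k) K) :=
  MvPolynomial.map_injective _ (algebraMap k K).injective

def bcR : SL2Ring k →+* SL2Ring K :=
  liftR ((algebraMap K (SL2Ring K)).comp (algebraMap k K)) tR uR xR yR rel_R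

@[simp] theorem bcR_t : bcR K (tR : SL2Ring k) = tR := liftR_t _ _ _ _ _ _
@[simp] theorem bcR_u : bcR K (uR : SL2Ring k) = uR := liftR_u _ _ _ _ _ _
@[simp] theorem bcR_x : bcR K (xR : SL2Ring k) = xR := liftR_x _ _ _ _ _ _
@[simp] theorem bcR_y : bcR K (yR : SL2Ring k) = yR := liftR_y _ _ _ _ _ _
@[simp] theorem bcR_C (c : k) : bcR K (algebraMap k (SL2Ring k) c) =
    algebraMap K _ (algebraMap k K c) := liftR_C _ _ _ _ _ _ _

theorem bcR_eta (b : B3 k) : bcR K (etaStar k b) = etaStar K (bc K b) := by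
  have : (bcR K).comp (etaStar k).toRingHom = (etaStar K).toRingHom.comp (bc K) := by
    apply MvPolynomial.ringHom_ext
    · intro r; simp
    · intro i; fin_cases i <;> simp
  exact RingHom.congr_fun this b

variable {K}

/-- extension of scalars of a homomorphism -/
def extK {S : Type*} [CommRing S] [Algebra K S] (f : SL2Ring k →+* S) : SL2Ring K →ₐ[K] S :=
  liftA (f tR) (f uR) (f xR) (f yR) (by rw [← map_mul, rel_R]; simp)

theorem extK_bcR {S : Type*} [CommRing S] [Algebra K S] (f : SL2Ring k →+* S)
    (hf : ∀ c : k, f (algebraMap k _ c) = algebraMap K S (algebraMap k K c)) (r : SL2Ring k) :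
    extK (K := K) f (bcR K r) = f r := by
  have : (extK (K := K) f).toRingHom.comp (bcR K) = f := by
    apply homR_ext <;> simp [extK, hf]
  exact RingHom.congr_fun this r

theorem extK_ext {S : Type*} [CommRing S] [Algebra K S] {f g : SL2Ring K →ₐ[K] S}
    (h : ∀ r : SL2Ring k, f (bcR K r) = g (bcR K r)) : f = g := by
  apply homA_ext
  · simpa using h tR
  · simpa using h uR
  · simpa using h xR
  · simpa using h yR

variable (K) in
def PhiK (Φ : SL2Ring k →ₐ[k] SL2Ring k) : SL2Ring K →ₐ[K] SL2Ring K :=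
  extK ((bcR K).comp Φ.toRingHom)

theorem PhiK_bcR (Φ : SL2Ring k →ₐ[k] SL2Ring k) (r : SL2Ring k) :
    PhiK K Φ (bcR K r) = bcR K (Φ r) := by
  rw [PhiK, extK_bcR]
  · rfl
  · intro c
    show bcR K (Φ _) = _
    rw [AlgHom.commutes]; simp

variable (K) in
def PhiKe (Φ : SL2Ring k ≃ₐ[k] SL2Ring k) : SL2Ring K ≃ₐ[K] SL2Ring K :=
  AlgEquiv.ofAlgHom (PhiK K Φ.toAlgHom) (PhiK K Φ.symm.toAlgHom)
    (extK_ext (k := k) (fun r => by simp [PhiK_bcR]))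
    (extK_ext (k := k) (fun r => by simp [PhiK_bcR]))

theorem PhiKe_bcR (Φ : SL2Ring k ≃ₐ[k] SL2Ring k) (r : SL2Ring k) :
    PhiKe K Φ (bcR K r) = bcR K (Φ r) := PhiK_bcR Φ.toAlgHom r

variable (K) in
theorem planeHom_bc {P : B3 k} {φ : SL2Ring k →ₐ[k] MvPolynomial (Fin 2) k} (h : PlaneHom P φ) :
    ∃ φ' : SL2Ring K →ₐ[K] MvPolynomial (Fin 2) K, PlaneHom (bc K P) φ' := by
  let mp : MvPolynomial (Fin 2) k →+* MvPolynomial (Fin 2) K := MvPolynomial.map (algebraMap k K)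
  let φ' : SL2Ring K →ₐ[K] MvPolynomial (Fin 2) K := extK (mp.comp φ.toRingHom)
  have hφ' : ∀ r, φ' (bcR K r) = mp (φ r) := by
    intro r
    simp only [φ']
    rw [extK_bcR]
    · rfl
    · intro c
      show mp (φ _) = _
      rw [AlgHom.commutes]
      simp [mp, MvPolynomial.algebraMap_eq]
  choose a ha using fun i : Fin 2 => h.surj (X i)
  let σ0 : MvPolynomial (Fin 2) k →ₐ[k] SL2Ring k := aeval a
  let σ : MvPolynomial (Fin 2) K →ₐ[K] SL2Ring K := aeval (fun i => bcR K (a i))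
  have hσ : ∀ q, σ (mp q) = bcR K (σ0 q) := by
    intro q
    have : σ.toRingHom.comp mp = (bcR K).comp σ0.toRingHom := by
      apply MvPolynomial.ringHom_ext
      · intro r; simp [σ, σ0, mp, ← MvPolynomial.algebraMap_eq]
      · intro i; simp [σ, σ0, mp]
    exact RingHom.congr_fun this q
  have hσ0 : ∀ q, φ (σ0 q) = q := by
    intro q
    have : φ.comp σ0 = AlgHom.id k _ := by
      apply MvPolynomial.algHom_ext
      intro i; simp [σ0, ha]
    exact congrArg (fun f : MvPolynomial (Fin 2) k →ₐ[k] _ => f q) this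
  have hφP : φ' (etaStar K (bc K P)) = 0 := by
    rw [← bcR_eta, hφ', (h.ker _).2 dvd_rfl, map_zero]
  refine ⟨φ', ?_, ?_⟩
  · intro q
    refine ⟨σ q, ?_⟩
    have : φ'.comp σ = AlgHom.id K _ := by
      apply MvPolynomial.algHom_ext
      intro i; simp [σ, hφ', ha, mp]
    exact congrArg (fun f : MvPolynomial (Fin 2) K →ₐ[K] _ => f q) this
  · intro r
    constructor
    · intro hr
      let I : Ideal (SL2Ring K) := Ideal.span {etaStar K (bc K P)}
      have : (Ideal.Quotient.mkₐ K I).comp (σ.comp φ') = Ideal.Quotient.mkₐ K I := by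
        refine extK_ext (k := k) (S := SL2Ring K ⧸ I) ?_
        intro r
        rw [AlgHom.comp_apply, AlgHom.comp_apply, hφ', hσ, ← sub_eq_zero, ← map_sub, ← map_sub]
        rw [Ideal.Quotient.mkₐ_eq_mk, Ideal.Quotient.eq_zero_iff_mem, Ideal.mem_span_singleton,
          ← bcR_eta]
        apply map_dvd
        rw [← h.ker, map_sub, hσ0, sub_self]
      have h2 := congrArg (fun f : SL2Ring K →ₐ[K] _ => f r) this
      simp only [AlgHom.comp_apply, hr, map_zero] at h2
      rw [Ideal.Quotient.mkₐ_eq_mk, eq_comm, Ideal.Quotient.eq_zero_iff_mem,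
        Ideal.mem_span_singleton] at h2
      exact h2
    · rintro ⟨c, rfl⟩
      rw [map_mul, hφP, zero_mul]

variable (K) in
theorem isVar_bc {P : B3 k} (hP : IsVarOverRatFunc k P) : IsVarOverRatFunc K (bc K P) := by
  obtain ⟨ψ, hψ⟩ := hP
  obtain ⟨j, hj⟩ : ∃ j : RatFunc k →+* RatFunc K, ∀ p : Polynomial k,
      j (ktoF p) = ktoF (p.map (algebraMap k K)) := by
    refine ⟨RatFunc.liftRingHom (ktoF.comp (Polynomial.mapRingHom (algebraMap k K))) ?_, ?_⟩
    · intro p hp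
      rw [Submonoid.mem_comap]
      apply mem_nonZeroDivisors_of_ne_zero
      have := nonZeroDivisors.ne_zero hp
      rw [RingHom.comp_apply]
      apply RatFunc.algebraMap_ne_zero
      simpa using this
    · intro p
      rw [RatFunc.liftRingHom_algebraMap]; rfl
  let mp : MvPolynomial (Fin 2) (RatFunc k) →+* MvPolynomial (Fin 2) (RatFunc K) :=
    MvPolynomial.map j
  let E : (MvPolynomial (Fin 2) (RatFunc k) →ₐ[RatFunc k] MvPolynomial (Fin 2) (RatFunc k)) →
      (MvPolynomial (Fin 2) (RatFunc K) →ₐ[RatFunc K] MvPolynomial (Fin 2) (RatFunc K)) :=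
    fun f => aeval (fun i => mp (f (X i)))
  have hE : ∀ f q, E f (mp q) = mp (f q) := by
    intro f q
    have : (E f).toRingHom.comp mp = mp.comp f.toRingHom := by
      apply MvPolynomial.ringHom_ext
      · intro r
        simp [mp, E, ← MvPolynomial.algebraMap_eq]
      · intro i; simp [mp, E]
    exact RingHom.congr_fun this q
  have hE1 : ∀ f g, (∀ q, f (g q) = q) → (E f).comp (E g) = AlgHom.id _ _ := by
    intro f g h
    apply MvPolynomial.algHom_ext
    intro i
    have : (X i : MvPolynomial (Fin 2) (RatFunc K)) = mp (X i) := by simp [mp]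
    rw [this, AlgHom.comp_apply, hE, hE, h]; rfl
  refine ⟨AlgEquiv.ofAlgHom (E ψ.toAlgHom) (E ψ.symm.toAlgHom) (hE1 _ _ (by simp))
    (hE1 _ _ (by simp)), ?_⟩
  have h1 : ∀ b, toRatFuncXY K (bc K b) = mp (toRatFuncXY k b) := by
    intro b
    have : (toRatFuncXY K).toRingHom.comp (bc K) = mp.comp (toRatFuncXY k).toRingHom := by
      apply MvPolynomial.ringHom_ext
      · intro r
        simp only [RingHom.comp_apply, bc_C]
        show toRatFuncXY K (C _) = mp (toRatFuncXY k (C _))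
        rw [toRat_C, toRat_C, MvPolynomial.map_C, hj, Polynomial.map_C]
      · intro i
        show toRatFuncXY K (bc K (X i)) = mp (toRatFuncXY k (X i))
        rw [bc_X]
        fin_cases i
        · show toRatFuncXY K (X 0) = mp (toRatFuncXY k (X 0))
          rw [toRat_X0, toRat_X0, MvPolynomial.map_C, hj, Polynomial.map_X]
        · show toRatFuncXY K (X 1) = mp (toRatFuncXY k (X 1))
          rw [toRat_X1, toRat_X1, MvPolynomial.map_X]
        · show toRatFuncXY K (X 2) = mp (toRatFuncXY k (X 2))
          rw [toRat_X2, toRat_X2, MvPolynomial.map_X]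
    exact RingHom.congr_fun this b
  show E _ _ = _
  rw [h1, hE]
  show mp (ψ _) = _
  rw [hψ]; simp [mp]

end SLP
end

end

section
section
namespace SLP
variable {k : Type*} [Field k]

/-! ### Descent -/

section
variable (K : Type*) [Field K] [Algebra k K]

theorem descent_t (Φ : SL2Ring k ≃ₐ[k] SL2Ring k) (α : K) (hα : α ≠ 0)
    (h : PhiKe K Φ tR = algebraMap K _ α * tR) :
    ∃ a : k, a ≠ 0 ∧ Φ tR = algebraMap k _ a * tR := by
  obtain ⟨n, b, hb⟩ := exists_t_pow (Φ tR)
  have h1 : bc K b = C α * X 0 ^ (n + 1) := by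
    apply eta_inj
    rw [← bcR_eta, ← hb, map_mul, map_pow, bcR_t, ← PhiKe_bcR, bcR_t, h, map_mul, map_pow, eta_X0,
      eta_C]
    ring
  have h2 : algebraMap k K (coeff (Finsupp.single 0 (n + 1)) b) = α := by
    have := congrArg (coeff (Finsupp.single 0 (n + 1))) h1
    rw [bc, coeff_map] at this
    rw [this, coeff_C_mul, coeff_X_pow, if_pos rfl, mul_one]
  set a := coeff (Finsupp.single 0 (n + 1)) b with ha
  have h3 : b = C a * X 0 ^ (n + 1) := by
    apply bc_inj K
    rw [h1, map_mul, map_pow, bc_C, bc_X, h2]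
  refine ⟨a, ?_, ?_⟩
  · rintro h0; rw [h0, map_zero] at h2; exact hα h2.symm
  · apply mul_left_cancel₀ (pow_ne_zero n (tR_ne (k := k)))
    rw [hb, h3, map_mul, map_pow, eta_X0, eta_C]; ring

variable {K}

/-- coefficientwise retraction -/
def ret (r : K →ₗ[k] k) (q : B3 K) : B3 k :=
  ∑ m ∈ q.support, monomial m (r (coeff m q))

theorem coeff_ret (r : K →ₗ[k] k) (q : B3 K) (m) : coeff m (ret r q) = r (coeff m q) := by
  classical
  rw [ret, coeff_sum]
  simp only [coeff_monomial, Finset.sum_ite_eq', mem_support_iff]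
  split_ifs with h
  · rfl
  · rw [not_not] at h; rw [h, map_zero]

theorem ret_add (r : K →ₗ[k] k) (p q : B3 K) : ret r (p + q) = ret r p + ret r q := by
  ext m; simp [coeff_ret]

theorem ret_bc_mul (r : K →ₗ[k] k) (p : B3 k) (q : B3 K) :
    ret r (bc K p * q) = p * ret r q := by
  classical
  ext m
  rw [coeff_ret, coeff_mul, coeff_mul, map_sum]
  refine Finset.sum_congr rfl fun x _ => ?_
  rw [bc, coeff_map, coeff_ret, ← Algebra.smul_def, map_smul, smul_eq_mul]

theorem ret_C (r : K →ₗ[k] k) (c : K) : ret r (C c) = C (r c) := by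
  classical
  ext m
  rw [coeff_ret, coeff_C, coeff_C]
  split_ifs <;> simp

theorem ret_bc (r : K →ₗ[k] k) (hr : r 1 = 1) (p : B3 k) : ret r (bc K p) = p := by
  rw [← mul_one (bc K p), ret_bc_mul, ← C_1, ret_C, hr, C_1, mul_one]

theorem ret_aeval {σ : Type*} (r : K →ₗ[k] k) (f : σ → B3 k) (q : MvPolynomial σ K) :
    ∃ q' : MvPolynomial σ k, ret r (aeval (fun i => bc K (f i)) q) = aeval f q' := by
  induction q using MvPolynomial.induction_on' with
  | monomial m c =>
    refine ⟨monomial m (r c), ?_⟩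
    rw [aeval_monomial, aeval_monomial]
    have : (m.prod fun i e => bc K (f i) ^ e) = bc K (m.prod fun i e => f i ^ e) := by
      simp [Finsupp.prod]
    rw [this, mul_comm, ret_bc_mul, MvPolynomial.algebraMap_eq, ret_C, mul_comm,
      MvPolynomial.algebraMap_eq]
  | add p q hp hq =>
    obtain ⟨p', hp'⟩ := hp
    obtain ⟨q', hq'⟩ := hq
    exact ⟨p' + q', by rw [map_add, ret_add, hp', hq', map_add]⟩

end

/-! comparison of `kap` with `aeval` -/

def e3 (P s : B3 k) : B3 k →ₐ[k] B3 k := aeval ![X 0, P, s]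

@[simp] theorem e3_X0 (P s : B3 k) : e3 P s (X 0) = X 0 := by simp [e3]
@[simp] theorem e3_X1 (P s : B3 k) : e3 P s (X 1) = P := by simp [e3]
@[simp] theorem e3_X2 (P s : B3 k) : e3 P s (X 2) = s := by simp [e3]

def w3 : B3 k →+* W3 k := eval₂Hom (S₁ := W3 k)
  (Polynomial.C.comp (Polynomial.C.comp (Polynomial.C : k →+* Polynomial k)) : k →+* W3 k)
  ![Polynomial.C Polynomial.X, Polynomial.C (Polynomial.C Polynomial.X), Polynomial.X]

def w3i : W3 k →+* B3 k := kap (X 1) (X 2)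

theorem w3_w3i (G : W3 k) : w3 (w3i G) = G := by
  have : w3.comp w3i = RingHom.id (W3 k) := by
    refine W3_hom_ext (A := W3 k) (k := k) ?_ ?_ ?_ ?_
    · intro r; simp [w3i, kap_CC, w3]
    · simp [w3i, kap_CC, w3]
    · simp [w3i, kap_CX, w3]
    · simp [w3i, kap_X, w3]
  exact RingHom.congr_fun this G

theorem e3_w3i (P s : B3 k) (G : W3 k) : e3 P s (w3i G) = kap P s G := by
  have : (e3 P s).toRingHom.comp w3i = kap P s := by
    apply W3_hom_ext
    · intro r; simp [w3i, kap_CC]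
    · simp [w3i, kap_CC]
    · simp [w3i, kap_CX]
    · simp [w3i, kap_X]
  exact RingHom.congr_fun this G

theorem e3_surj {P s : B3 k} (h : Function.Surjective (kap P s)) :
    Function.Surjective (e3 P s) := by
  intro b
  obtain ⟨G, rfl⟩ := h b
  exact ⟨_, e3_w3i P s G⟩

theorem noeth_inj {A : Type*} [CommRing A] [IsNoetherianRing A] (f : A →+* A)
    (hf : Function.Surjective f) : Function.Injective f := by
  rw [injective_iff_map_eq_zero]
  intro x hx
  have hmono : Monotone (fun n : ℕ => RingHom.ker (f ^ n)) := by
    refine monotone_nat_of_le_succ fun n a ha => ?_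
    rw [RingHom.mem_ker] at ha ⊢
    rw [pow_succ', RingHom.mul_def, RingHom.comp_apply, ha, map_zero]
  obtain ⟨n, hn⟩ := monotone_stabilizes_iff_noetherian.2
    (inferInstance : IsNoetherian A A) ⟨_, hmono⟩
  have hs : Function.Surjective (f ^ n) := by
    rw [RingHom.coe_pow]; exact hf.iterate n
  obtain ⟨y, rfl⟩ := hs x
  have h1 : y ∈ RingHom.ker (f ^ (n + 1)) := by
    rw [RingHom.mem_ker, pow_succ', RingHom.mul_def, RingHom.comp_apply, hx]
  have h2 : RingHom.ker (f ^ n) = RingHom.ker (f ^ (n + 1)) := hn (n + 1) (Nat.le_succ n)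
  rw [← h2] at h1
  exact h1

theorem e3_inj {P s : B3 k} (h : Function.Surjective (e3 P s)) :
    Function.Injective (e3 P s) :=
  noeth_inj (e3 P s).toRingHom h

theorem kap_inj' {P s : B3 k} (h : Function.Surjective (kap P s)) :
    Function.Injective (kap P s) := by
  intro G G' hG
  rw [← e3_w3i, ← e3_w3i] at hG
  have := e3_inj (e3_surj h) hG
  rw [← w3_w3i G, this, w3_w3i]

theorem jac_unit {P s : B3 k} (h : Function.Surjective (e3 P s)) :
    ∃ u : k, u ≠ 0 ∧ DB P s = C u := by
  have hu : IsUnit (DB P s) := by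
    obtain ⟨p, hp⟩ := h (X 1)
    obtain ⟨q, hq⟩ := h (X 2)
    have a1 := chain_rule (e3 P s) (pderiv 1) p
    have a2 := chain_rule (e3 P s) (pderiv 2) p
    have b1 := chain_rule (e3 P s) (pderiv 1) q
    have b2 := chain_rule (e3 P s) (pderiv 2) q
    rw [hp] at a1 a2
    rw [hq] at b1 b2
    simp only [Fin.sum_univ_three, e3_X0, e3_X1, e3_X2, pderiv_X_self,
      pderiv_X_of_ne (show (0 : Fin 3) ≠ 1 by decide), pderiv_X_of_ne (show (0 : Fin 3) ≠ 2 by decide),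
      pderiv_X_of_ne (show (1 : Fin 3) ≠ 2 by decide),
      pderiv_X_of_ne (show (2 : Fin 3) ≠ 1 by decide), mul_zero, zero_add] at a1 a2 b1 b2
    refine IsUnit.of_mul_eq_one (e3 P s (pderiv 1 p) * e3 P s (pderiv 2 q) -
      e3 P s (pderiv 2 p) * e3 P s (pderiv 1 q)) ?_
    rw [DB_apply]
    linear_combination (-1 : B3 k) * (e3 P s (pderiv 1 q) * pderiv 2 P + e3 P s (pderiv 2 q) * pderiv 2 s) * a1
      + (e3 P s (pderiv 1 q) * pderiv 1 P + e3 P s (pderiv 2 q) * pderiv 1 s) * a2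
      - b2
  rw [MvPolynomial.isUnit_iff_eq_C_of_isReduced] at hu
  obtain ⟨u, h1, h2⟩ := hu
  exact ⟨u, h1.ne_zero, h2⟩

theorem kap_comp (P s : B3 k) (G H : W3 k) : kap P (kap P s G) H = kap P s (H.comp G) := by
  have : kap P (kap P s G) = (kap P s).comp (Polynomial.compRingHom G) := by
    apply W3_hom_ext
    · intro r; simp [kap_CC]
    · simp [kap_CC]
    · simp [kap_CX]
    · simp [kap_X]
  exact RingHom.congr_fun this H

theorem DB_kap_C (P s : B3 k) (g : Polynomial (Polynomial k)) :
    DB P (kap P s (Polynomial.C g)) = 0 := by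
  induction g using Polynomial.induction_on' with
  | add p q hp hq => rw [Polynomial.C_add, map_add, map_add, hp, hq, add_zero]
  | monomial n a =>
    rw [← Polynomial.C_mul_X_pow_eq_monomial, Polynomial.C_mul, Polynomial.C_pow, map_mul, map_pow,
      kap_CC, kap_CX, Derivation.leibniz, Derivation.leibniz_pow, DB_aeval, DB_X0]
    simp

section
variable (K : Type*) [Field K] [Algebra k K]

theorem bc_kt (θ : Polynomial k) : bc K (kt θ) = kt (θ.map (algebraMap k K)) := by
  have : (bc K).comp (kt (k := k)).toRingHom =
      (kt (k := K)).toRingHom.comp (Polynomial.mapRingHom (algebraMap k K)) := by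
    apply Polynomial.ringHom_ext
    · intro a; simp [kt]
    · simp [kt]
  exact RingHom.congr_fun this θ

def bcW : W3 k →+* W3 K :=
  Polynomial.mapRingHom (Polynomial.mapRingHom (Polynomial.mapRingHom (algebraMap k K)))

theorem bc_kap (P s : B3 k) (G : W3 k) : bc K (kap P s G) = kap (bc K P) (bc K s) (bcW K G) := by
  have : (bc K).comp (kap P s) = (kap (bc K P) (bc K s)).comp (bcW K) := by
    apply W3_hom_ext
    · intro r; simp [kap_CC, bcW]
    · simp [kap_CC, bcW]
    · simp [kap_CX, bcW]
    · simp [kap_X, bcW]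
  exact RingHom.congr_fun this G

theorem bc_pderiv (i : Fin 3) (b : B3 k) : bc K (pderiv i b) = pderiv i (bc K b) := by
  rw [bc, MvPolynomial.pderiv_map]

theorem bc_DB (P s : B3 k) : bc K (DB P s) = DB (bc K P) (bc K s) := by
  rw [DB_apply, DB_apply, map_sub, map_mul, map_mul]
  simp only [bc_pderiv]

theorem GV_bc {P s : B3 k} (h : GV P s) : GV (bc K P) (bc K s) := by
  intro b
  induction b using MvPolynomial.induction_on with
  | C a =>
    exact ⟨1, one_ne_zero, Polynomial.C (Polynomial.C (Polynomial.C a)), by simp [kap_CC]⟩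
  | add p q hp hq =>
    obtain ⟨θ, h1, G, h2⟩ := hp
    obtain ⟨θ', h1', G', h2'⟩ := hq
    refine ⟨θ * θ', mul_ne_zero h1 h1', Polynomial.C (θ'.map Polynomial.C) * G +
      Polynomial.C (θ.map Polynomial.C) * G', ?_⟩
    simp only [map_add, map_mul, kap_kt, ← h2, ← h2']; ring
  | mul_X p i hp =>
    obtain ⟨θ, h1, G, h2⟩ := hp
    obtain ⟨θ', h1', G', h2'⟩ := h (X i)
    have h3 := congrArg (bc K) h2'
    rw [map_mul, bc_X, bc_kt, bc_kap] at h3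
    refine ⟨θ * θ'.map (algebraMap k K), mul_ne_zero h1 ?_, G * bcW K G', ?_⟩
    · simpa using h1'
    · rw [map_mul, map_mul, ← h2, ← h3]; ring


variable {K}

theorem kapK_range {P s s' : B3 K} (h : Function.Surjective (e3 P s))
    (h' : s ∈ (e3 P s').range) : Function.Surjective (e3 P s') := by
  have h1 : (e3 P s).range ≤ (e3 P s').range := by
    rintro _ ⟨b, rfl⟩
    show e3 P s b ∈ _
    induction b using MvPolynomial.induction_on with
    | C a => rw [← MvPolynomial.algebraMap_eq, AlgHom.commutes]; exact Subalgebra.algebraMap_mem _ _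
    | add p q hp hq => rw [map_add]; exact Subalgebra.add_mem _ hp hq
    | mul_X p i hp =>
      rw [map_mul]
      refine Subalgebra.mul_mem _ hp ?_
      fin_cases i
      · exact ⟨X 0, by simp⟩
      · exact ⟨X 1, by simp⟩
      · show e3 P s (X 2) ∈ _
        rw [e3_X2]; exact h'
  intro b
  obtain ⟨c, rfl⟩ := h b
  exact h1 ⟨c, rfl⟩

theorem kap_mem_range (P s : B3 K) (G : W3 K) : kap P s G ∈ (e3 P s).range :=
  ⟨w3i G, e3_w3i P s G⟩

theorem kap_C_indep (P s s' : B3 K) (g : Polynomial (Polynomial K)) :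
    kap P s (Polynomial.C g) = kap P s' (Polynomial.C g) := by
  simp only [kap, Polynomial.coe_eval₂RingHom, Polynomial.eval₂_C]

theorem e3_zero (P s q : B3 K) : ∃ z, e3 P 0 q = kap P s (Polynomial.C z) := by
  induction q using MvPolynomial.induction_on with
  | C a => exact ⟨Polynomial.C (Polynomial.C a), by rw [kap_CC]; simp [e3]⟩
  | add p q hp hq =>
    obtain ⟨z, hz⟩ := hp
    obtain ⟨z', hz'⟩ := hq
    exact ⟨z + z', by rw [map_add, hz, hz', Polynomial.C_add, map_add]⟩
  | mul_X p i hp =>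
    obtain ⟨z, hz⟩ := hp
    fin_cases i
    · refine ⟨z * Polynomial.X, ?_⟩
      show e3 P 0 (p * X 0) = _
      rw [map_mul, hz, Polynomial.C_mul, map_mul, kap_CX, e3_X0]
    · refine ⟨z * Polynomial.C Polynomial.X, ?_⟩
      show e3 P 0 (p * X 1) = _
      rw [map_mul, hz, Polynomial.C_mul, map_mul, kap_CC, e3_X1, Polynomial.aeval_X]
    · refine ⟨0, ?_⟩
      show e3 P 0 (p * X 2) = _
      rw [map_mul, e3_X2, mul_zero, Polynomial.C_0, map_zero]

/-- retraction preserves `K[t,P]` -/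
theorem ret_kap_C (r : K →ₗ[k] k) (P s : B3 k) (g : Polynomial (Polynomial K)) :
    ∃ G : B3 k, ret r (kap (bc K P) (bc K s) (Polynomial.C g)) = e3 P 0 G := by
  rw [kap_C_indep _ _ 0, ← e3_w3i]
  obtain ⟨q, hq⟩ := ret_aeval r ![X 0, P, 0] (w3i (Polynomial.C g))
  refine ⟨q, ?_⟩
  rw [← e3] at hq
  rw [← hq]
  congr 2
  apply algHomB_ext <;> simp

theorem VP_descent {P : B3 k} (hP : IsVarOverRatFunc k P) (h : VP (bc K P)) :
    ∃ s, Function.Surjective (e3 P s) := by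
  obtain ⟨s0, hGV, j, hj, hDB⟩ := lemma_IV P hP
  obtain ⟨s', hs'⟩ := h
  obtain ⟨r, hr⟩ := LinearMap.exists_leftInverse_of_injective (Algebra.linearMap k K)
    (LinearMap.ker_eq_bot.2 (algebraMap k K).injective)
  have hr1 : r 1 = 1 := by
    have := congrArg (fun f : k →ₗ[k] k => f 1) hr
    simpa using this
  have hinj := kap_inj' hs'
  have hsurj := e3_surj hs'
  obtain ⟨u, hu, hJ⟩ := jac_unit hsurj
  obtain ⟨G, hG⟩ := hs' (bc K s0)
  obtain ⟨θ, hθ, H, hH⟩ := GV_bc K hGV s'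
  -- degree of `G`
  have hdeg : G.natDegree = 1 := by
    have h1 : H.comp G = Polynomial.C (θ.map Polynomial.C) * Polynomial.X := by
      apply hinj
      rw [← kap_comp, hG, ← hH, map_mul, kap_kt, kap_X]
    have h2 := congrArg Polynomial.natDegree h1
    have hne : θ.map (Polynomial.C : K →+* Polynomial K) ≠ 0 :=
      (Polynomial.map_ne_zero_iff Polynomial.C_injective).2 hθ
    rw [Polynomial.natDegree_comp, Polynomial.natDegree_C_mul_X _ hne] at h2
    exact Nat.eq_one_of_mul_eq_one_left h2
  obtain ⟨g1, g0, hG10⟩ : ∃ g1 g0, G = Polynomial.C g1 * Polynomial.X + Polynomial.C g0 :=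
    ⟨_, _, Polynomial.eq_X_add_C_of_natDegree_le_one hdeg.le⟩
  have hs0 : bc K s0 = kap (bc K P) s' (Polynomial.C g1) * s' +
      kap (bc K P) s' (Polynomial.C g0) := by
    rw [← hG, hG10, map_add, map_mul, kap_X]
  have hg1 : bc K (kt j) = kap (bc K P) s' (Polynomial.C g1) * C u := by
    rw [← hDB, bc_DB, hs0, map_add, Derivation.leibniz, DB_kap_C, DB_kap_C, hJ]
    simp
  have hCu : (C u : B3 K) * C u⁻¹ = 1 := by rw [← C_mul, mul_inv_cancel₀ hu, C_1]
  set s1 : B3 K := C u⁻¹ * s' with hs1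
  have hs0' : bc K s0 = bc K (kt j) * s1 + kap (bc K P) s' (Polynomial.C g0) := by
    rw [hs0, hg1, hs1]
    linear_combination (-kap (bc K P) s' (Polynomial.C g1) * s') * hCu
  set s2 := ret r s1 with hs2
  obtain ⟨q, hq⟩ := ret_kap_C r P 0 g0
  have h3 : s0 = kt j * s2 + e3 P 0 q := by
    have := congrArg (ret r) hs0'
    rw [ret_bc r hr1, ret_add, ret_bc_mul, kap_C_indep _ _ (bc K (0 : B3 k)), hq] at this
    exact this
  -- `e3 P 0 q` is a polynomial in `t, P`
  obtain ⟨z0, hz0⟩ : ∃ z0, bc K (e3 P 0 q) = kap (bc K P) s' (Polynomial.C z0) := by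
    obtain ⟨z, hz⟩ := e3_zero P 0 q
    refine ⟨z.map (Polynomial.mapRingHom (algebraMap k K)), ?_⟩
    have hw : bcW K (Polynomial.C z) =
        Polynomial.C (z.map (Polynomial.mapRingHom (algebraMap k K))) := by simp [bcW]
    rw [hz, bc_kap, hw]
    exact kap_C_indep _ _ _ _
  have h4 : bc K (kt j) * (s1 - bc K s2) = kap (bc K P) s' (Polynomial.C (z0 - g0)) := by
    have := congrArg (bc K) h3
    rw [hs0', map_add, map_mul, hz0] at this
    have h5 : kap (bc K P) s' (Polynomial.C z0) = kap (bc K P) s' (Polynomial.C (z0 - g0)) +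
        kap (bc K P) s' (Polynomial.C g0) := by
      rw [← map_add, ← Polynomial.C_add, sub_add_cancel]
    rw [h5] at this
    linear_combination this
  obtain ⟨Z, hZ⟩ := hs' (s1 - bc K s2)
  have hZ0 : Z.natDegree = 0 := by
    have h5 : Polynomial.C ((j.map (algebraMap k K)).map Polynomial.C) * Z =
        Polynomial.C (z0 - g0) := by
      apply hinj
      rw [← h4, map_mul, kap_kt, hZ, bc_kt]
    have hne : (j.map (algebraMap k K)).map (Polynomial.C : K →+* Polynomial K) ≠ 0 :=
      (Polynomial.map_ne_zero_iff Polynomial.C_injective).2 (by simpa using hj)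
    have h6 := congrArg Polynomial.natDegree h5
    rwa [Polynomial.natDegree_C_mul hne, Polynomial.natDegree_C] at h6
  rw [Polynomial.eq_C_of_natDegree_eq_zero hZ0, kap_C_indep _ _ (bc K s2)] at hZ
  have h7 : Function.Surjective (e3 (bc K P) (bc K s2)) := by
    apply kapK_range hsurj
    have : s' = C u * (bc K s2 + kap (bc K P) (bc K s2) (Polynomial.C (Z.coeff 0))) := by
      rw [hZ, hs1]; linear_combination (-s') * hCu
    rw [this]
    refine Subalgebra.mul_mem _ ?_ (Subalgebra.add_mem _ ⟨X 2, by simp⟩ (kap_mem_range _ _ _))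
    rw [← MvPolynomial.algebraMap_eq]; exact Subalgebra.algebraMap_mem _ _
  refine ⟨s2, fun b => ?_⟩
  obtain ⟨c, hc⟩ := h7 (bc K b)
  obtain ⟨q', hq'⟩ := ret_aeval r ![X 0, P, s2] c
  refine ⟨q', ?_⟩
  rw [← e3] at hq'
  rw [← hq', ← ret_bc r hr1 b, ← hc]
  congr 2
  apply algHomB_ext <;> simp
end

end SLP
end

end

section
section
namespace SLP
variable {k : Type*} [Field k]

theorem planeHom_of_iso {P : B3 k}
    (h : Nonempty ((SL2Ring k ⧸ Ideal.span {etaStar k P}) ≃ₐ[k] MvPolynomial (Fin 2) k)) :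
    ∃ φ, PlaneHom P φ := by
  obtain ⟨e⟩ := h
  refine ⟨e.toAlgHom.comp (Ideal.Quotient.mkₐ k (Ideal.span {etaStar k P})), ?_, ?_⟩
  · intro b
    obtain ⟨r, hr⟩ := Ideal.Quotient.mk_surjective (e.symm b)
    refine ⟨r, ?_⟩
    show e (Ideal.Quotient.mk _ r) = b
    rw [hr, e.apply_symm_apply]
  · intro r
    show e (Ideal.Quotient.mk _ r) = 0 ↔ _
    rw [EmbeddingLike.map_eq_zero_iff, Ideal.Quotient.eq_zero_iff_mem, Ideal.mem_span_singleton]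

theorem final (P Q : B3 k) (hP : IsVarOverRatFunc k P) (hQ : IsVarOverRatFunc k Q)
    (hPiso : Nonempty ((SL2Ring k ⧸ Ideal.span {etaStar k P}) ≃ₐ[k] MvPolynomial (Fin 2) k))
    (hQiso : Nonempty ((SL2Ring k ⧸ Ideal.span {etaStar k Q}) ≃ₐ[k] MvPolynomial (Fin 2) k))
    (hequiv : ∃ Φ : SL2Ring k ≃ₐ[k] SL2Ring k,
      Ideal.map Φ (Ideal.span {etaStar k P}) = Ideal.span {etaStar k Q}) :
    ∃ ψ : B3 k ≃ₐ[k] B3 k, Ideal.map ψ (Ideal.span {P}) = Ideal.span {Q} := by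
  obtain ⟨Φ, hΦ⟩ := hequiv
  rw [Ideal.map_span, Set.image_singleton, Ideal.span_singleton_eq_span_singleton] at hΦ
  obtain ⟨v, hv⟩ := hΦ.symm
  obtain ⟨c, hc, hvc⟩ := unit_R v.isUnit
  have hΦ' : Φ (etaStar k P) = algebraMap k _ c * etaStar k Q := by
    rw [← hvc, mul_comm]; exact hv.symm
  obtain ⟨φ, hφ⟩ := planeHom_of_iso hPiso
  obtain ⟨φ', hφ'⟩ := planeHom_of_iso hQiso
  obtain ⟨χ, hχ⟩ := planeHom_bc (AlgebraicClosure k) hφ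
  obtain ⟨χ', hχ'⟩ := planeHom_bc (AlgebraicClosure k) hφ'
  have hK : PhiKe (AlgebraicClosure k) Φ (etaStar _ (bc (AlgebraicClosure k) P)) =
      algebraMap _ _ (algebraMap k (AlgebraicClosure k) c) *
        etaStar _ (bc (AlgebraicClosure k) Q) := by
    rw [← bcR_eta, PhiKe_bcR, hΦ', map_mul, bcR_C, bcR_eta]
  rcases Polynomial.core (isVar_bc _ hP) (isVar_bc _ hQ) hχ hχ' _ _
    (by simpa using hc) hK with ⟨h1, h2⟩ | ⟨γ, hγ, ht⟩
  · obtain ⟨s, hs⟩ := VP_descent hP h1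
    obtain ⟨s', hs'⟩ := VP_descent hQ h2
    let eP := AlgEquiv.ofBijective (e3 P s) ⟨e3_inj hs, hs⟩
    let eQ := AlgEquiv.ofBijective (e3 Q s') ⟨e3_inj hs', hs'⟩
    refine ⟨eP.symm.trans eQ, ?_⟩
    rw [Ideal.map_span, Set.image_singleton]
    have a : eP (X 1) = P := e3_X1 P s
    have b : eQ (X 1) = Q := e3_X1 Q s'
    have : (eP.symm.trans eQ) P = Q := by
      rw [AlgEquiv.trans_apply, ← b]
      congr 1
      rw [← a, AlgEquiv.symm_apply_apply]
    rw [this]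
  · obtain ⟨a, ha, hta⟩ := descent_t _ Φ γ hγ ht
    obtain ⟨ψ, hψ⟩ := S6_equiv Φ a ha hta
    refine ⟨ψ, ?_⟩
    rw [Ideal.map_span, Set.image_singleton]
    have h1 : ψ P = C c * Q := by
      apply eta_inj
      rw [hψ, hΦ', map_mul, eta_C]
    rw [h1, mul_comm]
    exact Ideal.span_singleton_mul_right_unit ((isUnit_iff_ne_zero.2 hc).map C) Q

end SLP
end

end

/-- **Theorem 3(2) (Blanc–van Santen).** If `P, Q ∈ k[t,x,y]` are variables of `k(t)[x,y]`
whose associated hypersurfaces `H_P, H_Q ⊂ SL₂` are isomorphic to `𝔸²` and equivalent under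
an automorphism of `SL₂`, then `Z_P, Z_Q ⊂ 𝔸³` are equivalent under an automorphism of
`𝔸³`. -/
theorem equivalence_in_SL2_implies_equivalence_in_A3
    (k : Type*) [Field k] (P Q : B3 k)
    (hP : IsVarOverRatFunc k P) (hQ : IsVarOverRatFunc k Q)
    (hPiso : Nonempty ((SL2Ring k ⧸ Ideal.span {etaStar k P}) ≃ₐ[k] MvPolynomial (Fin 2) k))
    (hQiso : Nonempty ((SL2Ring k ⧸ Ideal.span {etaStar k Q}) ≃ₐ[k] MvPolynomial (Fin 2) k))
    (hequiv : ∃ Φ : SL2Ring k ≃ₐ[k] SL2Ring k,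
        Ideal.map Φ (Ideal.span {etaStar k P}) = Ideal.span {etaStar k Q}) :
    ∃ ψ : B3 k ≃ₐ[k] B3 k,
      Ideal.map ψ (Ideal.span {P}) = Ideal.span {Q} := by
  exact SLP.final P Q hP hQ hPiso hQiso hequiv
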